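/- Let τ ↦ T_τ be a C² curve, defined on a neighbourhood (−ε,ε) of 0, of C⁷ expanding maps of the circle, and let g : S¹ → ℝ be C⁶. Then there is R > 1 such that for all u, τ sufficiently close to 0, the map z ↦ exp(−Σ_{n≥1} (1/n) (Σ_{x : T_τ^n x = x} exp(−u Σ_{k=0}^{n−1} g(T_τ^k x)) / |(T_τ^n)'(x) − 1|) z^n) extends to a holomorphic function z ↦ d(z,u,τ) on the disc of center 0 and radius R; the function d so defined is C¹, and for all τ sufficiently small ∫_{S¹} g dμ_τ = −(∂d/∂u)(1,0,τ) / (∂d/∂z)(1,0,τ). If moreover τ ↦ T_τ is a C³ curve of C⁸ expanding maps and g is C⁷, then d is C², and the linear response formula holds: d/dτ (∫_{S¹} g dμ_τ)|_{τ=0} = −(∂²d/∂u∂τ)(1,0,0)/(∂d/∂z)(1,0,0) + (∂²d/∂τ∂z)(1,0,0)·(∂d/∂u)(1,0,0)/((∂d/∂z)(1,0,0))². -/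

import Mathlib

noncomputable section

open MeasureTheory Complex Filter Set
open scoped Topology ENNReal NNReal BigOperators FourierTransform SchwartzMap

/-! ### `C^N` families of `C^r` functions -/

/-- Bundle a function of a real variable as a bounded continuous function
(junk value `0` if it is not bounded continuous). -/
def toBCF (u : ℝ → ℝ) : BoundedContinuousFunction ℝ ℝ :=
  open scoped Classical in
  if h : Continuous u ∧ ∃ C, ∀ x y, dist (u x) (u y) ≤ C then ⟨⟨u, h.1⟩, h.2⟩
  else 0

section Family
variable {P : Type*} [NormedAddCommGroup P] [NormedSpace ℝ P]

/-- `t ↦ f t` is a `C^N` map on `U` with values in the space `C^r(ℝ)`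
(of bounded `C^r` functions): each value is `C^r` and each derivative of order `≤ r`
depends on the parameter in a `C^N` way, as a bounded continuous function. -/
def CNFamily (N : ℕ) (r : ℕ) (U : Set P) (f : P → ℝ → ℝ) : Prop :=
  (∀ t ∈ U, ContDiff ℝ r (f t)) ∧
  ∀ j : ℕ, j ≤ r → ContDiffOn ℝ N (fun t => toBCF (iteratedDeriv j (f t))) U

/-- `t ↦ F t` is a `C^N` map on `U` with values in `C^r(ℝ)`, where the values may be
unbounded (e.g. diffeomorphisms of `ℝ`): the value at the base point and all
derivatives of order `1 ≤ j ≤ r` are `C^N` in the parameter. -/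
def CNFamilyU (N : ℕ) (r : ℕ) (U : Set P) (F : P → ℝ → ℝ) : Prop :=
  (∀ t ∈ U, ContDiff ℝ r (F t)) ∧
  ContDiffOn ℝ N (fun t => F t 0) U ∧
  ∀ j : ℕ, 1 ≤ j → j ≤ r → ContDiffOn ℝ N (fun t => toBCF (iteratedDeriv j (F t))) U

end Family

/-- `F` is a `C^k` diffeomorphism of `ℝ`. -/
def IsCDiffeo (k : ℕ) (F : ℝ → ℝ) : Prop :=
  ContDiff ℝ k F ∧ Function.Bijective F ∧ ∀ x, deriv F x ≠ 0

/-! ### The circle, circle maps through their lifts, periodic points, pressure -/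

/-- The circle `S¹ = ℝ/ℤ`. -/
abbrev 𝕊 : Type := UnitAddCircle

/-- The canonical representative in `[0,1)` of a point of the circle. -/
def liftRep (y : 𝕊) : ℝ := ((AddCircle.equivIco 1 0) y).1

/-- The self-map of the circle induced by a map `T : ℝ → ℝ` (meant to be applied to
lifts of circle maps, i.e. maps commuting with integer translations). -/
def circleMapC (T : ℝ → ℝ) (y : 𝕊) : 𝕊 := (T (liftRep y) : ℝ) 

/-- The function on the circle induced by a function `g : ℝ → ℝ` (meant to be applied
to `1`-periodic functions). -/
def circleFun (g : ℝ → ℝ) (y : 𝕊) : ℝ := g (liftRep y)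

/-- `T` is the lift of a degree `d` circle map. -/
def IsCircleLift (T : ℝ → ℝ) (d : ℤ) : Prop := ∀ x, T (x + 1) = T x + d

/-- Representatives in `[0,1)` of the fixed points of the `n`-th iterate of the
circle map with lift `T`. -/
def periodicPtsIn (T : ℝ → ℝ) (n : ℕ) : Set ℝ :=
  {x | x ∈ Set.Ico (0:ℝ) 1 ∧ ∃ k : ℤ, T^[n] x = x + k}

/-- Birkhoff sum `g_{n}(x) = ∑_{i<n} g(T^i x)`. -/
def birkhoff (T g : ℝ → ℝ) (n : ℕ) (x : ℝ) : ℝ :=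
  ∑ i ∈ Finset.range n, g (T^[i] x)

/-- `T` is (the lift of) a `C^r` expanding circle map with expansion constant `lam⁻¹`. -/
def IsExpandingLift (lam : ℝ) (r : ℕ) (T : ℝ → ℝ) : Prop :=
  ContDiff ℝ r T ∧ (∃ d : ℤ, IsCircleLift T d) ∧ ∀ x, lam⁻¹ ≤ |deriv T x|

/-- The topological pressure `P(T, g)` of the potential `g` for an expanding circle
map (with lift) `T`, computed through weighted periodic orbits. -/
def pressureExp (T g : ℝ → ℝ) : ℝ :=
  limsup (fun n : ℕ =>
    Real.log (∑ᶠ x ∈ periodicPtsIn T n, Real.exp (birkhoff T g n x)) / n) atTop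

section CFam
variable {P : Type*} [NormedAddCommGroup P] [NormedSpace ℝ P]

/-- `t ↦ T t` is a `C^N` family on `U`, with values in the `C^r` expanding maps of the
circle with expansion constant `lam⁻¹` (described through their lifts). -/
def ExpandingFamily (N r : ℕ) (lam : ℝ) (U : Set P) (T : P → ℝ → ℝ) : Prop :=
  (∀ t ∈ U, IsExpandingLift lam r (T t)) ∧ CNFamilyU N r U T

/-- `t ↦ g t` is a `C^N` family on `U` of `C^r` functions on the circle
(described through their `1`-periodic lifts). -/
def PotentialFamily (N r : ℕ) (U : Set P) (G : P → ℝ → ℝ) : Prop :=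
  (∀ t ∈ U, ContDiff ℝ r (G t) ∧ ∀ x, G t (x + 1) = G t x) ∧ CNFamily N r U G

end CFam

/-- The `n`-th coefficient of the logarithm of the dynamical determinant of
Pollicott–Vytnova: `(1/n) ∑_{T^n x = x} e^{−u g_n(x)} / |(T^n)'(x) − 1|`
(and `0` for `n = 0`). -/
def pvCoeff (T g : ℝ → ℝ) (u : ℝ) (n : ℕ) : ℂ :=
  ((n : ℂ))⁻¹ * ∑ᶠ x ∈ periodicPtsIn T n,
    ((Real.exp (-u * birkhoff T g n x) / |deriv (T^[n]) x - 1| : ℝ) : ℂ)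


/-! ### Part A: abstract iterated function systems -/

namespace PV

section Words
variable {ι : Type} [Fintype ι]

/-- Sum over all words of length `n`. -/
def sumW : ℕ → (List ι → ℝ) → ℝ
  | 0, F => F []
  | n + 1, F => ∑ i, sumW n (fun w => F (i :: w))

lemma sumW_congr (n : ℕ) (F F' : List ι → ℝ) (h : ∀ w, w.length = n → F w = F' w) :
    sumW n F = sumW n F' := by
  induction n generalizing F F' with
  | zero => exact h [] rfl
  | succ n ih =>
    simp only [sumW]
    exact Finset.sum_congr rfl fun i _ => ih _ _ fun w hw => h _ (by simp [hw])

lemma sumW_le (n : ℕ) (F F' : List ι → ℝ) (h : ∀ w, w.length = n → F w ≤ F' w) :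
    sumW n F ≤ sumW n F' := by
  induction n generalizing F F' with
  | zero => exact h [] rfl
  | succ n ih =>
    simp only [sumW]
    exact Finset.sum_le_sum fun i _ => ih _ _ fun w hw => h _ (by simp [hw])

lemma sumW_mul (n : ℕ) (c : ℝ) (F : List ι → ℝ) :
    sumW n (fun w => c * F w) = c * sumW n F := by
  induction n generalizing F with
  | zero => rfl
  | succ n ih =>
    simp only [sumW, Finset.mul_sum]
    exact Finset.sum_congr rfl fun i _ => ih _

lemma sumW_sum {κ : Type} (s : Finset κ) (n : ℕ) (F : κ → List ι → ℝ) :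
    sumW n (fun w => ∑ k ∈ s, F k w) = ∑ k ∈ s, sumW n (F k) := by
  induction n generalizing F with
  | zero => rfl
  | succ n ih =>
    simp only [sumW, ih]
    exact Finset.sum_comm

lemma sumW_append (m l : ℕ) (F : List ι → ℝ) :
    sumW (m + l) F = sumW m (fun v => sumW l (fun v' => F (v ++ v'))) := by
  induction m generalizing F with
  | zero => simp [sumW]
  | succ m ih =>
    rw [Nat.succ_add]
    simp only [sumW, ih, List.cons_append]

lemma sumW_tendsto (n : ℕ) (F : ℕ → List ι → ℝ) (F' : List ι → ℝ)
    (h : ∀ w, w.length = n → Tendsto (fun j => F j w) atTop (𝓝 (F' w))) :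
    Tendsto (fun j => sumW n (F j)) atTop (𝓝 (sumW n F')) := by
  induction n generalizing F F' with
  | zero => exact h [] rfl
  | succ n ih =>
    simp only [sumW]
    exact tendsto_finsetSum _ fun i _ => ih _ _ fun w hw => h _ (by simp [hw])

lemma sumW_nonneg (n : ℕ) (F : List ι → ℝ) (h : ∀ w, w.length = n → 0 ≤ F w) :
    0 ≤ sumW n F := by
  have := sumW_le n (fun _ => 0 * (0:ℝ)) F (by simpa using h)
  rw [sumW_mul] at this
  simpa using this

end Words

/-- An iterated function system with weights. -/
structure IFS (X ι : Type) [PseudoMetricSpace X] (q K : ℝ) where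
  ψ : ι → X → X
  G : ι → X → ℝ
  hψ : ∀ i x y, dist (ψ i x) (ψ i y) ≤ q * dist x y
  hpos : ∀ i x, 0 < G i x
  hG : ∀ i x y, G i x ≤ Real.exp (K * dist x y) * G i y

/-- The cone of log-Lipschitz functions. -/
def Cone {X : Type} [PseudoMetricSpace X] (a : ℝ) (f : X → ℝ) : Prop :=
  (∀ x, 0 < f x) ∧ ∀ x y, f x ≤ Real.exp (a * dist x y) * f y

section Cone
variable {X : Type} [PseudoMetricSpace X]

lemma Cone.mono {a b : ℝ} {f : X → ℝ} (h : Cone a f) (hab : a ≤ b) : Cone b f :=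
  ⟨h.1, fun x y => (h.2 x y).trans (by have := (h.1 y).le; gcongr)⟩

lemma exp_sub_key {t y : ℝ} (ht : 1 < t) (hy : 0 ≤ y) :
    (t - 1) * (Real.exp (t * y) - Real.exp (-y)) ≤
      (t + 1) * (Real.exp (t * y) - Real.exp y) := by
  have h1 : Real.exp y * ((t - 1) * y) ≤ Real.exp (t * y) - Real.exp y := by
    have : Real.exp (t * y) = Real.exp y * Real.exp ((t - 1) * y) := by
      rw [← Real.exp_add]; ring_nf
    rw [this]
    have := Real.add_one_le_exp ((t - 1) * y)
    have h := Real.exp_pos y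
    nlinarith
  have h2 : Real.exp y - Real.exp (-y) ≤ Real.exp y * (2 * y) := by
    have : Real.exp (-y) = Real.exp y * Real.exp (-(2 * y)) := by
      rw [← Real.exp_add]; ring_nf
    rw [this]
    have := Real.add_one_le_exp (-(2 * y))
    have h := Real.exp_pos y
    nlinarith
  nlinarith

/-- Subtracting a small multiple stays in a bigger cone. -/
lemma Cone.sub {a t s β : ℝ} (ha : 0 ≤ a) (ht : 1 < t) (hs : s = (t - 1) / (t + 1)) {f h : X → ℝ}
    (hf : Cone a f) (hh : Cone a h) (hβ : 0 ≤ β) (hβf : ∀ x, β * h x ≤ s * f x) :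
    Cone (t * a) (fun x => f x - β * h x) := by
  have hs1 : s < 1 := by rw [hs, div_lt_one (by linarith)]; linarith
  have hs0 : 0 < s := by rw [hs]; exact div_pos (by linarith) (by linarith)
  refine ⟨fun x => ?_, fun x y => ?_⟩
  · have := hβf x; have := hf.1 x; nlinarith
  · have h1 := hf.2 x y
    have h2 := hh.2 y x
    rw [dist_comm y x] at h2
    set D := a * dist x y with hD
    have hD0 : 0 ≤ D := mul_nonneg ha dist_nonneg
    have hty : t * a * dist x y = t * D := by rw [hD]; ring
    rw [hty]
    have key := exp_sub_key ht hD0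
    have h3 : Real.exp (-D) * h y ≤ h x := by
      rw [Real.exp_neg, inv_mul_le_iff₀ (Real.exp_pos _)]; exact h2
    have hk : s * (Real.exp (t * D) - Real.exp (-D)) ≤ Real.exp (t * D) - Real.exp D := by
      rw [hs, div_mul_eq_mul_div, div_le_iff₀ (by linarith)]; linarith
    have hmono : Real.exp (-D) ≤ Real.exp (t * D) := Real.exp_le_exp.2 (by nlinarith)
    have hfy := hf.1 y
    have h4 : β * h y * (Real.exp (t * D) - Real.exp (-D)) ≤
        s * f y * (Real.exp (t * D) - Real.exp (-D)) :=
      mul_le_mul_of_nonneg_right (hβf y) (by linarith)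
    have h5 := mul_le_mul_of_nonneg_right hk hfy.le
    have h6 := mul_le_mul_of_nonneg_left h3 hβ
    nlinarith

end Cone

namespace IFS
variable {X ι : Type} [PseudoMetricSpace X] [Fintype ι] {q K : ℝ} (S : IFS X ι q K)

/-- Transfer operator. -/
def L (f : X → ℝ) (x : X) : ℝ := ∑ i, S.G i x * f (S.ψ i x)

def wψ : List ι → X → X
  | [], x => x
  | i :: w, x => S.ψ i (wψ w x)

def wG : List ι → X → ℝ
  | [], _ => 1
  | i :: w, x => wG w x * S.G i (S.wψ w x)

lemma L_mono {f h : X → ℝ} (hfh : ∀ x, f x ≤ h x) (x : X) : S.L f x ≤ S.L h x :=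
  Finset.sum_le_sum fun i _ => mul_le_mul_of_nonneg_left (hfh _) (S.hpos _ _).le

lemma L_smul (c : ℝ) (f : X → ℝ) : S.L (fun x => c * f x) = fun x => c * S.L f x := by
  funext x
  simp only [L, Finset.mul_sum]
  exact Finset.sum_congr rfl fun i _ => by ring

lemma L_sub (f h : X → ℝ) : S.L (fun x => f x - h x) = fun x => S.L f x - S.L h x := by
  funext x
  simp only [L, ← Finset.sum_sub_distrib]
  exact Finset.sum_congr rfl fun i _ => by ring

lemma Ln_mono (n : ℕ) {f h : X → ℝ} (hfh : ∀ x, f x ≤ h x) (x : X) :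
    S.L^[n] f x ≤ S.L^[n] h x := by
  induction n generalizing f h with
  | zero => exact hfh x
  | succ n ih => simp only [Function.iterate_succ, Function.comp]; exact ih (S.L_mono hfh)

lemma Ln_smul (n : ℕ) (c : ℝ) (f : X → ℝ) :
    S.L^[n] (fun x => c * f x) = fun x => c * S.L^[n] f x := by
  induction n generalizing f with
  | zero => rfl
  | succ n ih => simp only [Function.iterate_succ, Function.comp, L_smul, ih]

lemma Ln_sub (n : ℕ) (f h : X → ℝ) :
    S.L^[n] (fun x => f x - h x) = fun x => S.L^[n] f x - S.L^[n] h x := by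
  induction n generalizing f h with
  | zero => rfl
  | succ n ih => simp only [Function.iterate_succ, Function.comp, L_sub, ih]

lemma Ln_eq (n : ℕ) (f : X → ℝ) (x : X) :
    S.L^[n] f x = sumW n (fun w => S.wG w x * f (S.wψ w x)) := by
  induction n generalizing f with
  | zero => simp [sumW, wG, wψ]
  | succ n ih =>
    rw [Function.iterate_succ, Function.comp, ih]
    simp only [sumW, ← sumW_sum]
    refine sumW_congr _ _ _ fun w _ => ?_
    simp only [L, Finset.mul_sum, wG, wψ]
    exact Finset.sum_congr rfl fun i _ => by ring

lemma L_cone [Nonempty ι] {b : ℝ} (hb : 0 ≤ b) {f : X → ℝ} (hf : Cone b f) :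
    Cone (K + q * b) (S.L f) := by
  refine ⟨fun x => Finset.sum_pos (fun i _ => mul_pos (S.hpos _ _) (hf.1 _))
    Finset.univ_nonempty, fun x y => ?_⟩
  simp only [L, Finset.mul_sum]
  refine Finset.sum_le_sum fun i _ => ?_
  have h1 := S.hG i x y
  have h2 := hf.2 (S.ψ i x) (S.ψ i y)
  have h3 : Real.exp (b * dist (S.ψ i x) (S.ψ i y)) ≤ Real.exp (b * (q * dist x y)) :=
    Real.exp_le_exp.2 (mul_le_mul_of_nonneg_left (S.hψ i x y) hb)
  calc S.G i x * f (S.ψ i x)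
      ≤ (Real.exp (K * dist x y) * S.G i y) * (Real.exp (b * (q * dist x y)) * f (S.ψ i y)) := by
        have := hf.1 (S.ψ i y)
        have := hf.1 (S.ψ i x)
        have := S.hpos i y
        refine mul_le_mul h1 (h2.trans (by gcongr)) (by positivity) (by positivity)
    _ = Real.exp ((K + q * b) * dist x y) * (S.G i y * f (S.ψ i y)) := by
        have : (K + q * b) * dist x y = K * dist x y + b * (q * dist x y) := by ring
        rw [this, Real.exp_add]; ring

lemma wψ_append (v w : List ι) (x : X) : S.wψ (v ++ w) x = S.wψ v (S.wψ w x) := by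
  induction v with
  | nil => rfl
  | cons i v ih => simp [wψ, ih]

lemma wG_append (v w : List ι) (x : X) : S.wG (v ++ w) x = S.wG w x * S.wG v (S.wψ w x) := by
  induction v with
  | nil => simp [wG]
  | cons i v ih => simp [wG, ih, wψ_append]; ring

lemma wψ_dist (hq : 0 ≤ q) (w : List ι) (x y : X) :
    dist (S.wψ w x) (S.wψ w y) ≤ q ^ w.length * dist x y := by
  induction w with
  | nil => simp [wψ]
  | cons i w ih =>
    simp only [wψ, List.length_cons, pow_succ']
    refine (S.hψ _ _ _).trans ?_
    rw [mul_assoc]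
    exact mul_le_mul_of_nonneg_left ih hq

lemma wG_cone {a : ℝ} (hq : 0 ≤ q) (ha : 0 ≤ a) (hK : 0 ≤ K) (haK : K ≤ a * (1 - q))
    (w : List ι) : Cone (a * (1 - q ^ w.length)) (S.wG w) := by
  induction w with
  | nil => exact ⟨fun x => by simp [wG], fun x y => by simp [wG]⟩
  | cons i w ih =>
    refine ⟨fun x => mul_pos (ih.1 x) (S.hpos _ _), fun x y => ?_⟩
    simp only [wG]
    have h1 := ih.2 x y
    have h2 := S.hG i (S.wψ w x) (S.wψ w y)
    have h3 := S.wψ_dist hq w x y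
    have h4 : K * dist (S.wψ w x) (S.wψ w y) ≤ a * (1 - q) * (q ^ w.length * dist x y) := by
      calc _ ≤ K * (q ^ w.length * dist x y) := mul_le_mul_of_nonneg_left h3 hK
        _ ≤ _ := mul_le_mul_of_nonneg_right haK (by positivity)
    have h5 := ih.1 x
    have h6 := ih.1 y
    have h7 := S.hpos i (S.wψ w y)
    have h8 := S.hpos i (S.wψ w x)
    calc S.wG w x * S.G i (S.wψ w x) ≤
        (Real.exp (a * (1 - q ^ w.length) * dist x y) * S.wG w y) *
        (Real.exp (a * (1 - q) * (q ^ w.length * dist x y)) * S.G i (S.wψ w y)) := by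
          refine mul_le_mul h1 (h2.trans (by gcongr)) h8.le (by positivity)
      _ = _ := by
        have : a * (1 - q ^ (i :: w).length) * dist x y =
          a * (1 - q ^ w.length) * dist x y + a * (1 - q) * (q ^ w.length * dist x y) := by
          simp only [List.length_cons, pow_succ]; ring
        rw [this, Real.exp_add]; ring

lemma wG_cone' {a : ℝ} (hq : 0 ≤ q) (ha : 0 ≤ a) (hK : 0 ≤ K) (haK : K ≤ a * (1 - q))
    (w : List ι) : Cone a (S.wG w) :=
  (S.wG_cone hq ha hK haK w).mono (by have : 0 ≤ q ^ w.length := by positivity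
                                      nlinarith)

/-- Ratio contraction. -/
lemma ratio [Nonempty ι] (hd : ∀ x y : X, dist x y ≤ 1) {a t s θ : ℝ} (ha : 0 ≤ a) (ht : 1 < t)
    (hs : s = (t - 1) / (t + 1)) (hat : K + q * (t * a) ≤ a)
    (hqK : K + q * a ≤ a)
    (hθ : θ = 1 / (1 + s * Real.exp (-(2 * a)))) (n : ℕ) (f h : X → ℝ)
    (hf : Cone a f) (hh : Cone a h) (M : ℝ) (hM : 0 ≤ M) (hfM : ∀ x, f x ≤ M * h x) :
    ∃ B, 0 ≤ B ∧ ∀ x, B * S.L^[n] h x ≤ S.L^[n] f x ∧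
      S.L^[n] f x ≤ (B + θ ^ n * M) * S.L^[n] h x := by
  have hs1 : s < 1 := by rw [hs, div_lt_one (by linarith)]; linarith
  have hs0 : 0 < s := by rw [hs]; exact div_pos (by linarith) (by linarith)
  have hθ0 : 0 < θ := by rw [hθ]; positivity
  induction n generalizing f h M with
  | zero =>
    refine ⟨0, le_rfl, fun x => ⟨by simpa using (hf.1 x).le, by simpa using hfM x⟩⟩
  | succ n ih =>
    obtain ⟨β, hβ0, hβ1, hβ2⟩ : ∃ β, 0 ≤ β ∧ (∀ x, β * h x ≤ s * f x) ∧
        ∀ x, f x - β * h x ≤ θ * M * h x := by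
      by_cases hc : ∀ x, f x ≤ θ * M * h x
      · exact ⟨0, le_rfl, fun x => by simpa using mul_nonneg hs0.le (hf.1 x).le,
          fun x => by simpa using hc x⟩
      · push Not at hc
        obtain ⟨x1, hx1⟩ := hc
        refine ⟨s * Real.exp (-(2 * a)) * (θ * M), by positivity, fun x => ?_, fun x => ?_⟩
        · have h1 := hf.2 x1 x
          have h2 := hh.2 x x1
          have e1 : Real.exp (a * dist x1 x) ≤ Real.exp a :=
            Real.exp_le_exp.2 (by have := hd x1 x; nlinarith)
          have e2 : Real.exp (a * dist x x1) ≤ Real.exp a :=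
            Real.exp_le_exp.2 (by have := hd x x1; nlinarith)
          have p1 := hf.1 x
          have p2 := hh.1 x1
          have h3 : f x1 ≤ Real.exp a * f x := h1.trans (by gcongr)
          have h4 : h x ≤ Real.exp a * h x1 := h2.trans (by gcongr)
          have e3 : Real.exp (-(2 * a)) * (Real.exp a * Real.exp a) = 1 := by
            rw [← Real.exp_add, ← Real.exp_add]; ring_nf; simp
          have hMθ : 0 ≤ θ * M := by positivity
          calc s * Real.exp (-(2 * a)) * (θ * M) * h x
              ≤ s * Real.exp (-(2 * a)) * (θ * M) * (Real.exp a * h x1) := by gcongr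
            _ = s * Real.exp (-(2 * a)) * Real.exp a * (θ * M * h x1) := by ring
            _ ≤ s * Real.exp (-(2 * a)) * Real.exp a * (Real.exp a * f x) := by
                have := hx1.le.trans h3
                gcongr
            _ = s * (Real.exp (-(2 * a)) * (Real.exp a * Real.exp a)) * f x := by ring
            _ = s * f x := by rw [e3]; ring
        · have := hfM x
          have hθ' : θ * M + s * Real.exp (-(2 * a)) * (θ * M) = M := by
            have : θ * (1 + s * Real.exp (-(2 * a))) = 1 := by
              rw [hθ]; exact one_div_mul_cancel (by positivity)
            calc _ = θ * (1 + s * Real.exp (-(2 * a))) * M := by ring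
              _ = M := by rw [this, one_mul]
          calc _ ≤ M * h x - s * Real.exp (-(2 * a)) * (θ * M) * h x := by linarith
            _ = (θ * M + s * Real.exp (-(2 * a)) * (θ * M)) * h x
                - s * Real.exp (-(2 * a)) * (θ * M) * h x := by rw [hθ']
            _ = _ := by ring
    have hc := Cone.sub ha ht hs hf hh hβ0 hβ1
    have hc1 : Cone a (S.L (fun x => f x - β * h x)) :=
      (S.L_cone (by nlinarith) hc).mono hat
    have hc2 : Cone a (S.L h) := (S.L_cone ha hh).mono hqK
    obtain ⟨B, hB0, hB⟩ := ih (S.L (fun x => f x - β * h x)) (S.L h) hc1 hc2 (θ * M)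
      (by positivity) (fun x => by
        have := S.L_mono hβ2 x
        rwa [S.L_smul] at this)
    refine ⟨B + β, by positivity, fun x => ?_⟩
    have key := hB x
    rw [S.L_sub, S.L_smul, S.Ln_sub, S.Ln_smul] at key
    simp only [Function.iterate_succ, Function.comp]
    constructor
    · linarith [key.1]
    · have := key.2
      rw [pow_succ]
      linarith

end IFS
end PV


namespace PV

/-- Admissible constants for the cone argument. -/
structure Good (q K a t s θ : ℝ) : Prop where
  hq0 : 0 < q
  hq1 : q < 1
  hK : 0 ≤ K
  ha : 0 ≤ a
  ht : 1 < t
  hs : s = (t - 1) / (t + 1)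
  hat : K + q * (t * a) ≤ a
  hθ : θ = 1 / (1 + s * Real.exp (-(2 * a)))

namespace Good
variable {q K a t s θ : ℝ} (C : Good q K a t s θ)
include C

lemma hqK : K + q * a ≤ a := by
  have h1 := C.hat; have h2 := C.ht; have h3 := C.ha; have h4 := C.hq0
  have : q * a ≤ q * (t * a) := mul_le_mul_of_nonneg_left (by nlinarith) h4.le
  linarith

lemma haK : K ≤ a * (1 - q) := by have := C.hqK; linarith

lemma s_pos : 0 < s := by
  have := C.ht
  rw [C.hs]; exact div_pos (by linarith) (by linarith)

lemma θ_pos : 0 < θ := by have := C.s_pos; rw [C.hθ]; positivity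

lemma θ_lt : θ < 1 := by
  have := C.s_pos
  rw [C.hθ, div_lt_one (by positivity)]
  have : 0 < s * Real.exp (-(2 * a)) := by positivity
  linarith

end Good

lemma exists_good {q K : ℝ} (hq0 : 0 < q) (hq1 : q < 1) (hK : 0 ≤ K) :
    ∃ a t s θ, Good q K a t s θ := by
  refine ⟨2 * K / (1 - q), (1 + q) / (2 * q), _, _, ⟨hq0, hq1, hK, ?_, ?_, rfl, ?_, rfl⟩⟩
  · exact div_nonneg (by linarith) (by linarith)
  · rw [lt_div_iff₀ (by linarith)]; linarith
  · have : 1 - q ≠ 0 := by linarith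
    apply le_of_eq
    field_simp
    ring

lemma sumW_swap {ι : Type} [Fintype ι] (m j : ℕ) (F : List ι → List ι → ℝ) :
    sumW m (fun v => sumW j (fun w => F v w)) = sumW j (fun w => sumW m (fun v => F v w)) := by
  induction m generalizing F with
  | zero => rfl
  | succ m ih =>
    simp only [sumW, ih]
    exact (sumW_sum _ _ _).symm

namespace IFS
variable {X ι : Type} [PseudoMetricSpace X] [Fintype ι] [Nonempty ι] {q K : ℝ} (S : IFS X ι q K)
variable {a t s θ : ℝ}

/-- The constant function one. -/
def one : X → ℝ := fun _ => 1

lemma one_cone (ha : 0 ≤ a) : Cone a (one : X → ℝ) :=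
  ⟨fun _ => by simp [one], fun x y => by
    simp only [one, mul_one]; exact Real.one_le_exp (mul_nonneg ha dist_nonneg)⟩

lemma Ln_cone (C : Good q K a t s θ) (n : ℕ) {f : X → ℝ} (hf : Cone a f) :
    Cone a (S.L^[n] f) := by
  induction n generalizing f with
  | zero => exact hf
  | succ n ih => exact ih ((S.L_cone C.ha hf).mono C.hqK)

lemma Ln_sumW (j m : ℕ) (c : List ι → ℝ) (f : List ι → X → ℝ) (x : X) :
    S.L^[j] (fun x => sumW m (fun v => c v * f v x)) x =
      sumW m (fun v => c v * S.L^[j] (f v) x) := by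
  simp only [Ln_eq, ← sumW_mul]
  rw [sumW_swap]
  refine sumW_congr _ _ _ fun w _ => sumW_congr _ _ _ fun v _ => by ring

/-- `r` is the asymptotic ratio of `f`. -/
def IsRho (f : X → ℝ) (r : ℝ) : Prop :=
  ∀ x, Tendsto (fun n => S.L^[n] f x / S.L^[n] one x) atTop (𝓝 r)

lemma exists_rho [Nonempty X] (hd : ∀ x y : X, dist x y ≤ 1) (C : Good q K a t s θ)
    {f : X → ℝ} (hf : Cone a f) :
    ∃ r, 0 < r ∧ S.IsRho f r ∧
      ∀ n x, |S.L^[n] f x - r * S.L^[n] one x| ≤ θ ^ n * Real.exp (2 * a) * r * S.L^[n] one x := by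
  obtain ⟨x0⟩ := (inferInstance : Nonempty X)
  have hθ0 := C.θ_pos
  have hθ1 := C.θ_lt
  set M := Real.exp a * f x0 with hMdef
  have hf0 := hf.1 x0
  have hM : 0 < M := by positivity
  have hexp : ∀ x y : X, Real.exp (a * dist x y) ≤ Real.exp a := fun x y =>
    Real.exp_le_exp.2 (by have := hd x y; have := C.ha; nlinarith)
  have hfM : ∀ x, f x ≤ M * one x := fun x => by
    simp only [one, mul_one]
    exact (hf.2 x x0).trans (mul_le_mul_of_nonneg_right (hexp _ _) hf0.le)
  have hfm : ∀ x, Real.exp (-a) * f x0 * one x ≤ f x := fun x => by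
    simp only [one, mul_one]
    rw [Real.exp_neg, inv_mul_le_iff₀ (Real.exp_pos _)]
    exact (hf.2 x0 x).trans (mul_le_mul_of_nonneg_right (hexp _ _) (hf.1 x).le)
  have h1pos : ∀ n x, 0 < S.L^[n] one x := fun n x => (S.Ln_cone C n (one_cone C.ha)).1 x
  choose B hB0 hB using fun n => S.ratio hd C.ha C.ht C.hs C.hat C.hqK C.hθ n f one hf
    (one_cone C.ha) M hM.le hfM
  set r' : ℕ → X → ℝ := fun n x => S.L^[n] f x / S.L^[n] one x with hr'
  have hlo : ∀ n k x, B n ≤ r' (n + k) x := fun n k x => by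
    rw [hr']
    simp only
    rw [le_div_iff₀ (h1pos _ _), add_comm, Function.iterate_add, Function.comp,
      Function.comp]
    have := S.Ln_mono k (fun x => (hB n x).1) x
    rwa [S.Ln_smul] at this
  have hhi : ∀ n k x, r' (n + k) x ≤ B n + θ ^ n * M := fun n k x => by
    rw [hr']
    simp only
    rw [div_le_iff₀ (h1pos _ _), add_comm n k, Function.iterate_add, Function.comp,
      Function.comp]
    have := S.Ln_mono k (fun x => (hB n x).2) x
    rwa [S.Ln_smul] at this
  have hθn : Tendsto (fun n => θ ^ n * M) atTop (𝓝 0) := by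
    simpa using (tendsto_pow_atTop_nhds_zero_of_lt_one hθ0.le hθ1).mul_const M
  have hcau : CauchySeq (fun n => r' n x0) := by
    refine cauchySeq_of_le_tendsto_0' (fun n => θ ^ n * M) (fun n m hnm => ?_) hθn
    obtain ⟨k, rfl⟩ := Nat.exists_eq_add_of_le hnm
    have h1 := hlo n 0 x0; have h2 := hhi n 0 x0
    have h3 := hlo n k x0; have h4 := hhi n k x0
    simp only [add_zero] at h1 h2
    rw [Real.dist_eq, abs_le]; constructor <;> linarith
  obtain ⟨r, hr⟩ := cauchySeq_tendsto_of_complete hcau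
  have hrlo : ∀ n, B n ≤ r := fun n => ge_of_tendsto hr (by
    filter_upwards [eventually_ge_atTop n] with m hm
    obtain ⟨k, rfl⟩ := Nat.exists_eq_add_of_le hm
    exact hlo n k x0)
  have hrhi : ∀ n, r ≤ B n + θ ^ n * M := fun n => le_of_tendsto hr (by
    filter_upwards [eventually_ge_atTop n] with m hm
    obtain ⟨k, rfl⟩ := Nat.exists_eq_add_of_le hm
    exact hhi n k x0)
  have hrM : M ≤ Real.exp (2 * a) * r := by
    have : Real.exp (-a) * f x0 ≤ r := ge_of_tendsto hr (by
      filter_upwards with n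
      rw [hr']
      simp only
      rw [le_div_iff₀ (h1pos _ _)]
      have := S.Ln_mono n hfm x0
      rwa [S.Ln_smul] at this)
    calc M = Real.exp (2 * a) * (Real.exp (-a) * f x0) := by
          rw [hMdef, ← mul_assoc, ← Real.exp_add]; ring_nf
      _ ≤ _ := by gcongr
  have hclose : ∀ n x, |r' n x - r| ≤ θ ^ n * M := fun n x => by
    have h1 := hlo n 0 x; have h2 := hhi n 0 x
    have h3 := hrlo n; have h4 := hrhi n
    simp only [add_zero] at h1 h2
    rw [abs_le]; constructor <;> linarith
  refine ⟨r, by have := Real.exp_pos (2 * a); nlinarith, fun x => ?_, fun n x => ?_⟩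
  · rw [tendsto_iff_dist_tendsto_zero]
    exact squeeze_zero (fun _ => dist_nonneg) (fun n => hclose n x) hθn
  · have h1 := h1pos n x
    have h2 : S.L^[n] f x - r * S.L^[n] one x = (r' n x - r) * S.L^[n] one x := by
      rw [hr']; field_simp
    rw [h2, abs_mul, abs_of_pos h1]
    refine mul_le_mul_of_nonneg_right ((hclose n x).trans ?_) h1.le
    rw [mul_assoc]
    gcongr

lemma IsRho.le [Nonempty X] (C : Good q K a t s θ) {f h : X → ℝ} {r r' : ℝ} (hr : S.IsRho f r)
    (hr' : S.IsRho h r') (hfh : ∀ x, f x ≤ h x) : r ≤ r' := by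
  obtain ⟨x0⟩ := (inferInstance : Nonempty X)
  refine le_of_tendsto_of_tendsto' (hr x0) (hr' x0) fun n => ?_
  have := (S.Ln_cone C n (one_cone C.ha)).1 x0
  gcongr
  exact S.Ln_mono n hfh x0

lemma IsRho.const (C : Good q K a t s θ) (c : ℝ) : S.IsRho (fun x => c * one x) c := by
  intro x
  rw [show (fun n => S.L^[n] (fun x => c * one x) x / S.L^[n] one x) = fun _ => c from ?_]
  · exact tendsto_const_nhds
  · funext n
    rw [S.Ln_smul]
    exact mul_div_cancel_right₀ _ ((S.Ln_cone C n (one_cone C.ha)).1 x).ne'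

lemma exists_lam [Nonempty X] (hd : ∀ x y : X, dist x y ≤ 1) (C : Good q K a t s θ) :
    ∃ lam, 0 < lam ∧ (∀ n, S.IsRho (S.L^[n] one) (lam ^ n)) ∧
      ∀ n x, Real.exp (-a) * lam ^ n ≤ S.L^[n] one x ∧ S.L^[n] one x ≤ Real.exp a * lam ^ n := by
  obtain ⟨lam, hlam, hrho, -⟩ := S.exists_rho hd C (S.Ln_cone C 1 (one_cone C.ha))
  have h1pos : ∀ n x, 0 < S.L^[n] one x := fun n x => (S.Ln_cone C n (one_cone C.ha)).1 x
  have hrn : ∀ n, S.IsRho (S.L^[n] one) (lam ^ n) := by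
    intro n
    induction n with
    | zero =>
      have h := IsRho.const S C 1
      have e : (fun x : X => (1:ℝ) * one x) = one := by funext x; simp
      rw [e] at h
      simpa using h
    | succ n ih =>
      intro x
      have h1 := ih x
      have h2 := (hrho x).comp (tendsto_add_atTop_nat n)
      have h3 := h2.mul h1
      rw [pow_succ']
      refine h3.congr fun j => ?_
      simp only [Function.comp_def, ← Function.iterate_add_apply]
      have e1 : j + n + 1 = j + (n + 1) := by ring
      rw [e1]
      exact div_mul_div_cancel₀ (h1pos _ _).ne'
  refine ⟨lam, hlam, hrn, fun n x => ?_⟩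
  have hc := S.Ln_cone C n (one_cone C.ha)
  have hexp : ∀ x y : X, Real.exp (a * dist x y) ≤ Real.exp a := fun x y =>
    Real.exp_le_exp.2 (by have := hd x y; have := C.ha; nlinarith)
  constructor
  · rw [Real.exp_neg, inv_mul_le_iff₀ (Real.exp_pos _)]
    refine IsRho.le S C (hrn n) (IsRho.const S C _) fun y => ?_
    simp only [one, mul_one]
    exact (hc.2 y x).trans (mul_le_mul_of_nonneg_right (hexp _ _) (hc.1 x).le)
  · rw [← inv_mul_le_iff₀ (Real.exp_pos _), ← Real.exp_neg]
    refine IsRho.le S C (IsRho.const S C _) (hrn n) fun y => ?_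
    simp only [one, mul_one]
    rw [Real.exp_neg, inv_mul_le_iff₀ (Real.exp_pos _)]
    exact (hc.2 x y).trans (mul_le_mul_of_nonneg_right (hexp _ _) (hc.1 y).le)

/-- Asymptotics of the sum over fixed points. -/
lemma trace [Nonempty X] (hd : ∀ x y : X, dist x y ≤ 1) (C : Good q K a t s θ) {lam : ℝ}
    (hlam : ∀ n, S.IsRho (S.L^[n] one) (lam ^ n)) (m l : ℕ) (xf : List ι → X)
    (hxf : ∀ w, w.length = m + l → S.wψ w (xf w) = xf w) :
    sumW (m + l) (fun w => S.wG w (xf w)) ≤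
        Real.exp (2 * a * q ^ m) * (1 + Real.exp (2 * a) * θ ^ l) * lam ^ (m + l) ∧
      Real.exp (-(2 * a * q ^ m)) * lam ^ (m + l) ≤ sumW (m + l) (fun w => S.wG w (xf w)) +
        Real.exp (2 * a) * θ ^ l * lam ^ (m + l) := by
  obtain ⟨x0⟩ := (inferInstance : Nonempty X)
  have hq0 := C.hq0
  have hθ0 := C.θ_pos
  set F := S.L^[l] one with hF
  have hFc : Cone a F := S.Ln_cone C l (one_cone C.ha)
  have hwG : ∀ w, Cone a (S.wG w) := S.wG_cone' C.hq0.le C.ha C.hK C.haK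
  choose r hr0 hr hrb using fun w => S.exists_rho hd C (hwG w)
  set y : List ι → X := fun v => S.wψ v x0 with hy
  have hdist : ∀ v x, v.length = m → dist (S.wψ v x) (y v) ≤ q ^ m := fun v x hv => by
    have := S.wψ_dist hq0.le v x x0
    rw [hv] at this
    exact this.trans (mul_le_of_le_one_right (by positivity) (hd _ _))
  set E := Real.exp (a * q ^ m) with hE
  have hE0 : 0 < E := Real.exp_pos _
  have hEE : ∀ x y : X, dist x y ≤ q ^ m → Real.exp (a * dist x y) ≤ E := fun x y h =>
    Real.exp_le_exp.2 (mul_le_mul_of_nonneg_left h C.ha)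
  -- step 1
  have s1 : ∀ v v', v.length = m → v'.length = l →
      S.wG (v ++ v') (xf (v ++ v')) ≤ E * S.wG (v ++ v') (y v) ∧
      S.wG (v ++ v') (y v) ≤ E * S.wG (v ++ v') (xf (v ++ v')) := by
    intro v v' hv hv'
    have hx := hxf (v ++ v') (by simp [hv, hv'])
    rw [S.wψ_append] at hx
    have h1 := hdist v (S.wψ v' (xf (v ++ v'))) hv
    rw [hx] at h1
    have hc := hwG (v ++ v')
    refine ⟨(hc.2 _ _).trans (mul_le_mul_of_nonneg_right (hEE _ _ h1) (hc.1 _).le),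
      (hc.2 _ _).trans (mul_le_mul_of_nonneg_right (hEE _ _ ?_) (hc.1 _).le)⟩
    rwa [dist_comm]
  have s1' : ∀ v, sumW l (fun v' => S.wG (v ++ v') (y v)) = S.L^[l] (S.wG v) (y v) := fun v => by
    rw [S.Ln_eq]; simp only [S.wG_append]
  -- step 3
  set Y := sumW m (fun v => F (y v) * r v) with hY
  have hYr : S.IsRho (fun x => sumW m (fun v => F (y v) * S.wG v x)) Y := by
    intro x
    simp only [S.Ln_sumW]
    have : ∀ n, sumW m (fun v => F (y v) * S.L^[n] (S.wG v) x) / S.L^[n] one x =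
        sumW m (fun v => F (y v) * (S.L^[n] (S.wG v) x / S.L^[n] one x)) := fun n => by
      rw [div_eq_inv_mul, ← sumW_mul]
      exact sumW_congr _ _ _ fun v _ => by ring
    simp only [this]
    exact sumW_tendsto _ _ _ fun v _ => (hr v x).const_mul _
  have hLn : ∀ x, S.L^[m + l] one x = sumW m (fun v => S.wG v x * F (S.wψ v x)) := fun x => by
    rw [Function.iterate_add_apply, S.Ln_eq]
  have hsc : ∀ c, S.IsRho (fun x => c * S.L^[m + l] one x) (c * lam ^ (m + l)) := fun c x => by
    have := ((hlam (m + l)) x).const_mul c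
    refine this.congr fun n => ?_
    rw [S.Ln_smul]; ring
  have s3a : Y ≤ E * lam ^ (m + l) := by
    refine IsRho.le S C hYr (hsc E) fun x => ?_
    rw [hLn, ← sumW_mul]
    refine sumW_le _ _ _ fun v hv => ?_
    have h1 := hFc.2 (y v) (S.wψ v x)
    have h2 := hEE _ _ (by rw [dist_comm]; exact hdist v x hv : dist (y v) (S.wψ v x) ≤ q ^ m)
    have h3 := h1.trans (mul_le_mul_of_nonneg_right h2 (hFc.1 _).le)
    have := mul_le_mul_of_nonneg_right h3 ((hwG v).1 x).le
    linarith
  have s3b : E⁻¹ * lam ^ (m + l) ≤ Y := by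
    refine IsRho.le S C (hsc E⁻¹) hYr fun x => ?_
    rw [hLn, ← sumW_mul]
    refine sumW_le _ _ _ fun v hv => ?_
    have h1 := hFc.2 (S.wψ v x) (y v)
    have h2 := hEE _ _ (hdist v x hv)
    have h3 := h1.trans (mul_le_mul_of_nonneg_right h2 (hFc.1 _).le)
    have := mul_le_mul_of_nonneg_right h3 ((hwG v).1 x).le
    rw [inv_mul_le_iff₀ hE0]
    linarith
  -- step 2
  have s2a : sumW m (fun v => S.L^[l] (S.wG v) (y v)) ≤ (1 + Real.exp (2 * a) * θ ^ l) * Y := by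
    rw [hY, ← sumW_mul]
    refine sumW_le _ _ _ fun v _ => ?_
    have := (abs_le.1 (hrb v l (y v))).2
    rw [← hF] at this
    linarith
  have s2b : Y ≤ sumW m (fun v => S.L^[l] (S.wG v) (y v)) + Real.exp (2 * a) * θ ^ l * Y := by
    have : (1 - Real.exp (2 * a) * θ ^ l) * Y ≤ sumW m (fun v => S.L^[l] (S.wG v) (y v)) := by
      rw [hY, ← sumW_mul]
      refine sumW_le _ _ _ fun v _ => ?_
      have := (abs_le.1 (hrb v l (y v))).1
      rw [← hF] at this
      linarith
    linarith
  have b1 : sumW (m + l) (fun w => S.wG w (xf w)) ≤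
      E * sumW m (fun v => S.L^[l] (S.wG v) (y v)) := by
    rw [sumW_append, ← sumW_mul]
    refine sumW_le _ _ _ fun v hv => ?_
    rw [← s1', ← sumW_mul]
    exact sumW_le _ _ _ fun v' hv' => (s1 v v' hv hv').1
  have b2 : sumW m (fun v => S.L^[l] (S.wG v) (y v)) ≤
      E * sumW (m + l) (fun w => S.wG w (xf w)) := by
    rw [sumW_append, ← sumW_mul]
    refine sumW_le _ _ _ fun v hv => ?_
    rw [← s1', ← sumW_mul]
    exact sumW_le _ _ _ fun v' hv' => (s1 v v' hv hv').2
  have e2 : Real.exp (2 * a * q ^ m) = E * E := by rw [hE, ← Real.exp_add]; ring_nf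
  have e3 : Real.exp (-(2 * a * q ^ m)) = E⁻¹ * E⁻¹ := by
    rw [Real.exp_neg, e2, mul_inv]
  set δ := Real.exp (2 * a) * θ ^ l with hδ
  have hδ0 : 0 < δ := by positivity
  constructor
  · rw [e2]
    calc _ ≤ E * ((1 + δ) * (E * lam ^ (m + l))) :=
          b1.trans (mul_le_mul_of_nonneg_left (s2a.trans (by gcongr)) hE0.le)
      _ = _ := by ring
  · rw [e3]
    have h1 : E⁻¹ * Y ≤ sumW (m + l) (fun w => S.wG w (xf w)) + E⁻¹ * (δ * Y) := by
      rw [inv_mul_le_iff₀ hE0, mul_add, mul_inv_cancel_left₀ hE0.ne']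
      linarith
    have h2 : E⁻¹ * (δ * Y) ≤ δ * lam ^ (m + l) := by
      rw [inv_mul_le_iff₀ hE0]
      calc δ * Y ≤ δ * (E * lam ^ (m + l)) := by gcongr
        _ = _ := by ring
    have h3 : E⁻¹ * (E⁻¹ * lam ^ (m + l)) ≤ E⁻¹ * Y :=
      mul_le_mul_of_nonneg_left s3b (by positivity)
    linarith

end IFS
end PV


namespace PV

/-- A `C¹` lift with derivative bounded below. -/
structure EM (f : ℝ → ℝ) (D : ℤ) (κ : ℝ) : Prop where
  hC : ContDiff ℝ 1 f
  lift : ∀ x, f (x + 1) = f x + D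
  hκ : 0 < κ
  hd : ∀ x, κ ≤ |deriv f x|

namespace EM
variable {f : ℝ → ℝ} {D : ℤ} {κ : ℝ} (E : EM f D κ)
include E

lemma diff : Differentiable ℝ f := E.hC.differentiable (by norm_num)

lemma dist_lower (x y : ℝ) : κ * |x - y| ≤ |f x - f y| := by
  wlog h : y < x generalizing x y
  · rcases eq_or_lt_of_le (not_lt.1 h) with h | h
    · simp [h]
    · rw [abs_sub_comm x, abs_sub_comm (f x)]; exact this y x h
  obtain ⟨c, -, hc⟩ := exists_deriv_eq_slope f h E.diff.continuous.continuousOn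
    E.diff.differentiableOn
  have h0 : 0 < x - y := by linarith
  have h1 := E.hd c
  rw [hc, abs_div, le_div_iff₀ (by positivity)] at h1
  exact h1

lemma inj : Function.Injective f := fun x y h => by
  have h1 := E.dist_lower x y
  rw [h, sub_self, abs_zero] at h1
  have := E.hκ
  by_contra hne
  have : 0 < |x - y| := abs_pos.2 (sub_ne_zero.2 hne)
  nlinarith [mul_pos E.hκ this]

lemma lift_nat (x : ℝ) (n : ℕ) : f (x + n) = f x + D * n := by
  induction n with
  | zero => simp
  | succ n ih => push_cast; rw [← add_assoc, E.lift, ih]; ring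

lemma lift_int (x : ℝ) (n : ℤ) : f (x + n) = f x + D * n := by
  obtain ⟨m, rfl | rfl⟩ := n.eq_nat_or_neg
  · exact_mod_cast E.lift_nat x m
  · have := E.lift_nat (x + ((-(m:ℤ) : ℤ) : ℝ)) m
    push_cast at this ⊢
    rw [neg_add_cancel_right] at this
    linarith

lemma D_lower : κ ≤ |(D : ℝ)| := by
  have h := E.dist_lower (0 + 1) 0
  rw [E.lift] at h
  simpa using h

lemma D_ne : (D : ℝ) ≠ 0 := by
  have := E.D_lower; have := E.hκ
  intro h; simp [h] at *; linarith

lemma D_ne' : D ≠ 0 := by exact_mod_cast E.D_ne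

lemma strictMono (h : 0 < D) : StrictMono f := by
  rcases E.diff.continuous.strictMono_of_inj E.inj with h1 | h1
  · exact h1
  · exfalso
    have h2 := h1 (show (0:ℝ) < 0 + 1 by norm_num)
    rw [E.lift] at h2
    have : (0:ℝ) < D := by exact_mod_cast h
    linarith

lemma strictAnti (h : D < 0) : StrictAnti f := by
  rcases E.diff.continuous.strictMono_of_inj E.inj with h1 | h1
  · exfalso
    have h2 := h1 (show (0:ℝ) < 0 + 1 by norm_num)
    rw [E.lift] at h2
    have : (D:ℝ) < 0 := by exact_mod_cast h
    linarith
  · exact h1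

lemma surj : Function.Surjective f := by
  intro y
  have hD := E.D_ne
  obtain ⟨n, hn⟩ := exists_nat_gt (|y - f 0| / |(D:ℝ)|)
  rw [div_lt_iff₀ (abs_pos.2 hD)] at hn
  have h1 := E.lift_int 0 n
  have h2 := E.lift_int 0 (-n)
  push_cast at h1 h2
  have hab := abs_lt.1 (show |y - f 0| < |(D:ℝ) * n| by rw [abs_mul, Nat.abs_cast]; linarith)
  have : y ∈ uIcc (f (0 + n)) (f (0 + -n)) := by
    rw [h1, h2, mem_uIcc]
    rcases abs_cases ((D:ℝ) * n) with ⟨h, -⟩ | ⟨h, -⟩ <;> rw [h] at hab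
    · right; constructor <;> linarith
    · left; constructor <;> linarith
  obtain ⟨x, -, hx⟩ := intermediate_value_uIcc (E.diff.continuous.continuousOn) this
  exact ⟨x, hx⟩

lemma bij : Function.Bijective f := ⟨E.inj, E.surj⟩

lemma comp {f' : ℝ → ℝ} {D' : ℤ} {κ' : ℝ} (E' : EM f' D' κ') : EM (f' ∘ f) (D' * D) (κ' * κ) where
  hC := E'.hC.comp E.hC
  lift x := by
    simp only [Function.comp]; rw [E.lift, E'.lift_int]; push_cast; ring
  hκ := mul_pos E'.hκ E.hκ
  hd x := by
    rw [deriv_comp _ (E'.diff _) (E.diff _), abs_mul]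
    exact mul_le_mul (E'.hd _) (E.hd _) E.hκ.le (abs_nonneg _)

lemma iterate (n : ℕ) : EM (f^[n]) (D ^ n) (κ ^ n) := by
  induction n with
  | zero =>
    refine ⟨contDiff_id, fun x => by simp, by simp, fun x => ?_⟩
    simp only [Function.iterate_zero, pow_zero]
    rw [deriv_id]; simp
  | succ n ih =>
    rw [Function.iterate_succ, pow_succ, pow_succ]
    exact E.comp ih

lemma sub_id (hκ : 1 < κ) : EM (fun x => f x - x) (D - 1) (κ - 1) where
  hC := E.hC.sub contDiff_id
  lift x := by rw [E.lift]; push_cast; ring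
  hκ := by linarith
  hd x := by
    rw [deriv_fun_sub (E.diff x) differentiableAt_fun_id, deriv_id'']
    have := E.hd x
    have h2 := abs_sub_abs_le_abs_sub (deriv f x) 1
    rw [abs_one] at h2
    linarith

/-- inverse -/
lemma exists_inv : ∃ ψ : ℝ → ℝ, (∀ y, f (ψ y) = y) ∧ (∀ x, ψ (f x) = x) ∧
    (∀ x y, |ψ x - ψ y| ≤ κ⁻¹ * |x - y|) := by
  refine ⟨Function.invFun f, Function.rightInverse_invFun E.surj, Function.leftInverse_invFun E.inj,
    fun x y => ?_⟩
  have := E.dist_lower (Function.invFun f x) (Function.invFun f y)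
  rw [Function.rightInverse_invFun E.surj, Function.rightInverse_invFun E.surj] at this
  rwa [← div_eq_inv_mul, le_div_iff₀ E.hκ, mul_comm]

end EM

/-! antidifferences over the integers -/

lemma exists_anti (Φ : ℤ → ℝ) : ∃ A : ℤ → ℝ, ∀ n, A (n + 1) = A n + Φ n := by
  refine ⟨fun n => ∑ k ∈ Finset.Ico 0 n, Φ k - ∑ k ∈ Finset.Ico n 0, Φ k, fun n => ?_⟩
  rcases le_or_gt 0 n with h | h
  · have e : Finset.Ico (0:ℤ) (n + 1) = insert n (Finset.Ico 0 n) := by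
      ext k; simp; omega
    dsimp only
    rw [e, Finset.sum_insert (by simp), Finset.Ico_eq_empty (by omega : ¬ n + 1 < 0),
      Finset.Ico_eq_empty (by omega : ¬ n < 0)]
    simp; ring
  · have e : Finset.Ico n (0:ℤ) = insert n (Finset.Ico (n + 1) 0) := by
      ext k; simp; omega
    dsimp only
    rw [e, Finset.sum_insert (by simp), Finset.Ico_eq_empty (by omega : ¬ 0 < n + 1),
      Finset.Ico_eq_empty (by omega : ¬ 0 < n)]
    simp

lemma sum_anti {Φ A : ℤ → ℝ} (hA : ∀ n, A (n + 1) = A n + Φ n) (a b : ℤ) (h : a ≤ b) :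
    ∑ k ∈ Finset.Ico a b, Φ k = A b - A a := by
  induction b, h using Int.leInduction with
  | base => simp
  | succ n hn ih =>
    have e : Finset.Ico a (n + 1) = insert n (Finset.Ico a n) := by
      ext k; simp; omega
    rw [e, Finset.sum_insert (by simp), ih, hA]; ring

/-- index set -/
def KI (m : ℤ) : Finset ℤ := Finset.Ico (min 0 m) (max 0 m)

lemma mem_KI {m k : ℤ} : k ∈ KI m ↔ min 0 m ≤ k ∧ k < max 0 m := by simp [KI]

lemma sum_KI {Φ A : ℤ → ℝ} (hA : ∀ n, A (n + 1) = A n + Φ n) (m : ℤ) :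
    ∑ k ∈ KI m, Φ k = m.sign * (A m - A 0) := by
  rw [KI, sum_anti hA _ _ (by omega)]
  rcases lt_trichotomy m 0 with h | h | h
  · rw [Int.sign_eq_neg_one_of_neg h, min_eq_right h.le, max_eq_left h.le]; push_cast; ring
  · simp [h]
  · rw [Int.sign_eq_one_of_pos h, min_eq_left h.le, max_eq_right h.le]; push_cast; ring

lemma sum_KI_KI (Φ : ℤ → ℝ) (d m : ℤ) :
    ∑ i ∈ KI d, ∑ k ∈ KI m, Φ (k + m * i) = ∑ k ∈ KI (m * d), Φ k := by
  obtain ⟨A, hA⟩ := exists_anti Φ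
  have h1 : ∀ i, ∑ k ∈ KI m, Φ (k + m * i) = m.sign * (A (m * (i + 1)) - A (m * i)) := fun i => by
    rw [sum_KI (A := fun k => A (k + m * i)) (fun n => by rw [← hA]; ring_nf)]
    ring_nf
  rw [sum_KI hA, Finset.sum_congr rfl fun i _ => h1 i, ← Finset.mul_sum,
    sum_KI (A := fun i => A (m * i)) (fun n => by ring)]
  rw [Int.sign_mul]; push_cast; simp; ring

end PV


namespace PV

lemma finsum_per {h : ℝ → ℝ} {D : ℤ} {κ : ℝ} (E : EM h D κ) (W : ℝ → ℝ)
    (hW : ∀ x, W (x + 1) = W x) (xk : ℤ → ℝ) (hxk : ∀ k, h (xk k) = k)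
    {A : ℤ → ℝ} (hA : ∀ n, A (n + 1) = A n + W (xk n)) :
    {x | x ∈ Set.Ico (0:ℝ) 1 ∧ ∃ k : ℤ, h x = k}.Finite ∧
    ∑ᶠ x ∈ {x | x ∈ Set.Ico (0:ℝ) 1 ∧ ∃ k : ℤ, h x = k}, W x = D.sign * (A D - A 0) := by
  have hper : ∀ k, xk (k + D) = xk k + 1 := fun k => by
    apply E.inj; rw [E.lift, hxk, hxk]; push_cast; ring
  have hdiff : ∀ c : ℤ, A (c + D) - A c = A D - A 0 := by
    have hs : ∀ c, A (c + 1 + D) - A (c + 1) = A (c + D) - A c := fun c => by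
      rw [show c + 1 + D = c + D + 1 by ring, hA, hA, hper, hW]; ring
    intro c
    induction c with
    | zero => simp
    | succ i ih => rw [hs, ih]
    | pred i ih => rw [← hs]; simpa using ih
  have hinj : Function.Injective xk := fun k l hkl => by
    have h1 := hxk k; have h2 := hxk l; rw [hkl, h2] at h1; exact_mod_cast h1.symm
  have key : ∀ S : Finset ℤ, {x | x ∈ Set.Ico (0:ℝ) 1 ∧ ∃ k : ℤ, h x = k} = Set.image xk (S : Set ℤ) →
      {x | x ∈ Set.Ico (0:ℝ) 1 ∧ ∃ k : ℤ, h x = k}.Finite ∧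
      ∑ᶠ x ∈ {x | x ∈ Set.Ico (0:ℝ) 1 ∧ ∃ k : ℤ, h x = k}, W x = ∑ k ∈ S, W (xk k) := by
    intro S hS
    rw [hS]
    refine ⟨S.finite_toSet.image _, ?_⟩
    rw [finsum_mem_image hinj.injOn, finsum_mem_coe_finset]
  have h1 : h 1 = h 0 + D := by simpa using E.lift 0
  have hset : ∀ S : Finset ℤ, (∀ k, k ∈ S ↔ xk k ∈ Set.Ico (0:ℝ) 1) →
      {x | x ∈ Set.Ico (0:ℝ) 1 ∧ ∃ k : ℤ, h x = k} = Set.image xk (S : Set ℤ) := by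
    intro S hS
    ext x
    constructor
    · rintro ⟨hx, k, hk⟩
      have : x = xk k := E.inj (by rw [hk, hxk])
      exact ⟨k, by simpa [hS, ← this] using hx, this.symm⟩
    · rintro ⟨k, hk, rfl⟩
      exact ⟨(hS k).1 hk, k, hxk k⟩
  rcases lt_or_gt_of_ne E.D_ne' with hD | hD
  · obtain ⟨k1, k2⟩ := key (Finset.Ico (⌊h 0⌋ + 1 + D) (⌊h 0⌋ + 1)) (hset _ fun k => by
      have hm := E.strictAnti hD
      rw [Finset.mem_Ico, Set.mem_Ico, ← hm.le_iff_ge, ← hm.lt_iff_gt, hxk, h1, Int.lt_add_one_iff,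
        Int.le_floor, and_comm]
      refine and_congr_right fun _ => ?_
      have : ⌊h 0⌋ + 1 + D ≤ k ↔ ⌊h 0 + D⌋ < k := by rw [Int.floor_add_intCast]; omega
      rw [this, Int.floor_lt])
    refine ⟨k1, ?_⟩
    rw [k2, sum_anti hA _ _ (by omega), Int.sign_eq_neg_one_of_neg hD, ← hdiff]
    push_cast; ring
  · obtain ⟨k1, k2⟩ := key (Finset.Ico ⌈h 0⌉ (⌈h 0⌉ + D)) (hset _ fun k => by
      have hm := E.strictMono hD
      rw [Finset.mem_Ico, Set.mem_Ico, ← hm.le_iff_le, ← hm.lt_iff_lt, hxk, h1, ← Int.ceil_add_intCast,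
        Int.lt_ceil, Int.ceil_le])
    refine ⟨k1, ?_⟩
    rw [k2, sum_anti hA _ _ (by omega), Int.sign_eq_one_of_pos hD, ← hdiff]
    push_cast; ring

/-- A circle expanding map with a potential: working data. -/
structure Dat (T : ℝ → ℝ) (d : ℤ) (κ : ℝ) (φ : ℝ → ℝ) (K p : ℝ) (ψ : ℝ → ℝ) : Prop where
  E : EM T d κ
  hκ : 1 < κ
  hp : T p = p
  hψ1 : ∀ y, T (ψ y) = y
  hψ2 : ∀ x y, |ψ x - ψ y| ≤ κ⁻¹ * |x - y|
  hφ : ∀ x y, |φ x - φ y| ≤ K * |x - y|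
  hφp : ∀ x, φ (x + 1) = φ x
  hK : 0 ≤ K

lemma per_int {φ : ℝ → ℝ} (h : ∀ x, φ (x + 1) = φ x) (x : ℝ) (k : ℤ) : φ (x + k) = φ x := by
  have : Function.Periodic φ 1 := h
  simpa using this.int_mul k x

namespace Dat
variable {T : ℝ → ℝ} {d : ℤ} {κ : ℝ} {φ : ℝ → ℝ} {K p : ℝ} {ψ : ℝ → ℝ} (A : Dat T d κ φ K p ψ)
include A

lemma Tn_p (n : ℕ) : T^[n] p = p := Function.iterate_fixed A.hp n

lemma mem_X {n : ℕ} {y : ℝ} {x : ℝ} {k : ℤ} (hx : x ∈ Icc p (p + 1)) (hk : k ∈ KI (d ^ n))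
    (hy : T^[n] y = x + k) : y ∈ Icc p (p + 1) := by
  have En := A.E.iterate n
  have h0 := A.Tn_p n
  have h1 := En.lift p
  rw [h0] at h1
  rw [mem_KI] at hk
  rcases lt_or_gt_of_ne En.D_ne' with hD | hD
  · have hm := En.strictAnti hD
    rw [min_eq_right hD.le, max_eq_left hD.le] at hk
    have h2 : ((d^n : ℤ):ℝ) ≤ k := by exact_mod_cast hk.1
    have h3 : (k:ℝ) + 1 ≤ 0 := by exact_mod_cast hk.2
    exact ⟨hm.le_iff_ge.1 (by rw [hy, h0]; linarith [hx.2]), hm.le_iff_ge.1 (by rw [hy, h1]; linarith [hx.1])⟩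
  · have hm := En.strictMono hD
    rw [min_eq_left hD.le, max_eq_right hD.le] at hk
    have h2 : (0:ℝ) ≤ k := by exact_mod_cast hk.1
    have h3 : (k:ℝ) + 1 ≤ (d^n : ℤ) := by exact_mod_cast hk.2
    exact ⟨hm.le_iff_le.1 (by rw [hy, h0]; linarith [hx.1]), hm.le_iff_le.1 (by rw [hy, h1]; linarith [hx.2])⟩

lemma q_pos : 0 < κ⁻¹ := inv_pos.2 A.E.hκ
lemma q_lt : κ⁻¹ < 1 := inv_lt_one_of_one_lt₀ A.hκ

lemma mem_X1 (x : Icc p (p + 1)) (i : ↥(KI d)) : ψ (x + (i:ℤ)) ∈ Icc p (p + 1) :=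
  A.mem_X (n := 1) (x := x) (k := i) x.2 (by simp) (by simp [A.hψ1])

/-- The associated iterated function system. -/
def S : IFS (Icc p (p + 1)) ↥(KI d) κ⁻¹ K where
  ψ i x := ⟨ψ (x + (i:ℤ)), A.mem_X1 x i⟩
  G i x := Real.exp (φ (ψ (x + (i:ℤ))))
  hψ i x y := by
    rw [Subtype.dist_eq, Subtype.dist_eq, Real.dist_eq, Real.dist_eq]
    refine (A.hψ2 _ _).trans (le_of_eq ?_)
    congr 2; ring
  hpos i x := Real.exp_pos _
  hG i x y := by
    rw [← Real.exp_add, Real.exp_le_exp, Subtype.dist_eq, Real.dist_eq]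
    have h1 := (le_abs_self _).trans (A.hφ (ψ (x + (i:ℤ))) (ψ (y + (i:ℤ))))
    have h2 := A.hψ2 (x + (i:ℤ)) (y + (i:ℤ))
    rw [add_sub_add_right_eq_sub] at h2
    have h3 : κ⁻¹ * |(x:ℝ) - y| ≤ |(x:ℝ) - y| := mul_le_of_le_one_left (abs_nonneg _) A.q_lt.le
    have h4 := mul_le_mul_of_nonneg_left (h2.trans h3) A.hK
    linarith

omit A in
/-- integer label of a word -/
def kw (d : ℤ) : List ↥(KI d) → ℤ
  | [] => 0
  | i :: w => kw d w + d ^ w.length * i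

lemma T_wψ (w : List ↥(KI d)) (x : Icc p (p + 1)) : T^[w.length] (A.S.wψ w x) = x + kw d w := by
  induction w with
  | nil => simp [IFS.wψ, kw]
  | cons i w ih =>
    rw [List.length_cons, Function.iterate_succ_apply, IFS.wψ]
    change T^[w.length] (T (ψ _)) = _
    rw [A.hψ1, (A.E.iterate _).lift_int, ih, kw]
    push_cast; ring

lemma birk_add_int {φ : ℝ → ℝ} (hφp : ∀ x, φ (x + 1) = φ x) (n : ℕ) (x : ℝ) (k : ℤ) :
    birkhoff T φ n (x + k) = birkhoff T φ n x := by
  refine Finset.sum_congr rfl fun i _ => ?_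
  rw [(A.E.iterate i).lift_int, ← Int.cast_mul, per_int hφp]

omit A in
lemma birk_succ (φ : ℝ → ℝ) (n : ℕ) (x : ℝ) :
    birkhoff T φ (n + 1) x = birkhoff T φ n (T x) + φ x := by
  simp [birkhoff, Finset.sum_range_succ']

lemma wG_eq (w : List ↥(KI d)) (x : Icc p (p + 1)) :
    A.S.wG w x = Real.exp (birkhoff T φ w.length (A.S.wψ w x)) := by
  induction w with
  | nil => simp [IFS.wG, birkhoff]
  | cons i w ih =>
    rw [List.length_cons, birk_succ, IFS.wG, ih, IFS.wψ]
    change _ * Real.exp (φ (ψ _)) = Real.exp (birkhoff T φ w.length (T (ψ _)) + φ (ψ _))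
    rw [A.hψ1, A.birk_add_int A.hφp, Real.exp_add]

omit A in
lemma sumW_kw (n : ℕ) (Φ : ℤ → ℝ) :
    sumW n (fun w : List ↥(KI d) => Φ (kw d w)) = ∑ k ∈ KI (d ^ n), Φ k := by
  induction n generalizing Φ with
  | zero =>
    have : Finset.Ico (0:ℤ) 1 = {0} := by decide
    simp [sumW, kw, KI, this]
  | succ n ih =>
    rw [sumW]
    have : ∀ i : ↥(KI d), sumW n (fun w : List ↥(KI d) => Φ (kw d (i :: w))) =
        ∑ k ∈ KI (d ^ n), Φ (k + d ^ n * i) := fun i => by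
      rw [← ih (fun k => Φ (k + d ^ n * i))]
      refine sumW_congr _ _ _ fun w hw => ?_
      rw [kw, hw]
    rw [Finset.sum_congr rfl fun i _ => this i,
      Finset.sum_coe_sort (KI d) (fun i => ∑ k ∈ KI (d ^ n), Φ (k + d ^ n * i)), sum_KI_KI, pow_succ]

omit A in
lemma kw_mem (hd : d ≠ 0) (w : List ↥(KI d)) : kw d w ∈ KI (d ^ w.length) := by
  induction w with
  | nil => simp [kw, KI]
  | cons i w ih =>
    obtain ⟨i, hi⟩ := i
    rw [kw, List.length_cons, pow_succ]
    have hm : d ^ w.length ≠ 0 := pow_ne_zero _ hd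
    generalize d ^ w.length = m at *
    generalize kw d w = k at *
    rw [mem_KI] at *
    dsimp only
    rcases lt_or_gt_of_ne hd with h | h <;> rcases lt_or_gt_of_ne hm with h' | h'
    · have := mul_pos_of_neg_of_neg h' h
      rw [min_eq_right h.le, max_eq_left h.le] at hi
      rw [min_eq_right h'.le, max_eq_left h'.le] at ih
      rw [min_eq_left this.le, max_eq_right this.le]
      constructor <;> nlinarith
    · have := mul_neg_of_pos_of_neg h' h
      rw [min_eq_right h.le, max_eq_left h.le] at hi
      rw [min_eq_left h'.le, max_eq_right h'.le] at ih
      rw [min_eq_right this.le, max_eq_left this.le]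
      constructor <;> nlinarith
    · have := mul_neg_of_neg_of_pos h' h
      rw [min_eq_left h.le, max_eq_right h.le] at hi
      rw [min_eq_right h'.le, max_eq_left h'.le] at ih
      rw [min_eq_right this.le, max_eq_left this.le]
      constructor <;> nlinarith
    · have := mul_pos h' h
      rw [min_eq_left h.le, max_eq_right h.le] at hi
      rw [min_eq_left h'.le, max_eq_right h'.le] at ih
      rw [min_eq_left this.le, max_eq_right this.le]
      constructor <;> nlinarith

lemma Ln_one (n : ℕ) (ψn : ℝ → ℝ) (hψn : ∀ y, T^[n] (ψn y) = y) (x : Icc p (p + 1)) :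
    A.S.L^[n] IFS.one x = ∑ k ∈ KI (d ^ n), Real.exp (birkhoff T φ n (ψn (x + k))) := by
  rw [A.S.Ln_eq, ← sumW_kw]
  refine sumW_congr _ _ _ fun w hw => ?_
  rw [IFS.one, mul_one, A.wG_eq, hw]
  congr 2
  apply (A.E.iterate n).inj
  rw [hψn, ← hw, A.T_wψ]

end Dat
end PV


namespace PV

/-- the potential -/
def pot (T g : ℝ → ℝ) (u : ℝ) : ℝ → ℝ := fun x => -u * g x - Real.log |deriv T x|

/-- periodic orbit sum (real valued) -/
def cR (T g : ℝ → ℝ) (u : ℝ) (n : ℕ) : ℝ :=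
  ∑ᶠ x ∈ periodicPtsIn T n, Real.exp (-u * birkhoff T g n x) / |deriv (T^[n]) x - 1|

namespace EM
variable {T : ℝ → ℝ} {d : ℤ} {κ : ℝ} (E : EM T d κ)
include E

lemma deriv_ne (x : ℝ) : deriv T x ≠ 0 := by
  have := E.hd x; have := E.hκ
  intro h; simp [h] at *; linarith

lemma deriv_per (x : ℝ) : deriv T (x + 1) = deriv T x := by
  have : (fun y => T (y + 1)) = fun y => T y + d := funext E.lift
  have h := congrArg (fun f => deriv f x) this
  simpa [deriv_comp_add_const] using h

lemma deriv_iter_succ (n : ℕ) (x : ℝ) :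
    deriv (T^[n+1]) x = deriv (T^[n]) (T x) * deriv T x := by
  rw [Function.iterate_succ, deriv_comp _ ((E.iterate n).diff _) (E.diff _)]

lemma exp_birk (g : ℝ → ℝ) (u : ℝ) (n : ℕ) (x : ℝ) :
    Real.exp (birkhoff T (pot T g u) n x) = Real.exp (-u * birkhoff T g n x) / |deriv (T^[n]) x| := by
  induction n generalizing x with
  | zero =>
    have : deriv (T^[0]) x = 1 := by rw [Function.iterate_zero]; simp
    rw [this]; simp [birkhoff]
  | succ n ih =>
    rw [Dat.birk_succ, Dat.birk_succ, Real.exp_add, ih, E.deriv_iter_succ, abs_mul, mul_add,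
      Real.exp_add, pot, Real.exp_sub, Real.exp_log (abs_pos.2 (E.deriv_ne x))]
    ring

lemma birk_per {φ : ℝ → ℝ} (hφp : ∀ x, φ (x + 1) = φ x) (n : ℕ) (x : ℝ) :
    birkhoff T φ n (x + 1) = birkhoff T φ n x := by
  refine Finset.sum_congr rfl fun i _ => ?_
  rw [(E.iterate i).lift, per_int hφp]

lemma birk_cont {φ : ℝ → ℝ} (hφ : Continuous φ) (n : ℕ) : Continuous (birkhoff T φ n) := by
  unfold birkhoff
  exact continuous_finsetSum _ fun i _ => hφ.comp (E.iterate i).diff.continuous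

lemma deriv_iter_per (n : ℕ) (x : ℝ) : deriv (T^[n]) (x + 1) = deriv (T^[n]) x :=
  (E.iterate n).deriv_per x

lemma sign_deriv (x : ℝ) : (d.sign : ℝ) * deriv T x = |deriv T x| := by
  rcases lt_or_gt_of_ne E.D_ne' with hD | hD
  · have h := (E.strictAnti hD).antitone.deriv_nonpos (x := x)
    rw [Int.sign_eq_neg_one_of_neg hD, abs_of_nonpos h]; push_cast; ring
  · have h := (E.strictMono hD).monotone.deriv_nonneg (x := x)
    rw [Int.sign_eq_one_of_pos hD, abs_of_nonneg h]; push_cast; ring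

/-- change of variables -/
lemma int_change {J : ℝ → ℝ} (hJ : Continuous J) {p : ℝ} (hp : T p = p) {ψ : ℝ → ℝ}
    (hψ : ∀ y, T (ψ y) = y) (hψc : Continuous ψ) :
    ∫ x in p..(p+1), ∑ k ∈ KI d, J (ψ (x + k)) = ∫ x in p..(p+1), J x * |deriv T x| := by
  set H := J ∘ ψ with hH
  have hHc : Continuous H := hJ.comp hψc
  have hii : ∀ a b, IntervalIntegrable H volume a b := fun a b => hHc.intervalIntegrable a b
  rw [intervalIntegral.integral_finsetSum]
  · have h1 : ∀ k : ℤ, ∫ x in p..(p+1), J (ψ (x + k)) = ∫ x in (p+k)..(p+k+1), H x := fun k => by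
      rw [show p + (k:ℝ) + 1 = p + 1 + k by ring,
        ← intervalIntegral.integral_comp_add_right (fun x => H x) (k:ℝ)]
      rfl
    rw [Finset.sum_congr rfl fun k _ => h1 k,
      sum_KI (A := fun k : ℤ => ∫ x in p..(p+k), H x)
        (fun n => by
          rw [intervalIntegral.integral_add_adjacent_intervals (hii _ _) (hii _ _)]
          push_cast; rw [add_assoc])]
    have h2 : ∫ x in p..(p+1), H (T x) * deriv T x = ∫ x in (T p)..(T (p+1)), H x := by
      exact intervalIntegral.integral_comp_mul_deriv (fun x _ => (E.diff x).hasDerivAt)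
        ((E.hC.continuous_deriv (by norm_num)).continuousOn) hHc
    rw [E.lift, hp] at h2
    rw [← h2, Int.cast_zero, add_zero, intervalIntegral.integral_same, sub_zero,
      ← intervalIntegral.integral_const_mul]
    refine intervalIntegral.integral_congr fun x _ => ?_
    have : ψ (T x) = x := E.inj (hψ _)
    rw [← E.sign_deriv, hH, Function.comp, this]; ring
  · intro k _
    exact (hHc.comp (continuous_id.add continuous_const)).intervalIntegrable _ _

end EM

namespace Dat
variable {T g : ℝ → ℝ} {d : ℤ} {κ u : ℝ} {K p : ℝ} {ψ : ℝ → ℝ} (A : Dat T d κ (pot T g u) K p ψ)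
include A

lemma int_Ln (hg : Continuous g) (n : ℕ) :
    ∃ F : ℝ → ℝ, Continuous F ∧ (∀ x : Icc p (p+1), F x = A.S.L^[n] IFS.one x) ∧
      ∫ x in p..(p+1), F x = ∫ x in p..(p+1), Real.exp (-u * birkhoff T g n x) := by
  have En := A.E.iterate n
  obtain ⟨ψn, h1, h2, h3⟩ := En.exists_inv
  have hc : Continuous ψn :=
    (LipschitzWith.of_dist_le_mul (K := ⟨(κ^n)⁻¹, (inv_pos.2 En.hκ).le⟩) (fun x y => h3 x y)).continuous
  have hJ : Continuous fun x => Real.exp (birkhoff T (pot T g u) n x) := by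
    simp only [A.E.exp_birk]
    refine Continuous.div ?_ ?_ fun x => (abs_pos.2 (En.deriv_ne x)).ne'
    · exact Real.continuous_exp.comp (continuous_const.mul (A.E.birk_cont hg n))
    · exact (En.hC.continuous_deriv (by norm_num)).abs
  refine ⟨fun x => ∑ k ∈ KI (d ^ n), Real.exp (birkhoff T (pot T g u) n (ψn (x + k))), ?_,
    fun x => (A.Ln_one n ψn h1 x).symm, ?_⟩
  · exact continuous_finsetSum _ fun k _ => hJ.comp (hc.comp (continuous_id.add continuous_const))
  · rw [En.int_change hJ (A.Tn_p n) h1 hc]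
    refine intervalIntegral.integral_congr fun x _ => ?_
    rw [A.E.exp_birk, div_mul_cancel₀ _ (abs_pos.2 (En.deriv_ne x)).ne']

lemma sum_fix (n : ℕ) (hn : n ≠ 0) (V : ℝ → ℝ) (hV : ∀ x, V (x + 1) = V x) :
    (periodicPtsIn T n).Finite ∧
    ∃ xf : List ↥(KI d) → Icc p (p+1), (∀ w, w.length = n → A.S.wψ w (xf w) = xf w) ∧
      |∑ᶠ x ∈ periodicPtsIn T n, V x - sumW n (fun w => V (xf w))| ≤ |V p| := by
  have En := A.E.iterate n
  have hκn : 1 < κ ^ n := one_lt_pow₀ A.hκ hn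
  have Eh := En.sub_id hκn
  obtain ⟨inv, hinv, -, -⟩ := Eh.exists_inv
  set xk : ℤ → ℝ := fun k => inv k with hxk
  have hx : ∀ k : ℤ, T^[n] (xk k) = xk k + k := fun k => by
    have := hinv k; rw [hxk]; dsimp only; linarith
  have hset : periodicPtsIn T n = {x | x ∈ Set.Ico (0:ℝ) 1 ∧ ∃ k : ℤ, T^[n] x - x = k} := by
    ext x
    simp only [periodicPtsIn, mem_ofPred_eq, sub_eq_iff_eq_add']
  obtain ⟨B, hB⟩ := exists_anti (fun k => V (xk k))
  obtain ⟨hfin, hsum⟩ := finsum_per Eh V hV xk (fun k => hinv k) hB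
  rw [hset]
  refine ⟨hfin, ?_⟩
  have hD1 : κ ^ n ≤ |((d ^ n : ℤ) : ℝ)| := En.D_lower
  have hD2 : 1 < |d ^ n| := by
    have : (1:ℝ) < |((d ^ n : ℤ) : ℝ)| := by linarith
    exact_mod_cast this
  have hxp : xk 0 = p := by
    apply Eh.inj
    have h1 := hx 0
    have h2 := A.Tn_p n
    simp only [Int.cast_zero, add_zero] at h1
    dsimp only
    rw [h1, h2, sub_self, sub_self]
  have hxp1 : xk (d ^ n - 1) = p + 1 := by
    apply Eh.inj
    dsimp only
    rw [hx, En.lift, A.Tn_p]; push_cast; ring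
  have hmem : ∀ w : List ↥(KI d), w.length = n → xk (kw d w) ∈ Icc p (p+1) := by
    intro w hw
    have hk := kw_mem A.E.D_ne' w
    rw [hw, mem_KI] at hk
    rcases lt_abs.1 hD2 with h | h
    · have hm := Eh.strictMono (by omega)
      rw [min_eq_left (by omega), max_eq_right (by omega)] at hk
      have e1 : (0:ℝ) ≤ kw d w := by exact_mod_cast hk.1
      have e2 : (kw d w : ℝ) ≤ ((d ^ n - 1 : ℤ) : ℝ) := by
        have : kw d w ≤ d ^ n - 1 := by omega
        exact_mod_cast this
      rw [← hxp1, mem_Icc]; nth_rewrite 1 [← hxp]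
      refine ⟨hm.le_iff_le.1 ?_, hm.le_iff_le.1 ?_⟩
      · rw [hinv, hinv]; simpa using e1
      · rw [hinv, hinv]; exact e2
    · have hm := Eh.strictAnti (by omega)
      rw [min_eq_right (by omega), max_eq_left (by omega)] at hk
      have e1 : (kw d w : ℝ) ≤ 0 := by exact_mod_cast hk.2.le
      have e2 : ((d ^ n - 1 : ℤ) : ℝ) ≤ (kw d w : ℝ) := by
        have : d ^ n - 1 ≤ kw d w := by omega
        exact_mod_cast this
      rw [← hxp1, mem_Icc]; nth_rewrite 1 [← hxp]
      refine ⟨hm.le_iff_ge.1 ?_, hm.le_iff_ge.1 ?_⟩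
      · rw [hinv, hinv]; simpa using e1
      · rw [hinv, hinv]; exact e2
  classical
  refine ⟨fun w => if hw : w.length = n then ⟨xk (kw d w), hmem w hw⟩ else
    ⟨p, by simp⟩, fun w hw => ?_, ?_⟩
  · dsimp only
    rw [dif_pos hw]
    apply Subtype.ext
    apply En.inj
    have := A.T_wψ w ⟨xk (kw d w), hmem w hw⟩
    rw [hw] at this
    rw [this]
    exact (hx _).symm
  · have e : sumW n (fun w => V ((if hw : w.length = n then (⟨xk (kw d w), hmem w hw⟩ : Icc p (p+1))
        else ⟨p, by simp⟩ : Icc p (p+1)))) = ∑ k ∈ KI (d ^ n), V (xk k) := by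
      rw [← sumW_kw n (fun k => V (xk k))]
      refine sumW_congr _ _ _ fun w hw => ?_
      rw [dif_pos hw]
    rw [e, hsum, sum_KI hB]
    have hs : (d ^ n - 1).sign = (d ^ n).sign := by
      rcases lt_abs.1 hD2 with h | h
      · rw [Int.sign_eq_one_of_pos (by omega), Int.sign_eq_one_of_pos (by omega)]
      · rw [Int.sign_eq_neg_one_of_neg (by omega), Int.sign_eq_neg_one_of_neg (by omega)]
    have h3 := hB (d ^ n - 1)
    rw [hxp1, hV, sub_add_cancel] at h3
    rw [hs, h3]
    have h4 : |((d ^ n).sign : ℝ)| ≤ 1 := by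
      rcases lt_abs.1 hD2 with h | h
      · rw [Int.sign_eq_one_of_pos (by omega)]; simp
      · rw [Int.sign_eq_neg_one_of_neg (by omega)]; simp
    have e3 : ((d ^ n).sign : ℝ) * (B (d ^ n - 1) - B 0) - (d ^ n).sign * (B (d ^ n - 1) + V p - B 0)
      = -((d ^ n).sign * V p) := by ring
    rw [e3, abs_neg, abs_mul]
    exact mul_le_of_le_one_left (abs_nonneg _) h4

lemma c_v (n : ℕ) (hn : n ≠ 0) (hfin : (periodicPtsIn T n).Finite) :
    |cR T g u n - ∑ᶠ x ∈ periodicPtsIn T n, Real.exp (birkhoff T (pot T g u) n x)| ≤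
      κ / (κ - 1) * κ⁻¹ ^ n * ∑ᶠ x ∈ periodicPtsIn T n, Real.exp (birkhoff T (pot T g u) n x) := by
  have En := A.E.iterate n
  have hκ := A.hκ
  have hκn : 1 < κ ^ n := one_lt_pow₀ A.hκ hn
  rw [cR, finsum_mem_eq_finite_toFinset_sum _ hfin, finsum_mem_eq_finite_toFinset_sum _ hfin,
    ← Finset.sum_sub_distrib, Finset.mul_sum]
  refine (Finset.abs_sum_le_sum_abs _ _).trans (Finset.sum_le_sum fun x _ => ?_)
  rw [A.E.exp_birk]
  set P := deriv (T^[n]) x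
  set e := Real.exp (-u * birkhoff T g n x)
  have he : 0 < e := Real.exp_pos _
  have hP : κ ^ n ≤ |P| := En.hd x
  have hP0 : 0 < |P| := by linarith
  have hP1 : |P| - 1 ≤ |P - 1| := by
    have h2 := abs_sub_abs_le_abs_sub P 1; rw [abs_one] at h2; exact h2
  have hP2 : |P - 1| ≤ |P| + 1 := by
    have := abs_sub P 1; rw [abs_one] at this; exact this
  have hP3 : 0 < |P - 1| := by linarith
  have e1 : e / |P - 1| - e / |P| = e / |P| * ((|P| - |P - 1|) / |P - 1|) := by
    field_simp
  rw [e1, abs_mul, abs_of_pos (div_pos he hP0), abs_div, abs_abs, mul_comm]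
  refine mul_le_mul_of_nonneg_right ?_ (div_pos he hP0).le
  have h5 : |(|P| - |P - 1|)| ≤ 1 := by rw [abs_le]; constructor <;> linarith
  have h6 : κ ^ n * (κ - 1) ≤ κ * (κ ^ n - 1) := by
    have : κ ≤ κ ^ n := by
      obtain ⟨m, rfl⟩ := Nat.exists_eq_succ_of_ne_zero hn
      rw [pow_succ]; exact le_mul_of_one_le_left (by linarith) (one_le_pow₀ hκ.le)
    nlinarith
  calc _ ≤ 1 / (κ ^ n - 1) := by
        apply div_le_div₀ (by norm_num) h5 (by linarith) (by linarith)
    _ ≤ κ / (κ - 1) * κ⁻¹ ^ n := by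
        rw [inv_pow, ← div_eq_mul_inv, div_div, div_le_div_iff₀ (by linarith)
          (mul_pos (by linarith) (by linarith))]
        linarith

end Dat
end PV


namespace PV

lemma le_of_pow_le {x y C : ℝ} (hy : 0 < y) (h : ∀ n : ℕ, x ^ n ≤ C * y ^ n) : x ≤ y := by
  by_contra hlt
  push Not at hlt
  have h1 : 1 < x / y := (one_lt_div hy).2 hlt
  obtain ⟨n, hn⟩ := pow_unbounded_of_one_lt C h1
  rw [div_pow, lt_div_iff₀ (by positivity)] at hn
  linarith [h n]

/-- elementary error bound for the trace asymptotics -/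
lemma trace_err {a q θ ω : ℝ} (ha : 0 ≤ a) (hq : 0 < q) (hθ : 0 < θ) (hω : 0 < ω) (hω1 : ω < 1)
    (hqω : q ≤ ω ^ 2) (hθω : θ ≤ ω ^ 2) (n : ℕ) {b l : ℝ} (hl : 0 < l)
    (h1 : b ≤ Real.exp (2 * a * q ^ (n / 2)) * (1 + Real.exp (2 * a) * θ ^ (n - n / 2)) * l)
    (h2 : Real.exp (-(2 * a * q ^ (n / 2))) * l ≤ b + Real.exp (2 * a) * θ ^ (n - n / 2) * l) :
    |b - l| ≤ (Real.exp (2 * a) * (2 * a) * ω⁻¹ + Real.exp (2 * a) * Real.exp (2 * a)) * ω ^ n * l := by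
  have hq1 : q ^ (n / 2) ≤ ω⁻¹ * ω ^ n := by
    have h3 : q ^ (n / 2) ≤ ω ^ (2 * (n / 2)) := by rw [pow_mul]; gcongr
    rw [le_inv_mul_iff₀ hω]
    calc ω * q ^ (n / 2) ≤ ω * ω ^ (2 * (n / 2)) := by gcongr
      _ = ω ^ (2 * (n / 2) + 1) := by rw [pow_succ]; ring
      _ ≤ ω ^ n := pow_le_pow_of_le_one hω.le hω1.le (by omega)
  have hθ1 : θ ^ (n - n / 2) ≤ ω ^ n := by
    have h3 : θ ^ (n - n / 2) ≤ ω ^ (2 * (n - n / 2)) := by rw [pow_mul]; gcongr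
    exact h3.trans (pow_le_pow_of_le_one hω.le hω1.le (by omega))
  have hq2 : q ^ (n / 2) ≤ 1 := pow_le_one₀ hq.le (hqω.trans (by nlinarith))
  set x := 2 * a * q ^ (n / 2) with hx
  set y := Real.exp (2 * a) * θ ^ (n - n / 2) with hy
  have hx0 : 0 ≤ x := by positivity
  have hy0 : 0 ≤ y := by positivity
  have hxa : x ≤ 2 * a := by rw [hx]; exact mul_le_of_le_one_right (by positivity) hq2
  have he : Real.exp x ≤ Real.exp (2 * a) := Real.exp_le_exp.2 hxa
  have he1 : 1 ≤ Real.exp (2 * a) := Real.one_le_exp (by linarith)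
  have ex : Real.exp x - 1 ≤ Real.exp (2 * a) * x := by
    have h4 := Real.one_sub_le_exp_neg x
    have h5 : Real.exp x * Real.exp (-x) = 1 := by rw [← Real.exp_add]; simp
    have h6 := Real.exp_pos x
    nlinarith
  have ey : 1 - x ≤ Real.exp (-x) := Real.one_sub_le_exp_neg x
  have hX : x ≤ 2 * a * ω⁻¹ * ω ^ n := by
    rw [hx, mul_assoc (2 * a)]; gcongr
  have hY : y ≤ Real.exp (2 * a) * ω ^ n := by rw [hy]; gcongr
  have tot : Real.exp (2 * a) * x + Real.exp (2 * a) * y ≤ (Real.exp (2 * a) * (2 * a) * ω⁻¹ + Real.exp (2 * a) * Real.exp (2 * a)) * ω ^ n := by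
    have := mul_le_mul_of_nonneg_left hX (Real.exp_pos (2*a)).le
    have := mul_le_mul_of_nonneg_left hY (Real.exp_pos (2*a)).le
    linarith
  have tot2 := mul_le_mul_of_nonneg_right tot hl.le
  rw [abs_le]
  constructor
  · have h7 : (1 - x) * l ≤ Real.exp (-x) * l := by gcongr
    have h8 : x ≤ Real.exp (2 * a) * x := le_mul_of_one_le_left hx0 he1
    have h9 : y ≤ Real.exp (2 * a) * y := le_mul_of_one_le_left hy0 he1
    have := mul_le_mul_of_nonneg_right (add_le_add h8 h9) hl.le
    linarith
  · have h7 : Real.exp x * (1 + y) - 1 ≤ Real.exp (2 * a) * x + Real.exp (2 * a) * y := by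
      have : Real.exp x * y ≤ Real.exp (2 * a) * y := by gcongr
      linarith
    have := mul_le_mul_of_nonneg_right h7 hl.le
    linarith

lemma birk_abs_le {T g : ℝ → ℝ} {M : ℝ} (hM : ∀ x, |g x| ≤ M) (n : ℕ) (x : ℝ) :
    |birkhoff T g n x| ≤ n * M := by
  unfold birkhoff
  refine (Finset.abs_sum_le_sum_abs _ _).trans ((Finset.sum_le_sum fun i _ => hM _).trans ?_)
  simp

/-- Main asymptotics for a single map, with uniform constants. -/
theorem asymp (κ B M : ℝ) (hκ : 1 < κ) (hB : 0 ≤ B) (hM : 0 ≤ M) :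
    ∃ η C θ a : ℝ, 0 < η ∧ η ≤ 1 ∧ 0 < C ∧ 0 < θ ∧ θ < 1 ∧
    ∀ (T g : ℝ → ℝ) (d : ℤ) (u : ℝ), EM T d κ →
      (∀ x y, |(Real.log |deriv T x|) - (Real.log |deriv T y|)| ≤ B * |x - y|) →
      (∀ x, g (x + 1) = g x) → (∀ x, |g x| ≤ M) → (∀ x y, |g x - g y| ≤ M * |x - y|) →
      |u| ≤ η →
      (∀ n, n ≠ 0 → (periodicPtsIn T n).Finite) ∧
      ∃ lam : ℝ, 0 < lam ∧ (∀ n, n ≠ 0 → |cR T g u n - lam ^ n| ≤ C * θ ^ n) ∧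
        lam ≤ Real.exp (|u| * M) ∧ Real.exp (-(|u| * M)) ≤ lam ∧
        ∀ n, Real.exp (-a) * lam ^ n ≤ ∫ x in (0:ℝ)..1, Real.exp (-u * birkhoff T g n x) ∧
          ∫ x in (0:ℝ)..1, Real.exp (-u * birkhoff T g n x) ≤ Real.exp a * lam ^ n := by
  have hκ0 : 0 < κ := by linarith
  set q := κ⁻¹ with hq
  have hq0 : 0 < q := inv_pos.2 hκ0
  have hq1 : q < 1 := inv_lt_one_of_one_lt₀ hκ
  obtain ⟨a, t, s, θ, G⟩ := exists_good hq0 hq1 (add_nonneg hB hM : 0 ≤ B + M)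
  have hθ0 := G.θ_pos
  have hθ1 := G.θ_lt
  have ha := G.ha
  set ω := Real.sqrt (max q θ) with hω
  have hmx0 : 0 < max q θ := lt_max_of_lt_left hq0
  have hω0 : 0 < ω := Real.sqrt_pos.2 hmx0
  have hωsq : ω ^ 2 = max q θ := Real.sq_sqrt hmx0.le
  have hω1 : ω < 1 := by rw [hω, Real.sqrt_lt' one_pos]; simp [hq1, hθ1]
  have hqω : q ≤ ω ^ 2 := by rw [hωsq]; exact le_max_left _ _
  have hθω : θ ≤ ω ^ 2 := by rw [hωsq]; exact le_max_right _ _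
  have hqω' : q ≤ ω := hqω.trans (by nlinarith)
  set δ := -Real.log ω with hδ
  have hδ0 : 0 < δ := by rw [hδ]; have := Real.log_neg hω0 hω1; linarith
  set C1 := Real.exp (2 * a) * (2 * a) * ω⁻¹ + Real.exp (2 * a) * Real.exp (2 * a) with hC1
  have hC1' : 0 ≤ C1 := by positivity
  set C2 := κ / (κ - 1) with hC2
  have hC2' : 0 ≤ C2 := div_nonneg hκ0.le (by linarith)
  set η := min 1 (δ / (2 * (M + 1))) with hη
  have hη0 : 0 < η := lt_min one_pos (by positivity)
  have hηM : η * M ≤ δ / 2 := by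
    have h1 : η ≤ δ / (2 * (M + 1)) := min_le_right _ _
    have h2 : η * (2 * (M + 1)) ≤ δ := by rwa [le_div_iff₀ (by positivity)] at h1
    nlinarith
  set Λ := Real.exp (η * M) with hΛ
  have hΛ0 : 0 < Λ := Real.exp_pos _
  have hΛ1 : 1 ≤ Λ := Real.one_le_exp (by positivity)
  have hΛω : ω * Λ ≤ Real.exp (-(δ / 2)) := by
    have : ω = Real.exp (-δ) := by rw [hδ, neg_neg, Real.exp_log hω0]
    rw [this, hΛ, ← Real.exp_add, Real.exp_le_exp]; linarith
  refine ⟨η, C1 + 1 + C2 * (2 + C1), Real.exp (-(δ / 2)), a, hη0, min_le_left _ _, by positivity,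
    Real.exp_pos _, by rw [Real.exp_lt_one_iff]; linarith, ?_⟩
  intro T g d u E hlog hgp hgM hgL hu
  have hu1 : |u| ≤ 1 := hu.trans (min_le_left _ _)
  have hgc : Continuous g :=
    (LipschitzWith.of_dist_le_mul (K := ⟨M, hM⟩) (fun x y => hgL x y)).continuous
  obtain ⟨p, hp⟩ := (E.sub_id hκ).surj 0
  obtain ⟨ψ, hψ1, -, hψ2⟩ := E.exists_inv
  have A : Dat T d κ (pot T g u) (B + M) p ψ := by
    refine ⟨E, hκ, by linarith, hψ1, hψ2, fun x y => ?_, fun x => ?_, by positivity⟩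
    · have e : pot T g u x - pot T g u y =
        -u * (g x - g y) - (Real.log |deriv T x| - Real.log |deriv T y|) := by simp only [pot]; ring
      rw [e]
      refine (abs_sub _ _).trans ?_
      rw [abs_mul, abs_neg]
      have h1 := hlog x y
      have h2 : |u| * |g x - g y| ≤ 1 * (M * |x - y|) :=
        mul_le_mul hu1 (hgL x y) (abs_nonneg _) (by norm_num)
      linarith
    · simp only [pot, hgp, E.deriv_per]
  have : Nonempty (Icc p (p+1)) := ⟨⟨p, by simp⟩⟩
  have : Nonempty ↥(KI d) := by
    have := E.D_ne'
    by_cases h : 0 < d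
    · exact ⟨⟨0, by rw [mem_KI]; omega⟩⟩
    · exact ⟨⟨d, by rw [mem_KI]; omega⟩⟩
  have hdist : ∀ x y : Icc p (p+1), dist x y ≤ 1 := fun x y => by
    rw [Subtype.dist_eq, Real.dist_eq, abs_le]
    constructor <;> linarith [x.2.1, x.2.2, y.2.1, y.2.2]
  obtain ⟨lam, hlam0, hrho, hLn⟩ := A.S.exists_lam hdist G
  have hInt : ∀ n, Real.exp (-a) * lam ^ n ≤ ∫ x in (0:ℝ)..1, Real.exp (-u * birkhoff T g n x) ∧
          ∫ x in (0:ℝ)..1, Real.exp (-u * birkhoff T g n x) ≤ Real.exp a * lam ^ n := by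
    intro n
    obtain ⟨F, hFc, hF, hFi⟩ := A.int_Ln hgc n
    have hper : Function.Periodic (fun x => Real.exp (-u * birkhoff T g n x)) 1 := fun x => by
      dsimp only; rw [E.birk_per hgp]
    have e := hper.intervalIntegral_add_eq 0 p
    rw [zero_add] at e
    rw [e, ← hFi]
    have hb : ∀ x ∈ Icc p (p+1), Real.exp (-a) * lam ^ n ≤ F x ∧ F x ≤ Real.exp a * lam ^ n :=
      fun x hx => by rw [hF ⟨x, hx⟩]; exact hLn n _
    constructor
    · have := intervalIntegral.integral_mono_on (μ := volume) (by linarith : p ≤ p + 1)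
        (intervalIntegrable_const (c := Real.exp (-a) * lam ^ n)) (hFc.intervalIntegrable _ _)
        (fun x hx => (hb x hx).1)
      simpa using this
    · have := intervalIntegral.integral_mono_on (μ := volume) (by linarith : p ≤ p + 1)
        (hFc.intervalIntegrable _ _) (intervalIntegrable_const (c := Real.exp a * lam ^ n))
        (fun x hx => (hb x hx).2)
      simpa using this
  have hbk : ∀ n x, |-u * birkhoff T g n x| ≤ n * (|u| * M) := fun n x => by
    rw [abs_mul, abs_neg]
    have := mul_le_mul_of_nonneg_left (birk_abs_le (T := T) hgM n x) (abs_nonneg u)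
    linarith
  have hci : ∀ n, IntervalIntegrable (fun x => Real.exp (-u * birkhoff T g n x)) volume 0 1 := fun n =>
    (Real.continuous_exp.comp (continuous_const.mul (E.birk_cont hgc n))).intervalIntegrable _ _
  have hexpa : Real.exp a * Real.exp (-a) = 1 := by rw [← Real.exp_add]; simp
  have hlam_up : lam ≤ Real.exp (|u| * M) := by
    refine le_of_pow_le (C := Real.exp a) (Real.exp_pos _) fun n => ?_
    have h1 := intervalIntegral.integral_mono_on (μ := volume) (zero_le_one : (0:ℝ) ≤ 1)
        (hci n) (intervalIntegrable_const (c := Real.exp (n * (|u| * M))))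
        (fun x _ => Real.exp_le_exp.2 ((le_abs_self _).trans (hbk n x)))
    have h2 := (hInt n).1.trans h1
    simp only [intervalIntegral.integral_const, sub_zero, one_smul] at h2
    rw [Real.exp_nat_mul] at h2
    have := mul_le_mul_of_nonneg_left h2 (Real.exp_pos a).le
    rwa [← mul_assoc, hexpa, one_mul] at this
  have hlam_lo : Real.exp (-(|u| * M)) ≤ lam := by
    refine le_of_pow_le (C := Real.exp a) hlam0 fun n => ?_
    have h1 := intervalIntegral.integral_mono_on (μ := volume) (zero_le_one : (0:ℝ) ≤ 1)
        (intervalIntegrable_const (c := Real.exp (n * (-(|u| * M))))) (hci n)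
        (fun x _ => Real.exp_le_exp.2 (by
          have := (neg_abs_le (-u * birkhoff T g n x))
          have := hbk n x
          linarith))
    have h2 := h1.trans (hInt n).2
    simp only [intervalIntegral.integral_const, sub_zero, one_smul] at h2
    rwa [Real.exp_nat_mul] at h2
  have hfin : ∀ n, n ≠ 0 → (periodicPtsIn T n).Finite := fun n hn =>
    (A.sum_fix n hn (fun _ => 0) (fun _ => rfl)).1
  refine ⟨hfin, lam, hlam0, fun n hn => ?_, hlam_up, hlam_lo, hInt⟩
  obtain ⟨-, xf, hxf, hdiff⟩ := A.sum_fix n hn (fun x => Real.exp (birkhoff T (pot T g u) n x))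
    (fun x => by rw [E.birk_per A.hφp])
  have hcv := A.c_v n hn (hfin n hn)
  set v := ∑ᶠ x ∈ periodicPtsIn T n, Real.exp (birkhoff T (pot T g u) n x) with hv
  set b := sumW n (fun w => Real.exp (birkhoff T (pot T g u) n (xf w))) with hb
  have hnn : n / 2 + (n - n / 2) = n := by omega
  have hbeq : sumW (n / 2 + (n - n / 2)) (fun w => A.S.wG w (xf w)) = b := by
    rw [hnn]
    refine sumW_congr _ _ _ fun w hw => ?_
    rw [A.wG_eq, hxf w hw, hw]
  obtain ⟨t1, t2⟩ := A.S.trace hdist G hrho (n / 2) (n - n / 2) xf (fun w hw => hxf w (by omega))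
  rw [hbeq] at t1 t2
  rw [hnn] at t1 t2
  have hbl := trace_err ha hq0 hθ0 hω0 hω1 hqω hθω n (pow_pos hlam0 n) t1 t2
  rw [← hC1] at hbl
  have hlΛ : lam ≤ Λ := hlam_up.trans (Real.exp_le_exp.2 (by gcongr))
  have hln : lam ^ n ≤ Λ ^ n := by gcongr
  have hVp : |Real.exp (birkhoff T (pot T g u) n p)| ≤ Λ ^ n * q ^ n := by
    rw [abs_of_pos (Real.exp_pos _), E.exp_birk, hq, inv_pow, ← div_eq_mul_inv]
    refine div_le_div₀ (by positivity) ?_ (by positivity) ((E.iterate n).hd p)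
    rw [hΛ, ← Real.exp_nat_mul, Real.exp_le_exp]
    refine (le_abs_self _).trans ((hbk n p).trans ?_)
    gcongr
  have hωn0 : 0 < ω ^ n := by positivity
  have hωn1 : ω ^ n ≤ 1 := pow_le_one₀ hω0.le hω1.le
  have hqn : q ^ n ≤ ω ^ n := by gcongr
  have hΛn : 0 < Λ ^ n := by positivity
  have hb2 : |b - lam ^ n| ≤ C1 * (ω ^ n * Λ ^ n) := hbl.trans (by rw [mul_assoc]; gcongr)
  have hp2 : |v - b| ≤ ω ^ n * Λ ^ n := hdiff.trans (hVp.trans (by rw [mul_comm]; gcongr))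
  have hprod : ω ^ n * Λ ^ n ≤ Λ ^ n := mul_le_of_le_one_left hΛn.le hωn1
  have hvle : v ≤ (2 + C1) * Λ ^ n := by
    have h1 := (abs_le.1 hp2).2
    have h2 := (abs_le.1 hb2).2
    have h3 := mul_le_mul_of_nonneg_left hprod hC1'
    linarith
  have hc2 : |cR T g u n - v| ≤ C2 * (2 + C1) * (ω ^ n * Λ ^ n) := by
    refine hcv.trans ?_
    calc C2 * q ^ n * v ≤ C2 * ω ^ n * ((2 + C1) * Λ ^ n) := by
          have hv0 : 0 ≤ v := by
            rw [hv]; exact finsum_nonneg fun x => finsum_nonneg fun _ => (Real.exp_pos _).le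
          gcongr
      _ = _ := by ring
  have hfinal : |cR T g u n - lam ^ n| ≤ (C1 + 1 + C2 * (2 + C1)) * (ω ^ n * Λ ^ n) := by
    have e : cR T g u n - lam ^ n = (cR T g u n - v) + (v - b) + (b - lam ^ n) := by ring
    rw [e]
    refine (abs_add_three _ _ _).trans ?_
    linarith
  refine hfinal.trans ?_
  rw [← mul_pow]
  gcongr

end PV


namespace PV

lemma exists_trunc {Ω : Type*} [MeasurableSpace Ω] (μ ν : Measure Ω) [IsProbabilityMeasure μ]
    [IsFiniteMeasure ν] (hμν : μ ≪ ν) {δ : ℝ} (hδ : 0 < δ) :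
    ∃ (A : Set Ω) (m : ℕ), MeasurableSet A ∧ μ.restrict A ≤ (m : ℝ≥0∞) • ν ∧ μ.real Aᶜ < δ := by
  set f := μ.rnDeriv ν with hf
  have hfm : Measurable f := Measure.measurable_rnDeriv μ ν
  have hwd : ν.withDensity f = μ := Measure.withDensity_rnDeriv_eq μ ν hμν
  set A : ℕ → Set Ω := fun m => {x | f x ≤ m} with hA
  have hAm : ∀ m, MeasurableSet (A m) := fun m => measurableSet_le hfm measurable_const
  have hanti : Antitone fun m => (A m)ᶜ := by
    intro m m' hmm x hx hx'
    exact hx (le_trans (show f x ≤ m from hx') (by exact_mod_cast hmm))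
  have hlim := tendsto_measure_iInter_atTop (μ := μ) (s := fun m => (A m)ᶜ)
    (fun m => (hAm m).compl.nullMeasurableSet) hanti ⟨0, measure_ne_top _ _⟩
  have hzero : μ (⋂ m, (A m)ᶜ) = 0 := by
    have hfin : ∀ᵐ x ∂μ, f x < ∞ := hμν.ae_le (Measure.rnDeriv_lt_top μ ν)
    refine measure_mono_null (fun x hx => ?_) hfin
    intro hlt
    obtain ⟨m, hm⟩ := ENNReal.exists_nat_gt (ne_of_lt hlt)
    exact (mem_iInter.1 hx m) hm.le
  rw [hzero] at hlim
  have hev := hlim.eventually (gt_mem_nhds (ENNReal.ofReal_pos.2 hδ))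
  obtain ⟨m, hm⟩ := hev.exists
  refine ⟨A m, m, hAm m, ?_, ?_⟩
  · rw [Measure.le_iff]
    intro s hs
    rw [Measure.restrict_apply hs, ← hwd, withDensity_apply _ (hs.inter (hAm m))]
    calc ∫⁻ a in s ∩ A m, f a ∂ν ≤ ∫⁻ a in s ∩ A m, m ∂ν :=
          setLIntegral_mono measurable_const fun x hx => hx.2
      _ = m * ν (s ∩ A m) := by simp
      _ ≤ m * ν s := by gcongr; exact inter_subset_left
      _ = _ := by simp
  · exact (ENNReal.ofReal_lt_ofReal_iff hδ).1 (by
      rw [Measure.real, ENNReal.ofReal_toReal (measure_ne_top _ _)]; exact hm)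

lemma lower_abs {Ω : Type*} [MeasurableSpace Ω] (μ ν : Measure Ω) [IsProbabilityMeasure μ]
    [IsFiniteMeasure ν] (hμν : μ ≪ ν) (h : ℕ → Ω → ℝ) (hm : ∀ n, Measurable (h n)) {B c D lam : ℝ}
    (hB : ∀ n x, |h n x| ≤ n * B) (hc : ∀ n, ∫ x, h n x ∂μ = n * c) (hlam : 0 < lam)
    (hD : ∀ n, ∫ x, Real.exp (h n x) ∂ν ≤ D * lam ^ n) : Real.exp c ≤ lam := by
  have hInt : ∀ (n) (ρ : Measure Ω) [IsFiniteMeasure ρ], Integrable (h n) ρ := fun n ρ _ =>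
    Integrable.of_bound (hm n).aestronglyMeasurable (n * B) (ae_of_all _ (hB n))
  have hinte : ∀ (n) (ρ : Measure Ω) [IsFiniteMeasure ρ], Integrable (fun x => Real.exp (h n x)) ρ :=
    fun n ρ _ => Integrable.of_bound (Real.measurable_exp.comp (hm n)).aestronglyMeasurable
      (Real.exp (n * B)) (ae_of_all _ fun x => by
        rw [Real.norm_eq_abs, abs_of_pos (Real.exp_pos _), Real.exp_le_exp]
        exact (le_abs_self _).trans (hB n x))
  have hB0 : 0 ≤ B := by
    have hne : Nonempty Ω := by
      by_contra hcon
      rw [not_nonempty_iff] at hcon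
      have := measure_univ (μ := μ)
      rw [Set.univ_eq_empty_iff.2 hcon] at this
      simp at this
    obtain ⟨x⟩ := hne
    have h1 := hB 1 x
    simp only [Nat.cast_one, one_mul] at h1
    exact (abs_nonneg _).trans h1
  have key : ∀ ε : ℝ, 0 < ε → Real.exp (c - ε) ≤ lam := by
    intro ε hε
    obtain ⟨A, m, hA, hres, hδ⟩ := exists_trunc μ ν hμν
      (δ := min (1/2) (ε / (2 * (B + |c| + 1)))) (by positivity)
    have hδ1 : μ.real Aᶜ < 1/2 := hδ.trans_le (min_le_left _ _)
    have hδ2 : μ.real Aᶜ * (2 * (B + |c| + 1)) < ε := by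
      rw [← lt_div_iff₀ (by positivity)]; exact hδ.trans_le (min_le_right _ _)
    have hAA : μ.real A = 1 - μ.real Aᶜ := by rw [probReal_compl_eq_one_sub hA]; ring
    refine le_of_pow_le (C := 2 * m * D) hlam fun n => ?_
    rw [← Real.exp_nat_mul]
    set w : ℝ := n * (c - ε) with hw
    have h1 : Real.exp w * μ.real A ≤ ∫ x in A, Real.exp (h n x) ∂μ := by
      have hpt : ∀ x, Real.exp w * (1 + (h n x - w)) ≤ Real.exp (h n x) := fun x => by
        have := Real.add_one_le_exp (h n x - w)
        have h2 := mul_le_mul_of_nonneg_left this (Real.exp_pos w).le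
        rw [← Real.exp_add, add_sub_cancel] at h2
        linarith
      have hi : Integrable (fun x => Real.exp w * (1 + (h n x - w))) (μ.restrict A) :=
        ((integrable_const _).add ((hInt n _).sub (integrable_const _))).const_mul _
      have h3 := integral_mono hi (hinte n (μ.restrict A)) hpt
      refine le_trans ?_ h3
      rw [integral_const_mul]
      refine mul_le_mul_of_nonneg_left ?_ (Real.exp_pos _).le
      have hs : Integrable (fun a => h n a - w) (μ.restrict A) := (hInt n _).sub (integrable_const _)
      rw [integral_add (integrable_const _) hs,
        integral_sub (hInt n _) (integrable_const _)]
      simp only [integral_const, smul_eq_mul, mul_one, measureReal_restrict_apply_univ]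
      have h4 : ∫ x in A, h n x ∂μ = n * c - ∫ x in Aᶜ, h n x ∂μ := by
        rw [← hc n, ← integral_add_compl hA (hInt n μ)]; ring
      have h5 : ∫ x in Aᶜ, h n x ∂μ ≤ n * B * μ.real Aᶜ := by
        have := integral_mono (hInt n (μ.restrict Aᶜ)) (integrable_const (n * B))
          (fun x => (le_abs_self _).trans (hB n x))
        simp only [integral_const, smul_eq_mul, measureReal_restrict_apply_univ] at this
        linarith
      rw [h4]
      have hn : (0:ℝ) ≤ n := n.cast_nonneg
      have h6 : 0 ≤ n * ((c - B * μ.real Aᶜ) - μ.real A * (c - ε)) := by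
        apply mul_nonneg hn
        rw [hAA]
        have h7 := neg_abs_le c
        have h8 : 0 ≤ μ.real Aᶜ := measureReal_nonneg
        nlinarith
      rw [hw]
      nlinarith
    have h2 : ∫ x in A, Real.exp (h n x) ∂μ ≤ m * ∫ x, Real.exp (h n x) ∂ν := by
      have hfm : IsFiniteMeasure ((m : ℝ≥0∞) • ν) := by
        have : (m : ℝ≥0∞) • ν = (m : ℝ≥0) • ν := by
          ext s hs; simp [ENNReal.smul_def]
        rw [this]; infer_instance
      have := integral_mono_measure hres (ae_of_all _ fun x => (Real.exp_pos (h n x)).le)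
        (hinte n ((m : ℝ≥0∞) • ν))
      rw [integral_smul_measure] at this
      simpa using this
    have h3 := h2.trans (mul_le_mul_of_nonneg_left (hD n) m.cast_nonneg)
    have h4 : Real.exp w ≤ 2 * (Real.exp w * μ.real A) := by
      have : 1 / 2 ≤ μ.real A := by rw [hAA]; linarith
      nlinarith [Real.exp_pos w]
    linarith
  have hcont : Tendsto (fun ε : ℝ => Real.exp (c - ε)) (𝓝[>] 0) (𝓝 (Real.exp (c - 0))) :=
    (Continuous.tendsto (by fun_prop) 0).mono_left nhdsWithin_le_nhds
  rw [sub_zero] at hcont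
  exact le_of_tendsto hcont (eventually_mem_nhdsWithin.mono fun ε hε => key ε hε)

lemma meas_liftRep : Measurable liftRep :=
  measurable_subtype_coe.comp (AddCircle.measurableEquivIco (1:ℝ) 0).measurable

lemma coe_liftRep (y : 𝕊) : ((liftRep y : ℝ) : 𝕊) = y := AddCircle.coe_equivIco

lemma liftRep_coe (x : ℝ) : ∃ k : ℤ, liftRep (x : 𝕊) = x + k := by
  have h := coe_liftRep (x : 𝕊)
  have h2 : ((liftRep (x:𝕊) - x : ℝ) : 𝕊) = 0 := by rw [AddCircle.coe_sub, h, sub_self]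
  rw [AddCircle.coe_eq_zero_iff] at h2
  obtain ⟨k, hk⟩ := h2
  refine ⟨k, ?_⟩
  simp at hk
  linarith

lemma circleFun_coe {H : ℝ → ℝ} (hH : ∀ x, H (x + 1) = H x) (x : ℝ) : circleFun H (x : 𝕊) = H x := by
  obtain ⟨k, hk⟩ := liftRep_coe x
  rw [circleFun, hk, per_int hH]

lemma circleFun_map {T H : ℝ → ℝ} (hH : ∀ x, H (x + 1) = H x) (y : 𝕊) :
    circleFun H (circleMapC T y) = circleFun (H ∘ T) y := by
  rw [circleMapC, circleFun_coe hH]; rfl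

theorem lam_lower {T g : ℝ → ℝ} {d : ℤ} {κ : ℝ} (E : EM T d κ) (hg : Continuous g)
    (hgp : ∀ x, g (x + 1) = g x) {M : ℝ} (hgM : ∀ x, |g x| ≤ M) (μ : Measure 𝕊)
    [IsProbabilityMeasure μ] (hμ : Measure.map (circleMapC T) μ = μ)
    (hac : μ ≪ (volume : Measure 𝕊)) {u lam D : ℝ} (hlam : 0 < lam)
    (hD : ∀ n, ∫ x in (0:ℝ)..1, Real.exp (-u * birkhoff T g n x) ≤ D * lam ^ n) :
    Real.exp (-u * ∫ y, circleFun g y ∂μ) ≤ lam := by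
  have hTm : Measurable (circleMapC T) :=
    AddCircle.measurable_mk'.comp (E.diff.continuous.measurable.comp meas_liftRep)
  have hmp : MeasurePreserving (circleMapC T) μ μ := ⟨hTm, hμ⟩
  have hcm : ∀ {H : ℝ → ℝ}, Continuous H → Measurable (circleFun H) := fun hH =>
    hH.measurable.comp meas_liftRep
  have hbp : ∀ i x, (g ∘ T^[i]) (x + 1) = (g ∘ T^[i]) x := fun i x => by
    simp only [Function.comp]; rw [(E.iterate i).lift, per_int hgp]
  have hinv : ∀ i, ∫ y, circleFun (g ∘ T^[i]) y ∂μ = ∫ y, circleFun g y ∂μ := by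
    intro i
    induction i with
    | zero => rfl
    | succ i ih =>
      rw [← ih]
      have : circleFun (g ∘ T^[i+1]) = fun y => circleFun (g ∘ T^[i]) (circleMapC T y) := by
        funext y; rw [circleFun_map (hbp i)]; rfl
      rw [this]
      have hm : AEStronglyMeasurable (circleFun (g ∘ T^[i])) (Measure.map (circleMapC T) μ) :=
        (hcm (hg.comp (E.iterate i).diff.continuous)).aestronglyMeasurable
      rw [← integral_map hTm.aemeasurable hm, hμ]
  refine lower_abs μ volume hac (fun n y => -u * circleFun (birkhoff T g n) y)
    (fun n => (hcm (E.birk_cont hg n)).const_mul _) (B := |u| * M) (D := D) ?_ ?_ hlam ?_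
  · intro n y
    rw [abs_mul, abs_neg]
    have := mul_le_mul_of_nonneg_left (birk_abs_le (T := T) hgM n (liftRep y)) (abs_nonneg u)
    rw [circleFun]; linarith
  · intro n
    rw [integral_const_mul]
    have e : ∀ y, circleFun (birkhoff T g n) y = ∑ i ∈ Finset.range n, circleFun (g ∘ T^[i]) y :=
      fun y => rfl
    simp only [e]
    rw [integral_finsetSum]
    · simp only [hinv]; simp; ring
    · intro i _
      exact Integrable.of_bound (hcm (hg.comp (E.iterate i).diff.continuous)).aestronglyMeasurable M
        (ae_of_all _ fun y => hgM _)
  · intro n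
    refine le_trans (le_of_eq ?_) (hD n)
    rw [← UnitAddCircle.intervalIntegral_preimage 0]
    rw [zero_add]
    refine intervalIntegral.integral_congr fun x _ => ?_
    rw [circleFun_coe (E.birk_per hgp n)]

end PV


namespace PV

/-- bounded continuous functions -/
abbrev BC := BoundedContinuousFunction ℝ ℝ

/-- integration from `0` to `x` -/
def IG (x : ℝ) : BC →L[ℝ] ℝ :=
  LinearMap.mkContinuous
    { toFun := fun f => ∫ t in (0:ℝ)..x, f t
      map_add' := fun f g => by
        simp only [BoundedContinuousFunction.coe_add, Pi.add_apply]
        exact intervalIntegral.integral_add (f.continuous.intervalIntegrable _ _)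
          (g.continuous.intervalIntegrable _ _)
      map_smul' := fun c f => by
        simp }
    |x| (fun f => by
      have := intervalIntegral.norm_integral_le_of_norm_le_const (a := (0:ℝ)) (b := x) (f := f)
        (C := ‖f‖) (fun t _ => f.norm_coe_le_norm t)
      simpa [mul_comm] using this)

lemma IG_apply (x : ℝ) (f : BC) : IG x f = ∫ t in (0:ℝ)..x, f t := rfl

/-- evaluation -/
def EV (x : ℝ) : BC →L[ℝ] ℝ := BoundedContinuousFunction.evalCLM ℝ x

lemma EV_apply (x : ℝ) (f : BC) : EV x f = f x := rfl

lemma IG_hasDeriv (f : BC) (x : ℝ) : HasDerivAt (fun x => IG x f) (f x) x := by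
  simp only [IG_apply]
  exact intervalIntegral.integral_hasDerivAt_right (f.continuous.intervalIntegrable _ _)
    (f.continuous.stronglyMeasurableAtFilter _ _) f.continuous.continuousAt

/-- families -/
structure Fam (n r : ℕ) (a : ℝ → ℝ) (h : ℕ → ℝ → BC) : Prop where
  ha : ContDiff ℝ n a
  hh : ∀ j, j < r → ContDiff ℝ n (h j)
  rel : ∀ j, j + 1 < r → ∀ s x, h j s x = h j s 0 + IG x (h (j+1) s)

lemma Fam.deriv_s {n r : ℕ} {a : ℝ → ℝ} {h : ℕ → ℝ → BC} (H : Fam (n+1) r a h) :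
    Fam n r (deriv a) (fun j => deriv (h j)) := by
  refine ⟨?_, ?_, ?_⟩
  · have := H.ha
    push_cast at this
    exact (contDiff_succ_iff_deriv.1 this).2.2
  · intro j hj
    have := H.hh j hj
    push_cast at this
    exact (contDiff_succ_iff_deriv.1 this).2.2
  · intro j hj s x
    have h1 : HasDerivAt (h j) (deriv (h j) s) s :=
      ((H.hh j (by omega)).differentiable (by simp) s).hasDerivAt
    have h2 : HasDerivAt (h (j+1)) (deriv (h (j+1)) s) s :=
      ((H.hh (j+1) hj).differentiable (by simp) s).hasDerivAt
    have e1 := (EV x).hasFDerivAt.comp_hasDerivAt s h1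
    have e2 := ((EV 0).hasFDerivAt.comp_hasDerivAt s h1).add ((IG x).hasFDerivAt.comp_hasDerivAt s h2)
    have e : (EV x ∘ h j) = (EV 0 ∘ h j) + (IG x ∘ h (j+1)) := by
      funext s; exact H.rel j hj s x
    rw [← e] at e2
    exact e1.unique e2

lemma Fam.deriv_x {n r : ℕ} {a : ℝ → ℝ} {h : ℕ → ℝ → BC} (H : Fam n (r+1) a h) :
    Fam n r (fun s => h 0 s 0) (fun j => h (j+1)) :=
  ⟨(EV 0).contDiff.comp (H.hh 0 (by omega)), fun j hj => H.hh (j+1) (by omega),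
    fun j hj s x => H.rel (j+1) (by omega) s x⟩

lemma Fam.cont {r : ℕ} {a : ℝ → ℝ} {h : ℕ → ℝ → BC} (H : Fam 0 r a h) (hr : 0 < r) :
    Continuous fun p : ℝ × ℝ => a p.1 + IG p.2 (h 0 p.1) := by
  refine (H.ha.continuous.comp continuous_fst).add ?_
  have hc := (H.hh 0 hr).continuous
  rw [continuous_iff_continuousAt]
  rintro ⟨s, x⟩
  have h1 : Tendsto (fun p : ℝ × ℝ => IG p.2 (h 0 p.1 - h 0 s)) (𝓝 (s, x)) (𝓝 0) := by
    have hb : ∀ p : ℝ × ℝ, ‖IG p.2 (h 0 p.1 - h 0 s)‖ ≤ |p.2| * ‖h 0 p.1 - h 0 s‖ := fun p => by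
      refine ((IG p.2).le_opNorm _).trans (mul_le_mul_of_nonneg_right ?_ (norm_nonneg _))
      exact LinearMap.mkContinuous_norm_le _ (abs_nonneg _) _
    refine squeeze_zero_norm hb ?_
    have : Continuous fun p : ℝ × ℝ => |p.2| * ‖h 0 p.1 - h 0 s‖ := by fun_prop
    have := this.tendsto (s, x)
    simpa using this
  have h2 : Tendsto (fun p : ℝ × ℝ => IG p.2 (h 0 s)) (𝓝 (s, x)) (𝓝 (IG x (h 0 s))) := by
    have : Continuous fun y => IG y (h 0 s) :=
      continuous_iff_continuousAt.2 fun y => (IG_hasDeriv _ y).continuousAt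
    exact (this.comp continuous_snd).tendsto (s, x)
  have h3 := h1.add h2
  rw [zero_add] at h3
  refine h3.congr fun p => ?_
  rw [map_sub, sub_add_cancel]

/-- Joint regularity. -/
theorem Fam.contDiff {n r : ℕ} {a : ℝ → ℝ} {h : ℕ → ℝ → BC} (H : Fam n r a h) (hr : n < r) :
    ContDiff ℝ n fun p : ℝ × ℝ => a p.1 + IG p.2 (h 0 p.1) := by
  induction n generalizing r a h with
  | zero =>
    simp only [Nat.cast_zero]
    rw [contDiff_zero]
    exact H.cont hr
  | succ n ih =>
    obtain ⟨r, rfl⟩ : ∃ r', r = r' + 1 := ⟨r - 1, by omega⟩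
    have hs := ih H.deriv_s (by omega)
    have H' : Fam n (r+1) a h := ⟨H.ha.of_le (by exact_mod_cast Nat.le_succ n),
      fun j hj => (H.hh j hj).of_le (by exact_mod_cast Nat.le_succ n), H.rel⟩
    have hx := ih H'.deriv_x (by omega)
    have hx' : (fun p : ℝ × ℝ => h 0 p.1 0 + IG p.2 (h 1 p.1)) = fun p : ℝ × ℝ => h 0 p.1 p.2 := by
      funext p; exact (H.rel 0 (by omega) p.1 p.2).symm
    simp only [zero_add] at hx
    rw [hx'] at hx
    push_cast
    rw [contDiff_succ_iff_hasFDerivAt]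
    refine ⟨fun p => (deriv a p.1 + IG p.2 (deriv (h 0) p.1)) • ContinuousLinearMap.fst ℝ ℝ ℝ +
      (h 0 p.1 p.2) • ContinuousLinearMap.snd ℝ ℝ ℝ, ?_, ?_⟩
    · exact (hs.smul contDiff_const).add (hx.smul contDiff_const)
    · rintro ⟨s, x⟩
      have key := hasStrictFDerivAt_uncurry_coprod (𝕜 := ℝ) (u := (s, x))
        (f := fun s x => a s + IG x (h 0 s))
        (f₁ := fun s x => ContinuousLinearMap.toSpanSingleton ℝ (deriv a s + IG x (deriv (h 0) s)))
        (f₂ := fun s x => ContinuousLinearMap.toSpanSingleton ℝ (h 0 s x)) ?_ ?_ ?_ ?_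
      · have := key.hasFDerivAt
        refine HasFDerivAt.congr_fderiv this ?_
        ext <;> simp [Function.HasUncurry.uncurry]
      · refine Eventually.of_forall fun p => ?_
        have h1 : HasDerivAt (h 0) (deriv (h 0) p.1) p.1 :=
          ((H.hh 0 (by omega)).differentiable (by simp) _).hasDerivAt
        have h2 : HasDerivAt a (deriv a p.1) p.1 := (H.ha.differentiable (by simp) _).hasDerivAt
        exact (h2.add ((IG p.2).hasFDerivAt.comp_hasDerivAt p.1 h1)).hasFDerivAt
      · refine Eventually.of_forall fun p => ?_
        exact ((IG_hasDeriv (h 0 p.1) p.2).const_add (a p.1)).hasFDerivAt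
      · have := (hs.continuous).continuousAt (x := (s, x))
        exact (ContinuousLinearMap.toSpanSingletonCLE (𝕜 := ℝ) (E := ℝ)).continuous.continuousAt.comp this
      · have := (hx.continuous).continuousAt (x := (s, x))
        exact (ContinuousLinearMap.toSpanSingletonCLE (𝕜 := ℝ) (E := ℝ)).continuous.continuousAt.comp this

end PV


namespace PV

/-- parameter space -/
abbrev V := ℝ × ℝ

/-- the linear form with given partials -/
def LF (a b : ℝ) : V →L[ℝ] ℝ :=
  a • ContinuousLinearMap.fst ℝ ℝ ℝ + b • ContinuousLinearMap.snd ℝ ℝ ℝ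

lemma LF_apply (a b : ℝ) (v : V) : LF a b v = a * v.1 + b * v.2 := by simp [LF]

lemma LF_eq (L : V →L[ℝ] ℝ) : L = LF (L (1,0)) (L (0,1)) := by
  ext <;> simp [LF]

/-- weighted bounds -/
def WB0 {ι : Type*} (w f : ι → V → ℝ) : Prop :=
  (∀ i, Continuous (f i)) ∧ ∃ C, 0 ≤ C ∧ ∀ i v, |f i v| ≤ C * w i v

/-- weighted bounds for derivatives -/
def WB {ι : Type*} (w : ι → V → ℝ) : ℕ → (ι → V → ℝ) → Prop
  | 0, f => WB0 w f
  | n+1, f => WB0 w f ∧ ∃ f1 f2, WB w n f1 ∧ WB w n f2 ∧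
      ∀ i v, HasFDerivAt (f i) (LF (f1 i v) (f2 i v)) v

/-- inner functions -/
def DN {ι : Type*} : ℕ → (ι → V → ℝ) → Prop
  | 0, y => ∀ i, Continuous (y i)
  | n+1, y => ∃ y1 y2, WB (fun _ _ => 1) n y1 ∧ WB (fun _ _ => 1) n y2 ∧
      ∀ i v, HasFDerivAt (y i) (LF (y1 i v) (y2 i v)) v

section
variable {ι : Type*} {w w' f h : ι → V → ℝ} {n : ℕ}

lemma WB.zero (H : WB w n f) : WB0 w f := by
  cases n with
  | zero => exact H
  | succ n => exact H.1

lemma WB.pred (H : WB w (n+1) f) : WB w n f := by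
  induction n generalizing f with
  | zero => exact H.1
  | succ n ih =>
    obtain ⟨h0, f1, f2, h1, h2, hd⟩ := H
    exact ⟨h0, f1, f2, ih h1, ih h2, hd⟩

lemma WB.le {m : ℕ} (H : WB w n f) (hm : m ≤ n) : WB w m f := by
  induction hm with
  | refl => exact H
  | step _ ih => exact ih H.pred

lemma WB.dn (H : WB (fun _ _ => 1) n f) : DN n f := by
  cases n with
  | zero => exact H.1
  | succ n => exact H.2

lemma DN.pred (H : DN (n+1) f) : DN n f := by
  obtain ⟨y1, y2, h1, h2, hd⟩ := H
  cases n with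
  | zero => exact fun i => continuous_iff_continuousAt.2 fun v => (hd i v).continuousAt
  | succ n => exact ⟨y1, y2, h1.pred, h2.pred, hd⟩

lemma DN.le {m : ℕ} (H : DN n f) (hm : m ≤ n) : DN m f := by
  induction hm with
  | refl => exact H
  | step _ ih => exact ih H.pred

lemma WB0.mono {K : ℝ} (hw : ∀ i v, w i v ≤ K * w' i v) (hK : 0 ≤ K) (H : WB0 w f) : WB0 w' f := by
  obtain ⟨hc, C, hC, hb⟩ := H
  refine ⟨hc, C * K, mul_nonneg hC hK, fun i v => (hb i v).trans ?_⟩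
  rw [mul_assoc]
  exact mul_le_mul_of_nonneg_left (hw i v) hC

lemma WB.mono {K : ℝ} (hw : ∀ i v, w i v ≤ K * w' i v) (hK : 0 ≤ K) (H : WB w n f) :
    WB w' n f := by
  induction n generalizing f with
  | zero => exact WB0.mono hw hK H
  | succ n ih =>
    obtain ⟨h0, f1, f2, h1, h2, hd⟩ := H
    exact ⟨h0.mono hw hK, f1, f2, ih h1, ih h2, hd⟩

lemma WB0.add (H : WB0 w f) (H' : WB0 w h) : WB0 w (fun i v => f i v + h i v) := by
  obtain ⟨hc, C, hC, hb⟩ := H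
  obtain ⟨hc', C', hC', hb'⟩ := H'
  refine ⟨fun i => (hc i).add (hc' i), C + C', add_nonneg hC hC', fun i v => ?_⟩
  have := abs_add_le (f i v) (h i v)
  have := hb i v
  have := hb' i v
  rw [add_mul]; linarith

lemma LF_add (a b c d : ℝ) : LF a b + LF c d = LF (a+c) (b+d) := by ext <;> simp [LF]

lemma WB.add (H : WB w n f) (H' : WB w n h) : WB w n (fun i v => f i v + h i v) := by
  induction n generalizing f h with
  | zero => exact WB0.add H H'
  | succ n ih =>
    obtain ⟨h0, f1, f2, h1, h2, hd⟩ := H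
    obtain ⟨h0', f1', f2', h1', h2', hd'⟩ := H'
    refine ⟨h0.add h0', _, _, ih h1 h1', ih h2 h2', fun i v => ?_⟩
    rw [← LF_add]
    exact (hd i v).add (hd' i v)

lemma WB0.mul (H : WB0 w f) (H' : WB0 w' h) :
    WB0 (fun i v => w i v * w' i v) (fun i v => f i v * h i v) := by
  obtain ⟨hc, C, hC, hb⟩ := H
  obtain ⟨hc', C', hC', hb'⟩ := H'
  refine ⟨fun i => (hc i).mul (hc' i), C * C', mul_nonneg hC hC', fun i v => ?_⟩
  rw [abs_mul]
  calc _ ≤ (C * w i v) * (C' * w' i v) :=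
        mul_le_mul (hb i v) (hb' i v) (abs_nonneg _) ((abs_nonneg _).trans (hb i v))
    _ = _ := by ring

lemma WB.mul (H : WB w n f) (H' : WB w' n h) :
    WB (fun i v => w i v * w' i v) n (fun i v => f i v * h i v) := by
  induction n generalizing f h with
  | zero => exact WB0.mul H H'
  | succ n ih =>
    have Hp := H.pred
    have Hp' := H'.pred
    obtain ⟨h0, f1, f2, h1, h2, hd⟩ := H
    obtain ⟨h0', f1', f2', h1', h2', hd'⟩ := H'
    refine ⟨h0.mul h0', _, _, (ih Hp h1').add (ih h1 Hp'), (ih Hp h2').add (ih h2 Hp'),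
      fun i v => ?_⟩
    refine ((hd i v).mul (hd' i v)).congr_fderiv ?_
    ext <;> simp [LF] <;> ring

/-- multiplication by constants -/
lemma WB.cmul (c : ι → ℝ) (H : WB w n f) :
    WB (fun i v => |c i| * w i v) n (fun i v => c i * f i v) := by
  induction n generalizing f with
  | zero =>
    obtain ⟨hc, C, hC, hb⟩ := H
    refine ⟨fun i => continuous_const.mul (hc i), C, hC, fun i v => ?_⟩
    rw [abs_mul]
    calc _ ≤ |c i| * (C * w i v) := mul_le_mul_of_nonneg_left (hb i v) (abs_nonneg _)
      _ = _ := by ring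
  | succ n ih =>
    have h00 := ih H.pred
    obtain ⟨h0, f1, f2, h1, h2, hd⟩ := H
    refine ⟨h00.zero, _, _, ih h1, ih h2, fun i v => ?_⟩
    refine ((hd i v).const_mul (c i)).congr_fderiv ?_
    ext <;> simp [LF]

lemma WB.const (c : ι → ℝ) : WB (fun i _ => |c i|) n (fun i _ => c i) := by
  have hz : ∀ m, WB (fun i _ => |c i|) m (fun (_ : ι) (_ : V) => (0:ℝ)) := by
    intro m
    induction m with
    | zero => exact ⟨fun i => continuous_const, 0, le_rfl, fun i v => by simp⟩
    | succ m ih =>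
      refine ⟨ih.zero, _, _, ih, ih, fun i v => ?_⟩
      have : LF 0 0 = 0 := by ext <;> simp [LF]
      rw [this]; exact hasFDerivAt_const _ _
  have h0 : WB0 (fun i _ => |c i|) (fun i (_:V) => c i) :=
    ⟨fun i => continuous_const, 1, zero_le_one, fun i v => by simp⟩
  cases n with
  | zero => exact h0
  | succ n =>
    refine ⟨h0, _, _, hz n, hz n, fun i v => ?_⟩
    have : LF 0 0 = 0 := by ext <;> simp [LF]
    rw [this]; exact hasFDerivAt_const _ _

lemma WB.neg (H : WB w n f) : WB w n (fun i v => - f i v) := by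
  have := H.cmul (fun _ => -1)
  simpa using this

lemma WB.sub (H : WB w n f) (H' : WB w n h) : WB w n (fun i v => f i v - h i v) := by
  simpa [sub_eq_add_neg] using H.add H'.neg

lemma WB.congr (H : WB w n f) (hf : ∀ i v, f i v = h i v) : WB w n h := by
  have : f = h := by funext i v; exact hf i v
  exact this ▸ H

lemma WB.congrw (H : WB w n f) (hf : ∀ i v, w i v = w' i v) : WB w' n f := by
  have : w = w' := by funext i v; exact hf i v
  exact this ▸ H

lemma WB.reindex {ι' : Type*} (e : ι' → ι) (H : WB w n f) :
    WB (fun i => w (e i)) n (fun i => f (e i)) := by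
  induction n generalizing f with
  | zero =>
    obtain ⟨hc, C, hC, hb⟩ := H
    exact ⟨fun i => hc (e i), C, hC, fun i => hb (e i)⟩
  | succ n ih =>
    have h00 := ih H.pred
    obtain ⟨h0, f1, f2, h1, h2, hd⟩ := H
    exact ⟨h00.zero, _, _, ih h1, ih h2, fun i => hd (e i)⟩

lemma WB.sum {α β : Type*} {w f : α × β → V → ℝ} (S : α → Finset β) (H : WB w n f) :
    WB (fun a v => ∑ b ∈ S a, w (a, b) v) n (fun a v => ∑ b ∈ S a, f (a, b) v) := by
  induction n generalizing f with
  | zero =>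
    obtain ⟨hc, C, hC, hb⟩ := H
    refine ⟨fun a => continuous_finsetSum _ fun b _ => hc (a, b), C, hC, fun a v => ?_⟩
    rw [Finset.mul_sum]
    exact (Finset.abs_sum_le_sum_abs _ _).trans (Finset.sum_le_sum fun b _ => hb (a, b) v)
  | succ n ih =>
    have h00 := ih H.pred
    obtain ⟨h0, f1, f2, h1, h2, hd⟩ := H
    refine ⟨h00.zero, _, _, ih h1, ih h2, fun a v => ?_⟩
    refine (HasFDerivAt.fun_sum fun b (_ : b ∈ S a) => hd (a, b) v).congr_fderiv ?_
    ext <;> simp [LF]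

lemma WB.mul1 (H : WB w n f) (H' : WB (fun _ _ => 1) n h) :
    WB w n (fun i v => f i v * h i v) := (H.mul H').congrw fun i v => by simp

/-- composition -/
lemma WB.comp {G : Unit → V → ℝ} {y z : ι → V → ℝ} (HG : WB (fun _ _ => 1) n G)
    (Hy : DN n y) (Hz : DN n z) :
    WB (fun _ _ => 1) n (fun i v => G () (y i v, z i v)) := by
  induction n generalizing G y z with
  | zero =>
    obtain ⟨hc, C, hC, hb⟩ := HG
    exact ⟨fun i => (hc ()).comp ((Hy i).prodMk (Hz i)), C, hC, fun i v => hb () _⟩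
  | succ n ih =>
    have h00 := ih HG.pred Hy.pred Hz.pred
    have Hyp := Hy.pred
    have Hzp := Hz.pred
    obtain ⟨h0, g1, g2, h1, h2, hd⟩ := HG
    obtain ⟨y1, y2, hy1, hy2, hdy⟩ := Hy
    obtain ⟨z1, z2, hz1, hz2, hdz⟩ := Hz
    have k1 := ih h1 Hyp Hzp
    have k2 := ih h2 Hyp Hzp
    refine ⟨h00.zero, _, _, (k1.mul1 hy1).add (k2.mul1 hz1), (k1.mul1 hy2).add (k2.mul1 hz2),
      fun i v => ?_⟩
    have := (hd () (y i v, z i v)).comp v ((hdy i v).prodMk (hdz i v))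
    refine this.congr_fderiv ?_
    ext <;> simp [LF]

/-- smooth periodic functions are uniformly bounded with their derivatives -/
lemma WB.of_periodic {G : V → ℝ} {p q : ℝ} (hp : 0 < p) (hq : 0 < q) (hG : ContDiff ℝ n G)
    (h1 : ∀ a b, G (a + p, b) = G (a, b)) (h2 : ∀ a b, G (a, b + q) = G (a, b)) :
    WB (fun (_ : Unit) _ => 1) n (fun _ => G) := by
  have h00 : ∀ G : V → ℝ, Continuous G → (∀ a b, G (a + p, b) = G (a, b)) →
      (∀ a b, G (a, b + q) = G (a, b)) → WB0 (fun (_ : Unit) _ => 1) (fun _ => G) := by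
    intro G hG h1 h2
    obtain ⟨C, hC⟩ := (isCompact_Icc (a := (0:ℝ)) (b := p)).prod
      (isCompact_Icc (a := (0:ℝ)) (b := q)) |>.exists_bound_of_continuousOn hG.continuousOn
    refine ⟨fun _ => hG, |C|, abs_nonneg _, fun _ v => ?_⟩
    obtain ⟨a, b⟩ := v
    have e1 : Function.Periodic (fun a => G (a, b)) p := fun a => h1 a b
    obtain ⟨a', ha', ea⟩ := e1.exists_mem_Ico₀ hp a
    have e2 : Function.Periodic (fun b => G (a', b)) q := fun b => h2 a' b
    obtain ⟨b', hb', eb⟩ := e2.exists_mem_Ico₀ hq b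
    have : G (a, b) = G (a', b') := ea.trans eb
    show |G (a, b)| ≤ |C| * 1
    rw [this, mul_one]
    exact (hC (a', b') ⟨⟨ha'.1, ha'.2.le⟩, ⟨hb'.1, hb'.2.le⟩⟩).trans (le_abs_self C)
  induction n generalizing G with
  | zero => exact h00 G hG.continuous h1 h2
  | succ n ih =>
    push_cast at hG
    have hd := (contDiff_succ_iff_fderiv.1 hG)
    have t1 : ∀ v, fderiv ℝ G (v + (p, 0)) = fderiv ℝ G v := by
      intro v
      rw [← fderiv_comp_add_right]
      congr 1; funext x; obtain ⟨a, b⟩ := x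
      simpa using h1 a b
    have t2 : ∀ v, fderiv ℝ G (v + (0, q)) = fderiv ℝ G v := by
      intro v
      rw [← fderiv_comp_add_right]
      congr 1; funext x; obtain ⟨a, b⟩ := x
      simpa using h2 a b
    refine ⟨h00 G hG.continuous h1 h2, _, _,
      ih (G := fun v => fderiv ℝ G v (1, 0)) (hd.2.2.clm_apply contDiff_const) ?_ ?_,
      ih (G := fun v => fderiv ℝ G v (0, 1)) (hd.2.2.clm_apply contDiff_const) ?_ ?_,
      fun _ v => ?_⟩
    · intro a b; have := t1 (a, b); simp only [Prod.mk_add_mk, add_zero] at this; rw [this]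
    · intro a b; have := t2 (a, b); simp only [Prod.mk_add_mk, add_zero] at this; rw [this]
    · intro a b; have := t1 (a, b); simp only [Prod.mk_add_mk, add_zero] at this; rw [this]
    · intro a b; have := t2 (a, b); simp only [Prod.mk_add_mk, add_zero] at this; rw [this]
    · rw [← LF_eq]
      exact (hd.1 v).hasFDerivAt

lemma DN.snd : DN n (fun (_ : ι) (v : V) => v.2) := by
  cases n with
  | zero => exact fun _ => continuous_snd
  | succ n =>
    refine ⟨fun _ _ => 0, fun _ _ => 1, ?_, ?_, fun i v => ?_⟩
    · exact (WB.const (fun _ => (0:ℝ))).mono (K := 1) (by simp) (by simp)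
    · exact (WB.const (fun _ => (1:ℝ))).mono (K := 1) (by simp) (by simp)
    · have : LF 0 1 = ContinuousLinearMap.snd ℝ ℝ ℝ := by ext <;> simp [LF]
      rw [this]; exact hasFDerivAt_snd

lemma DN.fst : DN n (fun (_ : ι) (v : V) => v.1) := by
  cases n with
  | zero => exact fun _ => continuous_fst
  | succ n =>
    refine ⟨fun _ _ => 1, fun _ _ => 0, ?_, ?_, fun i v => ?_⟩
    · exact (WB.const (fun _ => (1:ℝ))).mono (K := 1) (by simp) (by simp)
    · exact (WB.const (fun _ => (0:ℝ))).mono (K := 1) (by simp) (by simp)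
    · have : LF 1 0 = ContinuousLinearMap.fst ℝ ℝ ℝ := by ext <;> simp [LF]
      rw [this]; exact hasFDerivAt_fst

/-- exponentials -/
lemma WB.exp {q : ι → ℝ} {E : ι → V → ℝ} (hq : ∀ i, 1 ≤ q i) (hE : WB (fun i _ => q i) n E) :
    WB (fun i v => q i ^ n * Real.exp (E i v)) n (fun i v => Real.exp (E i v)) := by
  induction n generalizing E with
  | zero =>
    exact ⟨fun i => Real.continuous_exp.comp (hE.1 i), 1, zero_le_one, fun i v => by
      simp [abs_of_pos (Real.exp_pos _)]⟩
  | succ n ih =>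
    have hp := ih hE.pred
    obtain ⟨h0, f1, f2, h1, h2, hd⟩ := hE
    have hm : ∀ f, WB (fun i _ => q i) n f → WB (fun i v => q i ^ (n+1) * Real.exp (E i v)) n
        (fun i v => f i v * Real.exp (E i v)) := fun f hf =>
      (hf.mul hp).congrw fun i v => by ring
    refine ⟨?_, _, _, hm _ h1, hm _ h2, fun i v => ?_⟩
    · refine WB0.mono (K := 1) (fun i v => ?_) zero_le_one hp.zero
      rw [one_mul]
      exact mul_le_mul_of_nonneg_right (pow_le_pow_right₀ (hq i) (Nat.le_succ n)) (Real.exp_pos _).le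
    · refine (hd i v).exp.congr_fderiv ?_
      ext <;> simp [LF] <;> ring

/-- reciprocals -/
lemma WB.inv {f : ι → V → ℝ} {c : ℝ} (hc : 0 < c) (hf : ∀ i v, c ≤ f i v)
    (H : WB (fun _ _ => 1) n f) : WB (fun _ _ => 1) n (fun i v => (f i v)⁻¹) := by
  have h00 : WB0 (fun _ _ => 1) (fun i v => (f i v)⁻¹) := by
    refine ⟨fun i => (H.zero.1 i).inv₀ fun v => (hc.trans_le (hf i v)).ne', c⁻¹,
      (inv_pos.2 hc).le, fun i v => ?_⟩
    have := hc.trans_le (hf i v)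
    rw [abs_of_pos (inv_pos.2 this), mul_one]
    exact inv_anti₀ hc (hf i v)
  induction n with
  | zero => exact h00
  | succ n ih =>
    have hp := ih H.pred
    obtain ⟨h0, f1, f2, h1, h2, hd⟩ := H
    have h12 := (hp.mul1 hp).neg
    refine ⟨h00, _, _, h12.mul1 h1, h12.mul1 h2, fun i v => ?_⟩
    have hne : f i v ≠ 0 := (hc.trans_le (hf i v)).ne'
    refine ((hasDerivAt_inv hne).comp_hasFDerivAt v (hd i v)).congr_fderiv ?_
    ext <;> simp [LF] <;> left <;> field_simp

end

/-- pointwise cocycle bound -/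
lemma cocycle_bound {y a b : ℕ → ℝ} {κ B : ℝ} {p : ℕ} (hκ : 1 < κ) (hp : p ≠ 0)
    (hy : ∀ i, y (i+1) = a i * y i + b i) (ha : ∀ i, κ ≤ |a i|) (hb : ∀ i, |b i| ≤ B)
    (hper : ∀ i, y (i + p) = y i) (i : ℕ) : |y i| ≤ B / (κ - 1) := by
  have hk : 0 < κ - 1 := by linarith
  have step : ∀ j, κ * (|y j| - B / (κ-1)) ≤ |y (j+1)| - B / (κ-1) := by
    intro j
    have h1 : |a j * y j| - |b j| ≤ |y (j+1)| := by
      rw [hy j]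
      have := abs_sub_abs_le_abs_sub (a j * y j) (-(b j))
      rw [abs_neg, sub_neg_eq_add] at this
      exact this
    rw [abs_mul] at h1
    have h2 : κ * |y j| ≤ |a j| * |y j| := mul_le_mul_of_nonneg_right (ha j) (abs_nonneg _)
    have h3 := hb j
    have h4 : κ * (B / (κ - 1)) = B + B / (κ-1) := by field_simp; ring
    rw [mul_sub, h4]; linarith
  have it : ∀ m, κ^m * (|y i| - B / (κ-1)) ≤ |y (i+m)| - B / (κ-1) := by
    intro m
    induction m with
    | zero => simp
    | succ m ih =>
      have := step (i+m)
      have h2 := mul_le_mul_of_nonneg_left ih (by linarith : 0 ≤ κ)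
      rw [pow_succ, ← add_assoc]; nlinarith
  have h1 := it p
  rw [hper] at h1
  have h2 : 1 < κ ^ p := one_lt_pow₀ hκ hp
  nlinarith

/-- cocycle bound for derivatives -/
lemma WB.cocycle {α : Type*} {p : α → ℕ} {κ : ℝ} (hκ : 1 < κ) (hp : ∀ t, p t ≠ 0)
    {y a b : α × ℕ → V → ℝ} {n : ℕ} (ha : WB (fun _ _ => 1) n a) (hb : WB (fun _ _ => 1) n b)
    (hak : ∀ i v, κ ≤ |a i v|) (hy : ∀ t i v, y (t, i+1) v = a (t, i) v * y (t, i) v + b (t, i) v)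
    (hper : ∀ t i v, y (t, i + p t) v = y (t, i) v) (hC : ∀ i, ContDiff ℝ n (y i)) :
    WB (fun _ _ => 1) n y := by
  have h00 : WB0 (fun _ _ => 1) y := by
    obtain ⟨_, B, hB, hbb⟩ := hb.zero
    refine ⟨fun i => (hC i).continuous, B / (κ-1), div_nonneg hB (by linarith), fun i v => ?_⟩
    rw [mul_one]
    obtain ⟨t, i⟩ := i
    exact cocycle_bound (y := fun i => y (t, i) v) (a := fun i => a (t, i) v)
      (b := fun i => b (t, i) v) hκ (hp t) (fun i => hy t i v) (fun i => hak _ _)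
      (fun i => by simpa using hbb (t, i) v) (fun i => hper t i v) i
  induction n generalizing y b with
  | zero => exact h00
  | succ n ih =>
    have hap := ha.pred
    have hyp := ih hap hb.pred hy hper
      (fun i => (hC i).of_le (by exact_mod_cast Nat.le_succ n)) h00
    obtain ⟨ha0, a1, a2, ha1, ha2, had⟩ := ha
    obtain ⟨hb0, b1, b2, hb1, hb2, hbd⟩ := hb
    have hd := fun i => contDiff_succ_iff_fderiv.1 (by exact_mod_cast hC i : ContDiff ℝ ((n:WithTop ℕ∞)+1) (y i))
    have hyd : ∀ i v, HasFDerivAt (y i) (fderiv ℝ (y i) v) v := fun i v => ((hd i).1 v).hasFDerivAt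
    have rel : ∀ t i v, fderiv ℝ (y (t, i+1)) v =
        (a (t,i) v • fderiv ℝ (y (t, i)) v + y (t,i) v • LF (a1 (t,i) v) (a2 (t,i) v)) +
          LF (b1 (t,i) v) (b2 (t,i) v) := by
      intro t i v
      have e : y (t, i+1) = fun v => a (t, i) v * y (t, i) v + b (t, i) v := by
        funext v; exact hy t i v
      have := ((had (t,i) v).mul (hyd (t,i) v)).add (hbd (t,i) v)
      rw [e]; exact this.fderiv
    have relp : ∀ t i v, fderiv ℝ (y (t, i+p t)) v = fderiv ℝ (y (t,i)) v := by
      intro t i v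
      have e : y (t, i+p t) = y (t, i) := by funext v; exact hper t i v
      rw [e]
    have main : ∀ (u : V) (a' b' : α × ℕ → V → ℝ), WB (fun _ _ => 1) n a' → WB (fun _ _ => 1) n b' →
        (∀ t i v, LF (a1 (t,i) v) (a2 (t,i) v) u = a' (t,i) v) →
        (∀ t i v, LF (b1 (t,i) v) (b2 (t,i) v) u = b' (t,i) v) →
        WB (fun _ _ => 1) n (fun i v => fderiv ℝ (y i) v u) := by
      intro u a' b' ha' hb' hea heb
      have hbb := (ha'.mul1 hyp).add hb'
      have hrel : ∀ t i v, fderiv ℝ (y (t, i+1)) v u = a (t,i) v * fderiv ℝ (y (t, i)) v u +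
          (a' (t,i) v * y (t,i) v + b' (t,i) v) := by
        intro t i v
        rw [rel]
        simp only [add_apply, smul_apply, smul_eq_mul, hea, heb]
        ring
      have hper' : ∀ t i v, fderiv ℝ (y (t, i+p t)) v u = fderiv ℝ (y (t,i)) v u :=
        fun t i v => by rw [relp]
      have hCC : ∀ i, ContDiff ℝ n (fun v => fderiv ℝ (y i) v u) :=
        fun i => (hd i).2.2.clm_apply contDiff_const
      refine ih (y := fun i v => fderiv ℝ (y i) v u) hap hbb hrel hper' hCC ?_
      obtain ⟨_, B, hB, hbb⟩ := hbb.zero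
      refine ⟨fun i => (hCC i).continuous, B / (κ-1), div_nonneg hB (by linarith), fun i v => ?_⟩
      rw [mul_one]
      obtain ⟨t, i⟩ := i
      exact cocycle_bound (y := fun i => fderiv ℝ (y (t,i)) v u) (a := fun i => a (t, i) v)
        hκ (hp t) (fun i => hrel t i v) (fun i => hak _ _)
        (fun i => by simpa using hbb (t, i) v) (fun i => hper' t i v) i
    refine ⟨h00, _, _, main (1,0) a1 b1 ha1 hb1 ?_ ?_, main (0,1) a2 b2 ha2 hb2 ?_ ?_, fun i v => ?_⟩
    · intro t i v; simp [LF]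
    · intro t i v; simp [LF]
    · intro t i v; simp [LF]
    · intro t i v; simp [LF]
    · rw [← LF_eq]; exact hyd i v

end PV


namespace PV

/-- global periodic families of expanding maps -/
structure GF (N : ℕ) (F : ℝ → ℝ → ℝ) (g : ℝ → ℝ) (d : ℤ) (κ : ℝ) : Prop where
  hN : 1 ≤ N
  hκ : 1 < κ
  hF : ContDiff ℝ N fun p : V => F p.1 p.2
  hFx : ContDiff ℝ N fun p : V => deriv (F p.1) p.2
  lift : ∀ σ x, F σ (x + 1) = F σ x + d
  per : ∀ σ x, F (σ + 2 * Real.pi) x = F σ x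
  hd : ∀ σ x, κ ≤ |deriv (F σ) x|
  hg : ContDiff ℝ N g
  gper : ∀ x, g (x + 1) = g x

namespace GF

variable {N : ℕ} {F : ℝ → ℝ → ℝ} {g : ℝ → ℝ} {d : ℤ} {κ : ℝ} (H : GF N F g d κ)
include H

lemma N_ne : ((N : ℕ) : WithTop ℕ∞) ≠ 0 := by
  have := H.hN
  exact_mod_cast (by omega : N ≠ 0)

lemma one_le : (1 : WithTop ℕ∞) ≤ (N : ℕ) := by exact_mod_cast H.hN

lemma em (σ : ℝ) : EM (F σ) d κ where
  hC := (H.hF.comp (contDiff_const.prodMk contDiff_id)).of_le H.one_le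
  lift := H.lift σ
  hκ := by linarith [H.hκ]
  hd := H.hd σ

lemma iter (n : ℕ) : ContDiff ℝ N fun p : V => (F p.1)^[n] p.2 := by
  induction n with
  | zero => exact contDiff_snd
  | succ n ih =>
    simp only [Function.iterate_succ_apply']
    exact H.hF.comp (contDiff_fst.prodMk ih)

lemma exists_X : ∃ X : ℕ → ℤ → ℝ → ℝ, ∀ n k,
    (∀ σ, (F σ)^[n+1] (X n k σ) = X n k σ + k) ∧ ContDiff ℝ N (X n k) := by
  have e : ∀ n σ, EM (fun x => (F σ)^[n+1] x - x) (d^(n+1) - 1) (κ^(n+1) - 1) := fun n σ =>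
    ((H.em σ).iterate (n+1)).sub_id (one_lt_pow₀ H.hκ (by omega))
  choose X hX using fun n (k : ℤ) σ => (e n σ).surj k
  refine ⟨X, fun n k => ⟨fun σ => by linarith [hX n k σ], ?_⟩⟩
  rw [contDiff_iff_contDiffAt]
  intro σ
  set f : V → ℝ := fun p => (F p.1)^[n+1] p.2 - p.2 with hf
  have hfC : ContDiff ℝ N f := (H.iter (n+1)).sub contDiff_snd
  have hinv : (fderiv ℝ f (σ, X n k σ) ∘L .inr ℝ ℝ ℝ).IsInvertible := by
    have h1 : HasFDerivAt f (fderiv ℝ f (σ, X n k σ)) (σ, X n k σ) :=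
      (hfC.differentiable H.N_ne _).hasFDerivAt
    have h2 := h1.comp_hasDerivAt (X n k σ)
      ((hasDerivAt_const (X n k σ) σ).prodMk (hasDerivAt_id (X n k σ)))
    have h3 : fderiv ℝ f (σ, X n k σ) (0, 1) ≠ 0 := by
      have h4 := (e n σ).hd (X n k σ)
      have h5 : deriv (fun x => (F σ)^[n+1] x - x) (X n k σ) = fderiv ℝ f (σ, X n k σ) (0, 1) := h2.deriv
      rw [h5] at h4
      exact abs_pos.1 ((e n σ).hκ.trans_le h4)
    refine ⟨ContinuousLinearEquiv.unitsEquivAut ℝ (Units.mk0 _ h3), ?_⟩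
    ext
    simp
  have hc := hfC.contDiffAt (x := (σ, X n k σ))
  refine (hc.contDiffAt_implicitFunction H.N_ne hinv).congr_of_eventuallyEq ?_
  filter_upwards [hc.eventually_apply_implicitFunction H.N_ne hinv] with σ' h'
  refine (e n σ').inj ?_
  have h1 := hX n k σ'
  have h2 := hX n k σ
  simp only [hf] at h'
  simp only at h1 h2 ⊢
  rw [h1, h', h2]

/-- derivative in the parameter -/
lemma orbit_DN (X : ℕ → ℤ → ℝ → ℝ) (hX : ∀ n k,
    (∀ σ, (F σ)^[n+1] (X n k σ) = X n k σ + k) ∧ ContDiff ℝ N (X n k)) :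
    DN N (fun (t : (ℕ × ℤ) × ℕ) (v : V) => (F v.2)^[t.2] (X t.1.1 t.1.2 v.2)) := by
  obtain ⟨M, rfl⟩ : ∃ M, N = M + 1 := ⟨N - 1, by have := H.hN; omega⟩
  set x : (ℕ × ℤ) × ℕ → ℝ → ℝ := fun t σ => (F σ)^[t.2] (X t.1.1 t.1.2 σ) with hx
  have hxC : ∀ t, ContDiff ℝ ((M+1 : ℕ)) (x t) := fun t =>
    (H.iter t.2).comp (contDiff_id.prodMk (hX t.1.1 t.1.2).2)
  set y : (ℕ × ℤ) × ℕ → V → ℝ := fun t v => deriv (x t) v.2 with hy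
  have hyC : ∀ t, ContDiff ℝ M (y t) := fun t => by
    have := hxC t
    push_cast at this
    exact ((contDiff_succ_iff_deriv.1 this).2.2).comp contDiff_snd
  have hxd : ∀ t v, HasFDerivAt (fun v : V => x t v.2) (LF 0 (y t v)) v := fun t v => by
    have h1 : HasDerivAt (x t) (y t v) v.2 := ((hxC t).differentiable H.N_ne _).hasDerivAt
    refine (h1.comp_hasFDerivAt v hasFDerivAt_snd).congr_fderiv ?_
    ext <;> simp [LF]
  have hdn : ∀ m, WB (fun _ _ => 1) m y → DN (m+1) (fun t (v : V) => x t v.2) := fun m hm =>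
    ⟨fun _ _ => 0, y, (WB.const (fun _ => (0:ℝ))).mono (K := 1) (by simp) (by simp), hm, hxd⟩
  set Fu : V → ℝ := fun p => F p.1 p.2 with hFu
  have hFd := contDiff_succ_iff_fderiv.1 (by exact_mod_cast H.hF : ContDiff ℝ ((M : WithTop ℕ∞)+1) Fu)
  have per1 : ∀ a b, deriv (F (a + 2 * Real.pi)) b = deriv (F a) b := fun a b => by
    have : F (a + 2 * Real.pi) = F a := funext (H.per a)
    rw [this]
  have GA : WB (fun (_:Unit) _ => 1) M (fun _ (p : V) => deriv (F p.1) p.2) :=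
    (WB.of_periodic Real.two_pi_pos one_pos (H.hFx.of_le (by exact_mod_cast Nat.le_succ M))
      per1 (fun a b => (H.em a).deriv_per b))
  have GB : WB (fun (_:Unit) _ => 1) M (fun _ (p : V) => fderiv ℝ Fu p (1, 0)) := by
    refine WB.of_periodic Real.two_pi_pos one_pos (hFd.2.2.clm_apply contDiff_const) ?_ ?_
    · intro a b
      have e := fderiv_comp_add_right (𝕜 := ℝ) (f := Fu) (x := (a, b)) (2 * Real.pi, 0)
      have e2 : (fun v : V => Fu (v + (2 * Real.pi, 0))) = Fu := by
        funext v; simp [hFu, H.per]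
      rw [e2] at e
      simp only [Prod.mk_add_mk, add_zero] at e
      rw [← e]
    · intro a b
      have e := fderiv_comp_add_right (𝕜 := ℝ) (f := Fu) (x := (a, b)) (0, 1)
      have e2 : (fun v : V => Fu (v + (0, 1))) = fun v => Fu v + d := by
        funext v; simp [hFu, H.lift]
      rw [e2, fderiv_add_const] at e
      simp only [Prod.mk_add_mk, add_zero] at e
      rw [← e]
  have main : ∀ m, m ≤ M → DN m (fun t (v : V) => x t v.2) → WB (fun _ _ => 1) m y := by
    intro m hm hD
    have ha := (GA.le hm).comp (ι := (ℕ × ℤ) × ℕ) DN.snd hD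
    have hb := (GB.le hm).comp (ι := (ℕ × ℤ) × ℕ) DN.snd hD
    refine WB.cocycle (p := fun t : ℕ × ℤ => t.1 + 1) H.hκ (fun t => by omega) ha hb
      (fun i v => H.hd _ _) ?_ ?_ (fun i => (hyC i).of_le (by exact_mod_cast hm))
    · intro t i v
      have h1 : HasDerivAt (x (t, i)) (y (t, i) v) v.2 := ((hxC _).differentiable H.N_ne _).hasDerivAt
      have h2 : HasFDerivAt Fu (fderiv ℝ Fu (v.2, x (t,i) v.2)) (v.2, x (t,i) v.2) :=
        (hFd.1 _).hasFDerivAt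
      have h3 := h2.comp_hasDerivAt v.2 ((hasDerivAt_id v.2).prodMk h1)
      have h4 := h2.comp_hasDerivAt (x (t,i) v.2)
        ((hasDerivAt_const (x (t,i) v.2) v.2).prodMk (hasDerivAt_id (x (t,i) v.2)))
      have e4 : deriv (F v.2) (x (t,i) v.2) = fderiv ℝ Fu (v.2, x (t,i) v.2) (0, 1) := h4.deriv
      have e3 : y (t, i+1) v = fderiv ℝ Fu (v.2, x (t,i) v.2) (1, y (t,i) v) := by
        have e5 : x (t, i+1) = Fu ∘ fun σ => (id σ, x (t,i) σ) := by
          funext σ; simp [hx, hFu, Function.iterate_succ_apply']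
        simp only [hy]
        rw [e5]
        exact h3.deriv
      rw [e3, e4, LF_eq (fderiv ℝ Fu (v.2, x (t,i) v.2)), LF_apply, LF_apply, LF_apply]
      simp; ring
    · intro t i v
      have e5 : x (t, i + (t.1+1)) = fun σ => x (t, i) σ + (d^i * t.2 : ℤ) := by
        funext σ
        simp only [hx]
        rw [Function.iterate_add_apply, (hX t.1 t.2).1, ((H.em σ).iterate i).lift_int]
        push_cast; ring
      simp only [hy]
      rw [e5, deriv_add_const]
  have all : ∀ m, m ≤ M → WB (fun _ _ => 1) m y := by
    intro m
    induction m with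
    | zero => exact fun h => main 0 h fun t => (hxC t).continuous.comp continuous_snd
    | succ m ih => exact fun h => main (m+1) h (hdn m (ih (by omega)))
  exact hdn M (all M le_rfl)

/-- Bounds on the derivatives of the orbit sums. -/
theorem coeff (η : ℝ) :
    WB (fun (n : ℕ) v => ((n:ℝ)+1)^N * cR (F v.2) g (η * Real.sin v.1) (n+1)) N
      (fun (n : ℕ) v => cR (F v.2) g (η * Real.sin v.1) (n+1)) := by
  obtain ⟨X, hX⟩ := H.exists_X
  have hx := H.orbit_DN X hX
  have per1 : ∀ a b, deriv (F (a + 2 * Real.pi)) b = deriv (F a) b := fun a b => by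
    have : F (a + 2 * Real.pi) = F a := funext (H.per a)
    rw [this]
  have hl : WB (fun _ _ => 1) N (fun (t : (ℕ × ℤ) × ℕ) (v : V) =>
      Real.log |deriv (F v.2) ((F v.2)^[t.2] (X t.1.1 t.1.2 v.2))|) := by
    have G : WB (fun (_:Unit) _ => 1) N (fun _ (p : V) => Real.log |deriv (F p.1) p.2|) := by
      refine WB.of_periodic Real.two_pi_pos one_pos ?_ ?_ ?_
      · simp only [Real.log_abs]
        exact H.hFx.log fun p => (H.em p.1).deriv_ne p.2
      · intro a b; simp only [per1]
      · intro a b; simp only [(H.em a).deriv_per]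
    exact G.comp DN.snd hx
  have hgx : WB (fun _ _ => 1) N (fun (t : (ℕ × ℤ) × ℕ) (v : V) =>
      g ((F v.2)^[t.2] (X t.1.1 t.1.2 v.2))) := by
    have G : WB (fun (_:Unit) _ => 1) N (fun _ (p : V) => g p.2) :=
      WB.of_periodic one_pos one_pos (H.hg.comp contDiff_snd) (fun _ _ => rfl)
        (fun _ b => H.gper b)
    exact G.comp DN.snd hx
  have hs : WB (fun _ _ => 1) N (fun (t : (ℕ × ℤ) × ℕ) (v : V) => -(η * Real.sin v.1)) := by
    have G : WB (fun (_:Unit) _ => 1) N (fun _ (p : V) => -(η * Real.sin p.1)) := by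
      refine WB.of_periodic Real.two_pi_pos one_pos ?_ ?_ (fun _ _ => rfl)
      · exact (contDiff_const.mul (Real.contDiff_sin.comp contDiff_fst)).neg
      · intro a b; simp
    exact G.comp (z := fun _ v => v.1) DN.fst DN.fst
  have he := ((hs.mul1 hgx).sub hl).sum (fun t : ℕ × ℤ => Finset.range (t.1 + 1))
  have hL := (hl.neg).sum (fun t : ℕ × ℤ => Finset.range (t.1 + 1))
  simp only [Finset.sum_const, Finset.card_range, nsmul_eq_mul, mul_one] at he hL
  have hq : ∀ t : ℕ × ℤ, (1:ℝ) ≤ ((t.1 + 1 : ℕ) : ℝ) := fun t => by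
    exact_mod_cast Nat.le_add_left 1 t.1
  have hE := WB.exp hq he
  have hLe := WB.exp hq hL
  -- the exponent of `E`
  have iE : ∀ (t : ℕ × ℤ) (v : V), Real.exp (∑ b ∈ Finset.range (t.1 + 1),
      (-(η * Real.sin v.1) * g ((F v.2)^[b] (X t.1 t.2 v.2)) -
        Real.log |deriv (F v.2) ((F v.2)^[b] (X t.1 t.2 v.2))|)) =
      Real.exp (-(η * Real.sin v.1) * birkhoff (F v.2) g (t.1+1) (X t.1 t.2 v.2)) /
        |deriv ((F v.2)^[t.1+1]) (X t.1 t.2 v.2)| := fun t v =>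
    (H.em v.2).exp_birk g (η * Real.sin v.1) (t.1+1) (X t.1 t.2 v.2)
  have iL : ∀ (t : ℕ × ℤ) (v : V), Real.exp (∑ b ∈ Finset.range (t.1 + 1),
      -Real.log |deriv (F v.2) ((F v.2)^[b] (X t.1 t.2 v.2))|) =
      1 / |deriv ((F v.2)^[t.1+1]) (X t.1 t.2 v.2)| := fun t v => by
    have := (H.em v.2).exp_birk (fun _ => 0) 0 (t.1+1) (X t.1 t.2 v.2)
    simpa [birkhoff, pot] using this
  simp only [iE] at hE
  simp only [iL] at hLe
  have hDk : ∀ (t : ℕ × ℤ) (v : V), κ^(t.1+1) ≤ |deriv ((F v.2)^[t.1+1]) (X t.1 t.2 v.2)| :=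
    fun t v => ((H.em v.2).iterate (t.1+1)).hd _
  have hκ0 : 0 < κ := by linarith [H.hκ]
  have hD0 : ∀ (t : ℕ × ℤ) (v : V), 0 < |deriv ((F v.2)^[t.1+1]) (X t.1 t.2 v.2)| :=
    fun t v => (pow_pos hκ0 _).trans_le (hDk t v)
  -- `Q`
  have hQ : WB (fun _ _ => 1) N (fun (t : ℕ × ℤ) (v : V) =>
      (deriv ((F v.2)^[t.1+1]) (X t.1 t.2 v.2))⁻¹) := by
    have h1 := hLe.cmul (fun t : ℕ × ℤ => ((d^(t.1+1)).sign : ℝ))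
    obtain ⟨K, hK⟩ : ∃ K, ∀ m : ℕ, (m:ℝ)^N * (κ⁻¹)^m ≤ K := by
      have := tendsto_pow_const_mul_const_pow_of_abs_lt_one N (r := κ⁻¹) (by
        rw [abs_of_pos (inv_pos.2 hκ0)]; exact inv_lt_one_of_one_lt₀ H.hκ)
      obtain ⟨K, hK⟩ := this.bddAbove_range
      exact ⟨K, fun m => hK ⟨m, rfl⟩⟩
    have hK0 : 0 ≤ K := le_trans (by positivity) (hK 1)
    refine (h1.mono (w' := fun _ _ => 1) (K := K) ?_ hK0).congr ?_
    · intro t v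
      rw [mul_one]
      have hs : |(((d^(t.1+1)).sign : ℤ) : ℝ)| ≤ 1 := by
        rcases Int.sign_trichotomy (d^(t.1+1)) with h | h | h <;> simp [h]
      refine (mul_le_of_le_one_left (by positivity) hs).trans ?_
      refine le_trans ?_ (hK (t.1+1))
      refine mul_le_mul_of_nonneg_left ?_ (by positivity)
      rw [one_div, inv_pow]
      exact inv_anti₀ (pow_pos hκ0 _) (hDk t v)
    · intro t v
      have h1 := ((H.em v.2).iterate (t.1+1)).sign_deriv (X t.1 t.2 v.2)
      have hne : deriv ((F v.2)^[t.1+1]) (X t.1 t.2 v.2) ≠ 0 := abs_pos.1 (hD0 t v)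
      rw [← h1]
      have h2 : ((d^(t.1+1)).sign : ℝ) ≠ 0 := by
        intro h; rw [h, zero_mul] at h1; exact (hD0 t v).ne h1
      field_simp
  have hQb : ∀ (t : ℕ × ℤ) (v : V), |(deriv ((F v.2)^[t.1+1]) (X t.1 t.2 v.2))⁻¹| ≤ κ⁻¹ := by
    intro t v
    rw [abs_inv]
    refine inv_anti₀ hκ0 (le_trans ?_ (hDk t v))
    exact le_self_pow₀ H.hκ.le (by omega)
  have hκi : κ⁻¹ < 1 := inv_lt_one_of_one_lt₀ H.hκ
  have hP := WB.inv (c := 1 - κ⁻¹) (by linarith) (fun t v => by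
    have := (le_abs_self _).trans (hQb t v); linarith) 
    (((WB.const (fun _ : ℕ × ℤ => (1:ℝ))).congrw (w' := fun _ _ => 1) (by simp)).sub hQ)
  have hW := (hE.mul1 hP).sum (fun n : ℕ => KI (d^(n+1) - 1))
  -- identification
  have idW : ∀ (t : ℕ × ℤ) (v : V), Real.exp (-(η * Real.sin v.1) * birkhoff (F v.2) g (t.1+1) (X t.1 t.2 v.2)) /
        |deriv ((F v.2)^[t.1+1]) (X t.1 t.2 v.2)| * (1 - (deriv ((F v.2)^[t.1+1]) (X t.1 t.2 v.2))⁻¹)⁻¹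
      = Real.exp (-(η * Real.sin v.1) * birkhoff (F v.2) g (t.1+1) (X t.1 t.2 v.2)) /
        |deriv ((F v.2)^[t.1+1]) (X t.1 t.2 v.2) - 1| := by
    intro t v
    set D := deriv ((F v.2)^[t.1+1]) (X t.1 t.2 v.2) with hD
    have hne : D ≠ 0 := abs_pos.1 (hD0 t v)
    have h1 : 0 < 1 - D⁻¹ := by
      have := (le_abs_self _).trans (hQb t v); linarith
    have h2 : |D - 1| = |D| * (1 - D⁻¹) := by
      rw [← abs_of_pos h1, ← abs_mul]; congr 1; field_simp
    rw [h2, div_mul_eq_div_div, div_eq_mul_inv (_ / |D|)]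
  have idc : ∀ (n : ℕ) (v : V), cR (F v.2) g (η * Real.sin v.1) (n+1) = ∑ k ∈ KI (d^(n+1) - 1),
      Real.exp (-(η * Real.sin v.1) * birkhoff (F v.2) g (n+1) (X n k v.2)) /
        |deriv ((F v.2)^[n+1]) (X n k v.2) - 1| := by
    intro n v
    have E := H.em v.2
    have E' := (E.iterate (n+1)).sub_id (one_lt_pow₀ H.hκ (by omega : n + 1 ≠ 0))
    set W : ℝ → ℝ := fun x => Real.exp (-(η * Real.sin v.1) * birkhoff (F v.2) g (n+1) x) /
        |deriv ((F v.2)^[n+1]) x - 1| with hWd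
    obtain ⟨A, hA⟩ := exists_anti fun k => W (X n k v.2)
    have h1 := (finsum_per E' W (fun x => by
        simp only [hWd, E.birk_per H.gper, E.deriv_iter_per]) (fun k => X n k v.2) (fun k => by
        rw [(hX n k).1]; ring) hA).2
    rw [sum_KI hA (d^(n+1) - 1), ← h1]
    unfold cR
    have : periodicPtsIn (F v.2) (n+1) = {x | x ∈ Set.Ico (0:ℝ) 1 ∧ ∃ k : ℤ, (F v.2)^[n+1] x - x = k} := by
      ext x
      refine and_congr Iff.rfl (exists_congr fun k => ?_)
      rw [sub_eq_iff_eq_add, add_comm x]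
    rw [this]
  have hW2 := hW.congr (h := fun n v => cR (F v.2) g (η * Real.sin v.1) (n+1)) (by
    intro n v
    rw [idc]
    exact Finset.sum_congr rfl fun k _ => idW (n, k) v)
  refine hW2.mono (K := 2) ?_ (by norm_num)
  intro n v
  rw [idc, Finset.mul_sum, Finset.mul_sum]
  refine Finset.sum_le_sum fun k _ => ?_
  push_cast
  have := hD0 (n, k) v
  have hD1 := hDk (n, k) v
  simp only at this hD1
  have h1 : |deriv ((F v.2)^[n+1]) (X n k v.2) - 1| ≤ 2 * |deriv ((F v.2)^[n+1]) (X n k v.2)| := by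
    have h2 : |deriv ((F v.2)^[n+1]) (X n k v.2) - 1| ≤ |deriv ((F v.2)^[n+1]) (X n k v.2)| + |1| := abs_sub _ _
    have h3 : 1 ≤ κ^(n+1) := one_le_pow₀ H.hκ.le
    rw [abs_one] at h2
    linarith
  have h0 : 0 < |deriv ((F v.2)^[n+1]) (X n k v.2) - 1| := by
    have h2 : |deriv ((F v.2)^[n+1]) (X n k v.2)| - |1| ≤ |deriv ((F v.2)^[n+1]) (X n k v.2) - 1| :=
      abs_sub_abs_le_abs_sub _ _
    have h3 : 1 < κ^(n+1) := one_lt_pow₀ H.hκ (by omega)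
    rw [abs_one] at h2
    linarith
  have h4 : Real.exp (-(η * Real.sin v.1) * birkhoff (F v.2) g (n+1) (X n k v.2)) /
      |deriv ((F v.2)^[n+1]) (X n k v.2)| ≤ 2 * (Real.exp (-(η * Real.sin v.1) * birkhoff (F v.2) g (n+1) (X n k v.2)) /
      |deriv ((F v.2)^[n+1]) (X n k v.2) - 1|) := by
    rw [← mul_div_assoc, div_le_div_iff₀ this h0]
    nlinarith [Real.exp_pos (-(η * Real.sin v.1) * birkhoff (F v.2) g (n+1) (X n k v.2))]
  calc _ ≤ ((n:ℝ)+1)^N * (2 * (Real.exp (-(η * Real.sin v.1) * birkhoff (F v.2) g (n+1) (X n k v.2)) /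
      |deriv ((F v.2)^[n+1]) (X n k v.2) - 1|)) := mul_le_mul_of_nonneg_left h4 (by positivity)
    _ = _ := by ring

end GF

end PV


namespace PV

lemma wb_lip {G : V → ℝ} (H : WB (fun (_ : Unit) _ => 1) 1 (fun _ => G)) :
    ∃ C, 0 ≤ C ∧ ∀ a x y, |G (a, x) - G (a, y)| ≤ C * |x - y| := by
  obtain ⟨-, f1, f2, h1, h2, hd⟩ := H
  obtain ⟨-, C, hC, hb⟩ := h2
  refine ⟨C, hC, fun a x y => ?_⟩
  have hder : ∀ x, HasDerivAt (fun x => G (a, x)) (f2 () (a, x)) x := fun x => by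
    have := (hd () (a, x)).comp_hasDerivAt x ((hasDerivAt_const x a).prodMk (hasDerivAt_id x))
    have e : LF (f1 () (a, x)) (f2 () (a, x)) (0, 1) = f2 () (a, x) := by simp [LF]
    rw [← e]; exact this
  have := Convex.norm_image_sub_le_of_norm_hasDerivWithin_le (f := fun x => G (a, x))
    (s := Set.univ) (C := C) (fun x _ => (hder x).hasDerivWithinAt)
    (fun x _ => by simpa using hb () (a, x)) convex_univ (mem_univ y) (mem_univ x)
  simpa using this

namespace GF
variable {N : ℕ} {F : ℝ → ℝ → ℝ} {g : ℝ → ℝ} {d : ℤ} {κ : ℝ} (H : GF N F g d κ)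
include H

lemma logLip : ∃ B, 0 ≤ B ∧ ∀ σ x y, |(Real.log |deriv (F σ) x|) - (Real.log |deriv (F σ) y|)| ≤ B * |x - y| := by
  have G : WB (fun (_:Unit) _ => 1) N (fun _ (p : V) => Real.log |deriv (F p.1) p.2|) := by
    refine WB.of_periodic Real.two_pi_pos one_pos ?_ ?_ ?_
    · simp only [Real.log_abs]
      exact H.hFx.log fun p => (H.em p.1).deriv_ne p.2
    · intro a b
      have : F (a + 2 * Real.pi) = F a := funext (H.per a)
      simp only [this]
    · intro a b; simp only [(H.em a).deriv_per]
  exact wb_lip (G.le H.hN)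

lemma gBound : ∃ M, 0 ≤ M ∧ (∀ x, |g x| ≤ M) ∧ ∀ x y, |g x - g y| ≤ M * |x - y| := by
  have G : WB (fun (_:Unit) _ => 1) N (fun _ (p : V) => g p.2) :=
      WB.of_periodic one_pos one_pos (H.hg.comp contDiff_snd) (fun _ _ => rfl)
        (fun _ b => H.gper b)
  obtain ⟨C, hC, h⟩ := wb_lip (G.le H.hN)
  obtain ⟨-, C', hC', h'⟩ := G.zero
  refine ⟨C + C', by positivity, fun x => ?_, fun x y => (h 0 x y).trans ?_⟩
  · have := h' () (0, x)
    simp only [mul_one] at this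
    linarith
  · exact mul_le_mul_of_nonneg_right (by linarith) (abs_nonneg _)

end GF

lemma toBCF_apply {u : ℝ → ℝ} (hc : Continuous u) (hp : ∀ x, u (x + 1) = u x) (x : ℝ) :
    toBCF u x = u x := by
  have hb : ∃ C, ∀ x y, dist (u x) (u y) ≤ C := by
    obtain ⟨C, hC⟩ := (isCompact_Icc (a := (0:ℝ)) (b := 1)).exists_bound_of_continuousOn hc.continuousOn
    have : ∀ x, ‖u x‖ ≤ C := fun x => by
      obtain ⟨y, hy, e⟩ := (show Function.Periodic u 1 from hp).exists_mem_Ico₀ one_pos x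
      rw [e]; exact hC y ⟨hy.1, hy.2.le⟩
    exact ⟨C + C, fun x y => (dist_le_norm_add_norm _ _).trans (add_le_add (this x) (this y))⟩
  unfold toBCF
  rw [dif_pos ⟨hc, hb⟩]
  rfl

lemma iterDeriv_per {f : ℝ → ℝ} {d : ℤ} (hf : IsCircleLift f d) (j : ℕ) (x : ℝ) :
    iteratedDeriv (j+1) f (x + 1) = iteratedDeriv (j+1) f x := by
  rw [iteratedDeriv_succ']
  have h : (fun y => deriv f (y + 1)) = deriv f := by
    funext y
    rw [← deriv_comp_add_const]
    have : (fun y => f (y + 1)) = fun y => f y + d := funext hf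
    rw [this, deriv_add_const]
  have := congrFun (iteratedDeriv_comp_add_const j (deriv f) 1) x
  rw [h] at this
  exact this.symm

lemma deg_const (dd : ℝ → ℤ) (f : ℝ → ℝ) (h1 : ∀ σ, ((dd σ : ℤ) : ℝ) = f σ) (hf : Continuous f) (σ : ℝ) :
    dd σ = dd 0 := by
  have h2 : Continuous dd := by
    rw [Int.isClosedEmbedding_coe_real.isEmbedding.continuous_iff]
    have : ((↑) : ℤ → ℝ) ∘ dd = f := funext h1
    rw [this]
    exact hf
  exact ((IsLocallyConstant.iff_continuous dd).2 h2).apply_eq_of_preconnectedSpace σ 0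

lemma exists_GF {ε : ℝ} (hε : 0 < ε) {T : ℝ → ℝ → ℝ} {g : ℝ → ℝ} {N r : ℕ} (hN : 1 ≤ N) (hr : N + 2 ≤ r)
    (hT : CNFamilyU N r (Ioo (-ε) ε) T)
    (hTexp : ∀ τ ∈ Ioo (-ε) ε, (∃ d : ℤ, IsCircleLift (T τ) d) ∧ ∀ x, 1 < |deriv (T τ) x|)
    (hg : ContDiff ℝ N g) (hgper : ∀ x, g (x + 1) = g x) :
    ∃ d κ, GF N (fun σ => T (ε / 2 * Real.sin σ)) g d κ := by
  obtain ⟨F, hFd⟩ : ∃ F : ℝ → ℝ → ℝ, (fun σ => T (ε / 2 * Real.sin σ)) = F := ⟨_, rfl⟩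
  rw [hFd]
  have hFs : ∀ σ, T (ε / 2 * Real.sin σ) = F σ := fun σ => congrFun hFd σ
  have hmem : ∀ σ, ε / 2 * Real.sin σ ∈ Ioo (-ε) ε := fun σ => by
    have h1 := Real.sin_le_one σ
    have h2 := Real.neg_one_le_sin σ
    constructor <;> nlinarith
  have hsin : ContDiff ℝ N fun σ => ε / 2 * Real.sin σ := contDiff_const.mul Real.contDiff_sin
  have hFC : ∀ σ, ContDiff ℝ r (F σ) := fun σ => hFs σ ▸ hT.1 _ (hmem σ)
  have hE := fun σ => hTexp _ (hmem σ)
  simp only [hFs] at hE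
  choose dd hdd using fun σ => (hE σ).1
  set h : ℕ → ℝ → BC := fun j σ => toBCF (iteratedDeriv (j+1) (F σ)) with hh
  have hcont : ∀ j, j < r → ∀ σ, Continuous (iteratedDeriv (j+1) (F σ)) := fun j hj σ =>
    (hFC σ).continuous_iteratedDeriv (j+1) (by exact_mod_cast hj)
  have hap : ∀ j, j < r → ∀ σ x, h j σ x = iteratedDeriv (j+1) (F σ) x := fun j hj σ x =>
    toBCF_apply (hcont j hj σ) (iterDeriv_per (hdd σ) j) x
  have ftc : ∀ j, j < r → ∀ σ x, iteratedDeriv j (F σ) x = iteratedDeriv j (F σ) 0 + IG x (h j σ) := by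
    intro j hj σ x
    rw [IG_apply]
    simp only [hap j hj]
    rw [intervalIntegral.integral_eq_sub_of_hasDerivAt (f := iteratedDeriv j (F σ))]
    · ring
    · intro y _
      rw [iteratedDeriv_succ]
      exact ((hFC σ).differentiable_iteratedDeriv j (by exact_mod_cast hj) y).hasDerivAt
    · exact (hcont j hj σ).intervalIntegrable _ _
  have FAM : Fam N r (fun σ => F σ 0) h := by
    have k1 := hT.2.1.comp_contDiff hsin hmem
    have k2 := fun j (hj : j < r) => (hT.2.2 (j+1) (by omega) (by omega)).comp_contDiff hsin hmem
    simp only [Function.comp_def, hFs] at k1 k2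
    refine ⟨k1, k2, fun j hj σ x => ?_⟩
    rw [hap j (by omega), hap j (by omega), ftc (j+1) hj]
  have jF : ContDiff ℝ N fun p : V => F p.1 p.2 := by
    have := FAM.contDiff (by omega)
    convert this using 2 with p
    have := ftc 0 (by omega) p.1 p.2
    simpa using this
  have jFx : ContDiff ℝ N fun p : V => deriv (F p.1) p.2 := by
    obtain ⟨r, rfl⟩ : ∃ r', r = r' + 1 := ⟨r - 1, by omega⟩
    have := FAM.deriv_x.contDiff (by omega)
    convert this using 2 with p
    have := ftc 1 (by omega) p.1 p.2
    rw [hap 0 (by omega)]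
    simpa using this
  have hper : ∀ σ x, F (σ + 2 * Real.pi) x = F σ x := fun σ x => by rw [← hFs, ← hFs]; simp
  -- degree
  have hdc : ∀ σ, dd σ = dd 0 := by
    have h1 : ∀ σ, ((dd σ : ℤ) : ℝ) = F σ 1 - F σ 0 := fun σ => by
      have := hdd σ 0
      rw [zero_add] at this
      rw [this]; ring
    have hc1 : ∀ x, Continuous fun σ => F σ x := fun x => by
      have h3 : Continuous fun σ : ℝ => ((σ, x) : V) := by fun_prop
      exact jF.continuous.comp h3
    intro σ
    exact deg_const dd (fun σ => F σ 1 - F σ 0) h1 ((hc1 1).sub (hc1 0)) σ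
  -- kappa
  have hK : IsCompact (Icc (0:ℝ) (2 * Real.pi) ×ˢ Icc (0:ℝ) 1) := isCompact_Icc.prod isCompact_Icc
  obtain ⟨p, hp, hmin⟩ := hK.exists_isMinOn ⟨(0, 0), by simp [Real.pi_pos.le]⟩
    (f := fun p : V => |deriv (F p.1) p.2|) (jFx.continuous.abs.continuousOn)
  refine ⟨dd 0, |deriv (F p.1) p.2|, hN, (hE p.1).2 p.2, jF, jFx, ?_, hper, ?_, hg, hgper⟩
  · intro σ x
    rw [← hdc σ]; exact hdd σ x
  · intro σ x
    have e1 : Function.Periodic (fun σ => |deriv (F σ) x|) (2 * Real.pi) := fun σ => by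
      have : F (σ + 2 * Real.pi) = F σ := funext (hper σ)
      simp only [this]
    obtain ⟨a, ha, ea⟩ := e1.exists_mem_Ico₀ Real.two_pi_pos σ
    have e2 : Function.Periodic (fun x => |deriv (F a) x|) 1 := fun x => by
      have := iterDeriv_per (hdd a) 0 x
      simp only [zero_add, iteratedDeriv_one] at this
      simp only [this]
    obtain ⟨b, hb, eb⟩ := e2.exists_mem_Ico₀ one_pos x
    have : |deriv (F σ) x| = |deriv (F a) b| := ea.trans eb
    rw [this]
    exact hmin (show (a, b) ∈ _ from ⟨⟨ha.1, ha.2.le⟩, ⟨hb.1, hb.2.le⟩⟩)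

end PV


namespace PV

/-- Taylor coefficients of `exp (-∑ c_k z^(k+1)/(k+1))` -/
def dc (c : ℕ → ℝ) : ℕ → ℝ
  | 0 => 1
  | m+1 => -(∑ k : Fin (m+1), c k * dc c (m - k)) / (m+1)
  decreasing_by omega

lemma dc_zero (c : ℕ → ℝ) : dc c 0 = 1 := by rw [dc]

lemma dc_succ (c : ℕ → ℝ) (m : ℕ) :
    ((m:ℝ)+1) * dc c (m+1) = -∑ k ∈ Finset.range (m+1), c k * dc c (m - k) := by
  rw [dc, Fin.sum_univ_eq_sum_range (fun k => c k * dc c (m - k))]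
  have : (m:ℝ) + 1 ≠ 0 := by positivity
  field_simp

lemma dc_unique (c b : ℕ → ℝ) (h0 : b 0 = 1)
    (hs : ∀ m : ℕ, ((m:ℝ)+1) * b (m+1) = -∑ k ∈ Finset.range (m+1), c k * b (m - k)) (m : ℕ) :
    b m = dc c m := by
  induction m using Nat.strong_induction_on with
  | _ m ih =>
    cases m with
    | zero => rw [h0, dc_zero]
    | succ m =>
      have h1 : ((m:ℝ)+1) * b (m+1) = ((m:ℝ)+1) * dc c (m+1) := by
        rw [hs, dc_succ]
        congr 1
        refine Finset.sum_congr rfl fun k hk => ?_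
        rw [ih (m-k) (by omega)]
      exact mul_left_cancel₀ (by positivity) h1

/-- growth of solutions of the recursion -/
lemma rec_growth {C ρ s K0 R : ℝ} (hC : 0 ≤ C) (hρ : 0 ≤ ρ) (hs : ρ < s) (hK : 0 ≤ K0) (hR : 0 ≤ R) :
    ∃ K, 0 ≤ K ∧ ∀ c b r : ℕ → ℝ, (∀ k, |c k| ≤ C * ρ^k) → |b 0| ≤ K0 → (∀ m, |r m| ≤ R * s^m) →
      (∀ m : ℕ, ((m:ℝ)+1) * b (m+1) = -(∑ k ∈ Finset.range (m+1), c k * b (m - k)) + r m) →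
      ∀ m, |b m| ≤ K * s^m := by
  have hs0 : 0 < s := hρ.trans_lt hs
  set q := ρ / s with hq
  have hq0 : 0 ≤ q := div_nonneg hρ hs0.le
  have hq1 : q < 1 := (div_lt_one hs0).2 hs
  set C' := C * (1 - q)⁻¹ with hC'
  have hC'0 : 0 ≤ C' := mul_nonneg hC (inv_nonneg.2 (by linarith))
  set L := 1 + (C' + 1) / s with hL
  have hL1 : 1 ≤ L := by
    have : 0 ≤ (C'+1)/s := by positivity
    linarith
  obtain ⟨m0, hm0⟩ := exists_nat_ge ((C'+1)/s)
  set K1 := max K0 R with hK1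
  have hK10 : 0 ≤ K1 := hK.trans (le_max_left _ _)
  refine ⟨K1 * L^m0, by positivity, ?_⟩
  intro c b r hc hb hr hrec
  have step : ∀ K, R ≤ K → ∀ m : ℕ, (∀ j ≤ m, |b j| ≤ K * s^j) →
      ((m:ℝ)+1) * |b (m+1)| ≤ K * (C'+1) * s^m := by
    intro K hKR m hj
    have hK0 : 0 ≤ K := hR.trans hKR
    have e1 : ((m:ℝ)+1) * |b (m+1)| = |-(∑ k ∈ Finset.range (m+1), c k * b (m - k)) + r m| := by
      rw [← hrec, abs_mul, abs_of_pos (by positivity : (0:ℝ) < (m:ℝ)+1)]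
    rw [e1]
    have e2 : |∑ k ∈ Finset.range (m+1), c k * b (m - k)| ≤ K * C' * s^m := by
      calc _ ≤ ∑ k ∈ Finset.range (m+1), |c k * b (m - k)| := Finset.abs_sum_le_sum_abs _ _
        _ ≤ ∑ k ∈ Finset.range (m+1), (C * K * s^m) * q^k := by
          refine Finset.sum_le_sum fun k hk => ?_
          have hkm : k ≤ m := by have := Finset.mem_range.1 hk; omega
          rw [abs_mul]
          calc _ ≤ (C * ρ^k) * (K * s^(m-k)) :=
                mul_le_mul (hc k) (hj _ (by omega)) (abs_nonneg _) (by positivity)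
            _ = _ := by
              have : s^m = s^(m-k) * s^k := by rw [← pow_add]; congr 1; omega
              rw [this, hq, div_pow]; field_simp
        _ = (C * K * s^m) * ∑ k ∈ Finset.range (m+1), q^k := by rw [Finset.mul_sum]
        _ ≤ (C * K * s^m) * (1 - q)⁻¹ := by
          refine mul_le_mul_of_nonneg_left ?_ (by positivity)
          rw [← tsum_geometric_of_lt_one hq0 hq1]
          exact (summable_geometric_of_lt_one hq0 hq1).sum_le_tsum _ (fun i _ => by positivity)
        _ = _ := by rw [hC']; ring
    have e3 := abs_add_le (-(∑ k ∈ Finset.range (m+1), c k * b (m - k))) (r m)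
    rw [abs_neg] at e3
    have e4 := hr m
    have e5 : R * s^m ≤ K * s^m := mul_le_mul_of_nonneg_right hKR (by positivity)
    nlinarith
  have hKR : R ≤ K1 := le_max_right _ _
  have st1 : ∀ m, |b m| ≤ K1 * L^m * s^m := by
    intro m
    induction m using Nat.strong_induction_on with
    | _ m ih =>
      cases m with
      | zero =>
        rw [pow_zero, pow_zero, mul_one, mul_one]
        exact hb.trans (le_max_left _ _)
      | succ m =>
        have hLm : 1 ≤ L^m := one_le_pow₀ hL1
        have := step (K1 * L^m) (by nlinarith) m (fun j hj => (ih j (by omega)).trans (by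
          refine mul_le_mul_of_nonneg_right ?_ (by positivity)
          exact mul_le_mul_of_nonneg_left (pow_le_pow_right₀ hL1 hj) hK10))
        have h1 : |b (m+1)| ≤ ((m:ℝ)+1) * |b (m+1)| := by
          have : (0:ℝ) ≤ m := by positivity
          nlinarith [abs_nonneg (b (m+1))]
        refine (h1.trans this).trans ?_
        have h2 : C' + 1 ≤ L * s := by rw [hL]; field_simp; linarith
        calc K1 * L^m * (C'+1) * s^m ≤ K1 * L^m * (L*s) * s^m := by gcongr
          _ = _ := by ring
  intro m
  induction m using Nat.strong_induction_on with
  | _ m ih =>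
    by_cases hm : m ≤ m0
    · refine (st1 m).trans (mul_le_mul_of_nonneg_right ?_ (by positivity))
      exact mul_le_mul_of_nonneg_left (pow_le_pow_right₀ hL1 hm) hK10
    · cases m with
      | zero => omega
      | succ m =>
        have hLm : 1 ≤ L^m0 := one_le_pow₀ hL1
        have := step (K1 * L^m0) (by nlinarith) m (fun j hj => ih j (by omega))
        have h3 : (C'+1)/s ≤ (m:ℝ)+1 := hm0.trans (by exact_mod_cast (by omega : m0 ≤ m+1))
        have h4 : C'+1 ≤ ((m:ℝ)+1) * s := (div_le_iff₀ hs0).1 h3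
        have h5 : ((m:ℝ)+1) * |b (m+1)| ≤ ((m:ℝ)+1) * (K1 * L^m0 * s^(m+1)) := by
          refine this.trans ?_
          calc K1 * L^m0 * (C'+1) * s^m ≤ K1 * L^m0 * (((m:ℝ)+1) * s) * s^m := by gcongr
            _ = _ := by ring
        exact le_of_mul_le_mul_left h5 (by positivity)

/-- shifted sequence -/
def shf (e : ℕ → ℝ) : ℕ → ℝ
  | 0 => 0
  | m+1 => e m

lemma dc_split (r : ℕ → ℝ) (lam : ℝ) (m : ℕ) :
    dc (fun k => r k + lam^(k+1)) m = dc r m - lam * shf (dc r) m := by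
  symm
  refine dc_unique _ (fun m => dc r m - lam * shf (dc r) m) (by simp [dc_zero, shf]) ?_ m
  intro m
  set e := dc r with he
  have h1 : ∀ m, ∑ k ∈ Finset.range (m+1), lam^(k+1) * (e (m-k) - lam * shf e (m-k)) = lam * e m := by
    intro m
    induction m with
    | zero => simp [shf]
    | succ m ih =>
      rw [Finset.sum_range_succ']
      have : ∑ k ∈ Finset.range (m+1), lam^(k+1+1) * (e (m+1-(k+1)) - lam * shf e (m+1-(k+1))) =
          lam * ∑ k ∈ Finset.range (m+1), lam^(k+1) * (e (m-k) - lam * shf e (m-k)) := by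
        rw [Finset.mul_sum]
        refine Finset.sum_congr rfl fun k _ => ?_
        rw [show m+1-(k+1) = m-k by omega]; ring
      rw [this, ih]
      simp [shf]
      ring
  have h2 : (m:ℝ) * e m = -∑ k ∈ Finset.range (m+1), r k * shf e (m-k) := by
    cases m with
    | zero => simp [shf]
    | succ m =>
      push_cast
      rw [he, dc_succ, Finset.sum_range_succ _ (m+1)]
      simp only [Nat.sub_self, shf, mul_zero, add_zero]
      congr 1
      refine Finset.sum_congr rfl fun k hk => ?_
      have : m + 1 - k = (m - k) + 1 := by have := Finset.mem_range.1 hk; omega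
      rw [this]
  have h3 := dc_succ r m
  rw [← he] at h3
  have h4 : ∑ k ∈ Finset.range (m+1), (r k + lam^(k+1)) * (e (m-k) - lam * shf e (m-k)) =
     (∑ k ∈ Finset.range (m+1), r k * e (m-k)) - lam * (∑ k ∈ Finset.range (m+1), r k * shf e (m-k)) +
      ∑ k ∈ Finset.range (m+1), lam^(k+1) * (e (m-k) - lam * shf e (m-k)) := by
    rw [Finset.mul_sum, ← Finset.sum_sub_distrib, ← Finset.sum_add_distrib]
    exact Finset.sum_congr rfl fun k _ => by ring
  rw [h4, h1]
  have h5 : shf e (m+1) = e m := rfl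
  simp only [h5]
  linear_combination h3 - lam * h2

/-- power series with geometric bounds -/
lemma ps_bound {a : ℕ → ℝ} {K s ρ : ℝ} (ha : ∀ m, |a m| ≤ K * s^m)
    (m : ℕ) {z : ℂ} (hz : z ∈ Metric.ball (0:ℂ) ρ) : ‖(a m : ℂ) * z^m‖ ≤ K * (s*ρ)^m := by
  have hz' : ‖z‖ ≤ ρ := (mem_ball_zero_iff.1 hz).le
  rw [norm_mul, norm_pow, Complex.norm_real, Real.norm_eq_abs, mul_pow, ← mul_assoc]
  have h1 : ‖z‖^m ≤ ρ^m := pow_le_pow_left₀ (norm_nonneg _) hz' m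
  exact mul_le_mul (ha m) h1 (by positivity) ((abs_nonneg _).trans (ha m))

lemma ps_sum {K s ρ : ℝ} (hs : 0 ≤ s) (hρ : 0 ≤ ρ) (h : s * ρ < 1) :
    Summable fun m : ℕ => K * (s*ρ)^m :=
  (summable_geometric_of_lt_one (mul_nonneg hs hρ) h).mul_left K

lemma ps_diff {a : ℕ → ℝ} {K s ρ : ℝ} (ha : ∀ m, |a m| ≤ K * s^m) (hs : 0 ≤ s) (hρ : 0 ≤ ρ)
    (h : s * ρ < 1) :
    DifferentiableOn ℂ (fun z : ℂ => ∑' m, (a m : ℂ) * z^m) (Metric.ball 0 ρ) :=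
  differentiableOn_tsum_of_summable_norm (ps_sum hs hρ h) (fun m => by fun_prop) Metric.isOpen_ball
    (fun m z hz => ps_bound ha m hz)

lemma ps_deriv {a : ℕ → ℝ} {K s ρ : ℝ} (ha : ∀ m, |a m| ≤ K * s^m) (hs : 0 ≤ s) (hρ : 0 ≤ ρ)
    (h : s * ρ < 1) {z : ℂ} (hz : z ∈ Metric.ball (0:ℂ) ρ) :
    HasSum (fun m : ℕ => ((m:ℂ)+1) * (a (m+1) : ℂ) * z^m) (deriv (fun z : ℂ => ∑' m, (a m : ℂ) * z^m) z) := by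
  have := hasSum_deriv_of_summable_norm (F := fun m (z : ℂ) => (a m : ℂ) * z^m) (ps_sum hs hρ h)
    (fun m => by fun_prop) Metric.isOpen_ball (fun m z hz => ps_bound ha m hz) hz
  have e : (fun m : ℕ => deriv (fun z : ℂ => (a m : ℂ) * z^m) z) = fun m : ℕ => (a m : ℂ) * (m * z^(m-1)) := by
    funext m; simp
  simp only [e] at this
  rw [← hasSum_nat_add_iff' 1] at this
  simp at this
  have e2 : (fun m : ℕ => ((m:ℂ)+1) * (a (m+1) : ℂ) * z^m) =
      fun n : ℕ => (a (n+1) : ℂ) * (((n:ℂ)+1) * z^n) := by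
    funext m; ring
  rw [e2]
  exact this

/-- the exponential formula -/
lemma dc_exp {c : ℕ → ℝ} {C ρ r : ℝ} (hC : 0 ≤ C) (hρ : 0 ≤ ρ) (hc : ∀ k, |c k| ≤ C * ρ^k) (hr : 0 < r)
    (hrr : ρ * r < 1) {z : ℂ} (hz : ‖z‖ < r) :
    ∑' m, (dc c m : ℂ) * z^m = Complex.exp (-∑' k : ℕ, (c k : ℂ) / ((k:ℂ)+1) * z^(k+1)) := by
  obtain ⟨s, hs1, hs2⟩ : ∃ s, ρ < s ∧ s * r < 1 := by
    have : ρ < 1 / r := by rwa [lt_div_iff₀ hr]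
    obtain ⟨s, h1, h2⟩ := exists_between this
    exact ⟨s, h1, (lt_div_iff₀ hr).1 h2⟩
  have hs0 : 0 ≤ s := hρ.trans hs1.le
  obtain ⟨K, hK, hb⟩ := rec_growth (K0 := 1) (R := 0) hC hρ hs1 zero_le_one le_rfl
  have ha : ∀ m, |dc c m| ≤ K * s^m := hb c (dc c) (fun _ => 0) hc (by simp [dc_zero]) (by simp)
    (by simpa using dc_succ c)
  -- the primitive
  set p : ℕ → ℝ := fun n => shf (fun k => c k / (k+1)) n with hp
  have hpb : ∃ K', 0 ≤ K' ∧ ∀ m, |p m| ≤ K' * s^m := by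
    have hs0' : 0 < s := hρ.trans_lt hs1
    refine ⟨C / s, by positivity, fun m => ?_⟩
    cases m with
    | zero => simp only [hp, shf, abs_zero]; positivity
    | succ k =>
      simp only [hp, shf]
      rw [abs_div, abs_of_pos (by positivity : (0:ℝ) < (k:ℝ)+1)]
      calc _ ≤ |c k| := div_le_self (abs_nonneg _) (by linarith [(Nat.cast_nonneg k : (0:ℝ) ≤ k)])
        _ ≤ C * ρ^k := hc k
        _ ≤ C * s^k := by gcongr
        _ = _ := by field_simp; ring
  obtain ⟨K', hK', hpb⟩ := hpb
  set f : ℂ → ℂ := fun z => ∑' m, (dc c m : ℂ) * z^m with hf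
  set P : ℂ → ℂ := fun z => ∑' m, (p m : ℂ) * z^m with hP
  have hfd := ps_diff ha hs0 hr.le hs2
  have hPd := ps_diff hpb hs0 hr.le hs2
  have key : ∀ w ∈ Metric.ball (0:ℂ) r, deriv f w = - deriv P w * f w := by
    intro w hw
    have h1 := ps_deriv ha hs0 hr.le hs2 hw
    have h2 := ps_deriv hpb hs0 hr.le hs2 hw
    have h2' : HasSum (fun m : ℕ => (c m : ℂ) * w^m) (deriv P w) := by
      convert h2 using 2 with m
      simp only [hp, shf]
      have : (m:ℂ) + 1 ≠ 0 := by exact_mod_cast Nat.succ_ne_zero m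
      push_cast
      field_simp
    have sc : Summable fun m : ℕ => ‖(c m : ℂ) * w^m‖ :=
      Summable.of_nonneg_of_le (fun _ => norm_nonneg _) (fun m => ps_bound hc m hw)
        (ps_sum hρ hr.le hrr)
    have sa : Summable fun m : ℕ => ‖(dc c m : ℂ) * w^m‖ :=
      Summable.of_nonneg_of_le (fun _ => norm_nonneg _) (fun m => ps_bound ha m hw)
        (ps_sum hs0 hr.le hs2)
    have h3 := tsum_mul_tsum_eq_tsum_sum_range_of_summable_norm sc sa
    rw [← h2'.tsum_eq, ← h1.tsum_eq, neg_mul, hf, h3, ← tsum_neg]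
    congr 1
    funext m
    have h4 := dc_succ c m
    have h5 : ((m:ℂ)+1) * (dc c (m+1) : ℂ) = -∑ k ∈ Finset.range (m+1), (c k : ℂ) * (dc c (m-k) : ℂ) := by
      exact_mod_cast congrArg (fun x : ℝ => (x : ℂ)) h4
    rw [h5, neg_mul, Finset.sum_mul]
    congr 1
    refine Finset.sum_congr rfl fun k hk => ?_
    have : w^m = w^k * w^(m-k) := by
      rw [← pow_add]; congr 1; have := Finset.mem_range.1 hk; omega
    rw [this]; ring
  have hconst : ∀ w ∈ Metric.ball (0:ℂ) r, f w * Complex.exp (P w) = f 0 * Complex.exp (P 0) := by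
    intro w hw
    refine Convex.is_const_of_fderivWithin_eq_zero (𝕜 := ℂ) (f := fun w => f w * Complex.exp (P w))
      (convex_ball (0:ℂ) r) (hfd.mul hPd.cexp) ?_ hw (Metric.mem_ball_self hr)
    intro x hx
    rw [fderivWithin_of_isOpen Metric.isOpen_ball hx]
    have d1 : HasDerivAt f (deriv f x) x :=
      (hfd.differentiableAt (Metric.isOpen_ball.mem_nhds hx)).hasDerivAt
    have d2 : HasDerivAt P (deriv P x) x :=
      (hPd.differentiableAt (Metric.isOpen_ball.mem_nhds hx)).hasDerivAt
    have d3 : HasDerivAt (fun w => f w * Complex.exp (P w)) _ x := d1.mul d2.cexp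
    have e : deriv f x * Complex.exp (P x) + f x * (Complex.exp (P x) * deriv P x) = 0 := by
      rw [key x hx]; ring
    rw [e] at d3
    ext
    simpa using congrArg (fun L => L 1) d3.hasFDerivAt.fderiv
  have hz' : z ∈ Metric.ball (0:ℂ) r := mem_ball_zero_iff.2 hz
  have f0 : f 0 = 1 := by
    simp only [hf]
    rw [tsum_eq_single 0 (fun m hm => by simp [hm])]
    simp [dc_zero]
  have P0 : P 0 = 0 := by
    simp only [hP]
    rw [tsum_eq_single 0 (fun m hm => by simp [hm])]
    simp [hp, shf]
  have h6 := hconst z hz'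
  rw [f0, P0, Complex.exp_zero, mul_one] at h6
  have hPz : P z = ∑' k : ℕ, (c k : ℂ) / ((k:ℂ)+1) * z^(k+1) := by
    have sp : Summable fun m : ℕ => (p m : ℂ) * z^m :=
      Summable.of_norm_bounded (ps_sum hs0 hr.le hs2) (fun m => ps_bound hpb m hz')
    simp only [hP]
    rw [sp.tsum_eq_zero_add]
    simp [hp, shf]
  rw [← hPz, Complex.exp_neg]
  exact eq_inv_of_mul_eq_one_left h6

end PV


namespace PV

lemma WB.contDiff {ι : Type*} {w f : ι → V → ℝ} {n : ℕ} (H : WB w n f) (i : ι) :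
    ContDiff ℝ n (f i) := by
  induction n generalizing f with
  | zero => exact contDiff_zero.2 (H.1 i)
  | succ n ih =>
    obtain ⟨h0, f1, f2, h1, h2, hd⟩ := H
    push_cast
    refine contDiff_succ_iff_hasFDerivAt.2 ⟨fun v => LF (f1 i v) (f2 i v), ?_, fun v => hd i v⟩
    unfold LF
    exact ((ih h1).smul contDiff_const).add ((ih h2).smul contDiff_const)

lemma WB.of_derivs {ι : Type*} {w f : ι → V → ℝ} {n : ℕ} (h0 : WB0 w f)
    (hd : ∀ i, Differentiable ℝ (f i))
    (h1 : WB w n (fun i v => fderiv ℝ (f i) v (1,0))) (h2 : WB w n (fun i v => fderiv ℝ (f i) v (0,1))) :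
    WB w (n+1) f :=
  ⟨h0, _, _, h1, h2, fun i v => by
    have := (hd i v).hasFDerivAt
    rwa [LF_eq (fderiv ℝ (f i) v)] at this⟩

lemma WB.derivs {ι : Type*} {w f : ι → V → ℝ} {n : ℕ} (H : WB w (n+1) f) :
    (∀ i, Differentiable ℝ (f i)) ∧
    WB w n (fun i v => fderiv ℝ (f i) v (1,0)) ∧ WB w n (fun i v => fderiv ℝ (f i) v (0,1)) := by
  obtain ⟨h0, f1, f2, h1, h2, hd⟩ := H
  refine ⟨fun i v => (hd i v).differentiableAt, h1.congr fun i v => ?_, h2.congr fun i v => ?_⟩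
  · rw [(hd i v).fderiv, LF_apply]; simp
  · rw [(hd i v).fderiv, LF_apply]; simp

lemma geom_conv {ρ s : ℝ} (hρ : 0 ≤ ρ) (hs : ρ < s) (m : ℕ) :
    ∑ k ∈ Finset.range (m+1), ρ^k * s^(m-k) ≤ (1 - ρ/s)⁻¹ * s^m := by
  have hs0 : 0 < s := hρ.trans_lt hs
  have hq0 : 0 ≤ ρ/s := div_nonneg hρ hs0.le
  have hq1 : ρ/s < 1 := (div_lt_one hs0).2 hs
  have : ∀ k ∈ Finset.range (m+1), ρ^k * s^(m-k) = (ρ/s)^k * s^m := by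
    intro k hk
    have : s^m = s^(m-k) * s^k := by
      rw [← pow_add]; congr 1; have := Finset.mem_range.1 hk; omega
    rw [this, div_pow]; field_simp
  rw [Finset.sum_congr rfl this, ← Finset.sum_mul]
  refine mul_le_mul_of_nonneg_right ?_ (by positivity)
  rw [← tsum_geometric_of_lt_one hq0 hq1]
  exact (summable_geometric_of_lt_one hq0 hq1).sum_le_tsum _ (fun i _ => by positivity)

lemma rec_contDiff {n : WithTop ℕ∞} {c b r : ℕ → V → ℝ} (hc : ∀ k, ContDiff ℝ n (c k))
    (hr : ∀ k, ContDiff ℝ n (r k)) (hb : ContDiff ℝ n (b 0))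
    (hrec : ∀ (m : ℕ) v, ((m:ℝ)+1) * b (m+1) v =
      -(∑ k ∈ Finset.range (m+1), c k v * b (m - k) v) + r m v) (m : ℕ) : ContDiff ℝ n (b m) := by
  induction m using Nat.strong_induction_on with
  | _ m ih =>
    cases m with
    | zero => exact hb
    | succ m =>
      have e : b (m+1) = fun v => ((m:ℝ)+1)⁻¹ *
          (-(∑ k ∈ Finset.range (m+1), c k v * b (m - k) v) + r m v) := by
        funext v
        rw [← hrec]
        have : (m:ℝ)+1 ≠ 0 := by positivity
        field_simp
      rw [e]
      refine contDiff_const.mul (ContDiff.add (ContDiff.neg ?_) (hr m))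
      exact ContDiff.sum fun k _ => (hc k).mul (ih (m-k) (by omega))

/-- convolutions -/
lemma WB.conv {n : ℕ} {c b : ℕ → V → ℝ} {ρ s : ℝ} (hρ : 0 ≤ ρ) (hs : ρ < s)
    (hc : WB (fun k _ => ρ^k) n c) (hb : WB (fun m _ => s^m) n b) :
    WB (fun m _ => s^m) n (fun (m : ℕ) v => ∑ k ∈ Finset.range (m+1), c k v * b (m-k) v) := by
  have h1 := hc.reindex (fun p : ℕ × ℕ => p.2)
  have h2 := hb.reindex (fun p : ℕ × ℕ => p.1 - p.2)
  have h3 := (h1.mul h2).sum (fun m => Finset.range (m+1))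
  have hq1 : ρ/s < 1 := (div_lt_one (hρ.trans_lt hs)).2 hs
  exact h3.mono (K := (1 - ρ/s)⁻¹) (fun m v => geom_conv hρ hs m) (inv_nonneg.2 (by linarith))

lemma fderiv_rec {c b r : ℕ → V → ℝ} (hc : ∀ k, Differentiable ℝ (c k))
    (hr : ∀ k, Differentiable ℝ (r k)) (hb : ∀ k, Differentiable ℝ (b k))
    (hrec : ∀ (m : ℕ) v, ((m:ℝ)+1) * b (m+1) v =
      -(∑ k ∈ Finset.range (m+1), c k v * b (m - k) v) + r m v) (e : V) (m : ℕ) (v : V) :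
    ((m:ℝ)+1) * fderiv ℝ (b (m+1)) v e =
      -(∑ k ∈ Finset.range (m+1), c k v * fderiv ℝ (b (m - k)) v e) +
      (fderiv ℝ (r m) v e - ∑ k ∈ Finset.range (m+1), fderiv ℝ (c k) v e * b (m-k) v) := by
  have h1 : HasFDerivAt (fun v => ((m:ℝ)+1) * b (m+1) v) (((m:ℝ)+1) • fderiv ℝ (b (m+1)) v) v :=
    (hb (m+1) v).hasFDerivAt.const_mul _
  have h2 : HasFDerivAt (fun v => -(∑ k ∈ Finset.range (m+1), c k v * b (m - k) v) + r m v)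
      (-(∑ k ∈ Finset.range (m+1), (c k v • fderiv ℝ (b (m-k)) v + b (m-k) v • fderiv ℝ (c k) v)) +
        fderiv ℝ (r m) v) v := by
    refine HasFDerivAt.add (HasFDerivAt.neg ?_) (hr m v).hasFDerivAt
    exact HasFDerivAt.fun_sum fun k _ => (hc k v).hasFDerivAt.mul (hb (m-k) v).hasFDerivAt
  have h3 : (fun v => ((m:ℝ)+1) * b (m+1) v) =
    (fun v => -(∑ k ∈ Finset.range (m+1), c k v * b (m - k) v) + r m v) := funext (hrec m)
  rw [h3] at h1
  have h4 := congrArg (fun L : V →L[ℝ] ℝ => L e) (h1.unique h2)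
  simp only [add_apply, smul_apply, neg_apply, sum_apply, smul_eq_mul] at h4
  rw [h4, Finset.sum_add_distrib]
  have h5 : ∀ k, b (m-k) v * fderiv ℝ (c k) v e = fderiv ℝ (c k) v e * b (m-k) v := fun k => mul_comm _ _
  simp only [h5]
  ring

lemma WB.recur {n : ℕ} {c b r : ℕ → V → ℝ} {ρ s : ℝ} (hρ : 0 ≤ ρ) (hs : ρ < s)
    (hc : WB (fun k _ => ρ^k) n c) (hr : WB (fun m _ => s^m) n r)
    (hb : WB (fun _ _ => 1) n (fun (_ : Unit) => b 0))
    (hrec : ∀ (m : ℕ) v, ((m:ℝ)+1) * b (m+1) v =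
      -(∑ k ∈ Finset.range (m+1), c k v * b (m - k) v) + r m v) :
    WB (fun m _ => s^m) n b := by
  induction n generalizing b r with
  | zero =>
    have hcd := rec_contDiff (n := ((0:ℕ):WithTop ℕ∞)) (fun k => hc.contDiff k) (fun k => hr.contDiff k) (hb.contDiff ()) hrec
    obtain ⟨_, C, hC, hc'⟩ := hc
    obtain ⟨_, R, hR, hr'⟩ := hr
    obtain ⟨_, K0, hK0, hb'⟩ := hb
    obtain ⟨K, hK, h⟩ := rec_growth hC hρ hs hK0 hR
    refine ⟨fun m => (hcd m).continuous, K, hK, fun m v => ?_⟩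
    exact h (fun k => c k v) (fun k => b k v) (fun k => r k v) (fun k => hc' k v)
      (by simpa using hb' () v) (fun k => hr' k v) (fun m => hrec m v) m
  | succ n ih =>
    have hcd := rec_contDiff (fun k => hc.contDiff k) (fun k => hr.contDiff k) (hb.contDiff ()) hrec
    have hbn := ih hc.pred hr.pred hb.pred hrec
    obtain ⟨dc1, dc2, dc3⟩ := hc.derivs
    obtain ⟨dr1, dr2, dr3⟩ := hr.derivs
    obtain ⟨db1, db2, db3⟩ := hb.derivs
    have hbd : ∀ k, Differentiable ℝ (b k) := fun k => (hcd k).differentiable (by simp)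
    refine WB.of_derivs hbn.zero hbd ?_ ?_
    · exact ih hc.pred (dr2.sub (WB.conv hρ hs dc2 hbn)) db2 (fderiv_rec dc1 dr1 hbd hrec _)
    · exact ih hc.pred (dr3.sub (WB.conv hρ hs dc3 hbn)) db3 (fderiv_rec dc1 dr1 hbd hrec _)

/-- one-dimensional Landau inequality -/
lemma landau1 {φ φ1 φ2 : ℝ → ℝ} {A B h : ℝ} (hh : 0 < h) (h1 : ∀ x, HasDerivAt φ (φ1 x) x)
    (h2 : ∀ x, HasDerivAt φ1 (φ2 x) x) (hA : ∀ x, |φ x| ≤ A) (hB : ∀ x, |φ2 x| ≤ B) (x : ℝ) :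
    |φ1 x| ≤ 2 * A / h + B * h := by
  obtain ⟨ξ, hξ, he⟩ := exists_hasDerivAt_eq_slope φ φ1 (show x < x + h by linarith)
    (fun y _ => (h1 y).continuousAt.continuousWithinAt) (fun y _ => h1 y)
  have h3 : |φ1 x - φ1 ξ| ≤ B * |x - ξ| := by
    have := Convex.norm_image_sub_le_of_norm_hasDerivWithin_le (f := φ1) (f' := φ2) (C := B) (s := univ)
      (fun y _ => (h2 y).hasDerivWithinAt) (fun y _ => hB y) convex_univ (mem_univ ξ) (mem_univ x)
    simpa using this
  have hB0 : 0 ≤ B := (abs_nonneg _).trans (hB 0)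
  have h4 : |x - ξ| ≤ h := by rw [abs_le]; constructor <;> linarith [hξ.1, hξ.2]
  have h5 : |φ1 ξ| ≤ 2 * A / h := by
    rw [he, add_sub_cancel_left, abs_div, abs_of_pos hh]
    gcongr
    have := abs_sub (φ (x+h)) (φ x)
    linarith [hA (x+h), hA x]
  have h6 : φ1 x = φ1 ξ + (φ1 x - φ1 ξ) := by ring
  calc |φ1 x| ≤ |φ1 ξ| + |φ1 x - φ1 ξ| := by rw [h6]; simpa using abs_add_le (φ1 ξ) (φ1 x - φ1 ξ)
    _ ≤ _ := add_le_add h5 (h3.trans (mul_le_mul_of_nonneg_left h4 hB0))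

/-- Landau inequality for weighted families, first derivatives -/
lemma landau_step {s ρ s' : ℝ} (hs : 0 < s) (hρ : 0 ≤ ρ) (hs' : √s * ρ ≤ s') (hss : √s ≤ s')
    {f f1 f1d : ℕ → V → ℝ} {e : V}
    (hf : WB0 (fun m _ => s^m) f)
    (hd : ∀ m v, HasFDerivAt (f m) (fderiv ℝ (f m) v) v) (hfe : ∀ m v, fderiv ℝ (f m) v e = f1 m v)
    (hf1 : ∀ m, Differentiable ℝ (f1 m))
    (hfd : ∀ m v, fderiv ℝ (f1 m) v e = f1d m v) (hB : WB0 (fun m _ => ρ^m) f1d) :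
    WB0 (fun m _ => s'^m) f1 := by
  obtain ⟨_, A, hA, hA'⟩ := hf
  obtain ⟨_, B, hB, hB'⟩ := hB
  have hq : 0 < √s := Real.sqrt_pos.2 hs
  refine ⟨fun m => (hf1 m).continuous, 2 * A + B, by positivity, fun m v => ?_⟩
  have line : ∀ t : ℝ, HasDerivAt (fun t : ℝ => v + t • e) e t := fun t => by
    simpa using ((hasDerivAt_id t).smul_const e).const_add v
  have h1 : ∀ t : ℝ, HasDerivAt (fun t : ℝ => f m (v + t • e)) (f1 m (v + t • e)) t := fun t => by
    have := (hd m (v + t • e)).comp_hasDerivAt t (line t)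
    rw [hfe] at this; exact this
  have h2 : ∀ t : ℝ, HasDerivAt (fun t : ℝ => f1 m (v + t • e)) (f1d m (v + t • e)) t := fun t => by
    have := ((hf1 m) (v + t • e)).hasFDerivAt.comp_hasDerivAt t (line t)
    rw [hfd] at this; exact this
  have h3 := landau1 (h := (√s)^m) (by positivity) h1 h2 (fun t => hA' m _) (fun t => hB' m _) 0
  simp only [zero_smul, add_zero] at h3
  refine h3.trans ?_
  have e1 : s^m = (√s)^m * (√s)^m := by rw [← mul_pow, Real.mul_self_sqrt hs.le]
  have e2 : 2 * (A * s^m) / (√s)^m = 2 * A * (√s)^m := by rw [e1]; field_simp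
  have e3 : B * ρ^m * (√s)^m = B * (√s*ρ)^m := by rw [mul_pow]; ring
  rw [e2, e3]
  show _ ≤ (2 * A + B) * s'^m
  rw [add_mul]
  gcongr

lemma WB.landau (n : ℕ) (s : ℝ) (hs : 0 < s) (hs1 : s < 1) :
    ∃ ρ t : ℝ, 1 < ρ ∧ 0 < t ∧ t < 1 ∧ ∀ f : ℕ → V → ℝ, WB (fun m _ => ρ^m) (n+1) f →
      WB0 (fun m _ => s^m) f → WB (fun m _ => t^m) n f := by
  induction n generalizing s with
  | zero => exact ⟨2, s, by norm_num, hs, hs1, fun f _ h => h⟩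
  | succ n ih =>
    have hq : 0 < √s := Real.sqrt_pos.2 hs
    have hq1 : √s < 1 := by rw [Real.sqrt_lt' one_pos]; simpa using hs1
    obtain ⟨s', hs1', hs2'⟩ := exists_between hq1
    have hs0' : 0 < s' := hq.trans hs1'
    obtain ⟨ρ', t', hρ', ht0, ht1, H⟩ := ih s' hs0' hs2'
    have h1 : 1 < s' / √s := (one_lt_div hq).2 hs1'
    have hρ1 : 1 < min ρ' (s' / √s) := lt_min hρ' h1
    refine ⟨min ρ' (s' / √s), max t' s, hρ1, lt_max_of_lt_left ht0, max_lt ht1 hs1, ?_⟩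
    set ρ := min ρ' (s' / √s)
    intro f hf hf0
    have hle : √s * ρ ≤ s' := by
      have : ρ ≤ s' / √s := min_le_right _ _
      rw [le_div_iff₀ hq] at this; linarith
    obtain ⟨d1, d2, d3⟩ := hf.derivs
    obtain ⟨d11, d12, d13⟩ := d2.derivs
    obtain ⟨d21, d22, d23⟩ := d3.derivs
    have mono1 : ∀ g : ℕ → V → ℝ, WB (fun m _ => ρ^m) (n+1) g → WB (fun m _ => ρ'^m) (n+1) g := fun g hg =>
      hg.mono (K := 1) (fun m v => by
        rw [one_mul]; exact pow_le_pow_left₀ (by linarith) (min_le_left _ _) m) zero_le_one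
    have mono2 : ∀ g : ℕ → V → ℝ, WB (fun m _ => t'^m) n g → WB (fun m _ => (max t' s)^m) n g := fun g hg =>
      hg.mono (K := 1) (fun m v => by
        rw [one_mul]; exact pow_le_pow_left₀ ht0.le (le_max_left _ _) m) zero_le_one
    refine WB.of_derivs ?_ d1 ?_ ?_
    · exact hf0.mono (K := 1) (fun m v => by
        rw [one_mul]; exact pow_le_pow_left₀ hs.le (le_max_right _ _) m) zero_le_one
    · refine mono2 _ (H _ (mono1 _ d2) ?_)
      exact landau_step hs (by linarith) hle hs1'.le hf0 (fun m v => (d1 m v).hasFDerivAt)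
        (fun m v => rfl) d11 (fun m v => rfl) d12.zero
    · refine mono2 _ (H _ (mono1 _ d3) ?_)
      exact landau_step hs (by linarith) hle hs1'.le hf0 (fun m v => (d1 m v).hasFDerivAt)
        (fun m v => rfl) d21 (fun m v => rfl) d23.zero

end PV


namespace PV

/-- coordinate forms -/
def lz : ℂ × V →L[ℝ] ℂ := ContinuousLinearMap.fst ℝ ℂ V
def l1 : ℂ × V →L[ℝ] ℂ :=
  Complex.ofRealCLM.comp ((ContinuousLinearMap.fst ℝ ℝ ℝ).comp (ContinuousLinearMap.snd ℝ ℂ V))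
def l2 : ℂ × V →L[ℝ] ℂ :=
  Complex.ofRealCLM.comp ((ContinuousLinearMap.snd ℝ ℝ ℝ).comp (ContinuousLinearMap.snd ℝ ℂ V))

/-- the power series of a family -/
def PS (a : ℕ → V → ℝ) (p : ℂ × V) : ℂ := ∑' m, (a m p.2 : ℂ) * p.1^m

/-- derivative coefficients -/
def dz (a : ℕ → V → ℝ) (m : ℕ) (v : V) : ℝ := ((m:ℝ)+1) * a (m+1) v

lemma lin_geom {s t : ℝ} (hs : 0 < s) (hst : s < t) : ∃ K, 0 ≤ K ∧ ∀ m : ℕ, ((m:ℝ)+1) * s^(m+1) ≤ K * t^m := by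
  have ht : 0 < t := hs.trans hst
  have h0 : Tendsto (fun m : ℕ => (m:ℝ) * (s/t)^m) atTop (𝓝 0) := by
    exact tendsto_self_mul_const_pow_of_lt_one (div_nonneg hs.le ht.le) ((div_lt_one ht).2 hst)
  obtain ⟨K, hK⟩ := h0.bddAbove_range
  have hK' : ∀ m : ℕ, (m:ℝ) * (s/t)^m ≤ K := fun m => hK ⟨m, rfl⟩
  have hK0 : 0 ≤ K := by simpa using hK' 0
  refine ⟨K * t, by positivity, fun m => ?_⟩
  have := hK' (m+1)
  rw [div_pow, ← mul_div_assoc, div_le_iff₀ (by positivity)] at this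
  push_cast at this
  calc _ ≤ K * t^(m+1) := this
    _ = _ := by ring

lemma WB.dz {n : ℕ} {a : ℕ → V → ℝ} {s t : ℝ} (hs : 0 < s) (hst : s < t) (h : WB (fun m _ => s^m) n a) :
    WB (fun m _ => t^m) n (PV.dz a) := by
  have h1 := (h.reindex (fun m : ℕ => m+1)).cmul (fun m : ℕ => (m:ℝ)+1)
  obtain ⟨K, hK, hb⟩ := lin_geom hs hst
  refine h1.mono (K := K) (fun m v => ?_) hK
  rw [abs_of_pos (by positivity : (0:ℝ) < (m:ℝ)+1)]
  exact hb m

lemma PS.term_bound {a : ℕ → V → ℝ} {C s R : ℝ} (hb : ∀ m v, |a m v| ≤ C * s^m) (m : ℕ) {p : ℂ × V}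
    (hp : p ∈ Metric.ball (0:ℂ) R ×ˢ (univ : Set V)) : ‖(a m p.2 : ℂ) * p.1^m‖ ≤ C * (s*R)^m :=
  ps_bound (a := fun m => a m p.2) (fun m => hb m p.2) m hp.1

lemma PS.hasSum {a : ℕ → V → ℝ} {s R : ℝ} (h : WB0 (fun m _ => s^m) a) (hs : 0 < s) (hR : 0 < R)
    (hsR : s * R < 1) {p : ℂ × V} (hp : p ∈ Metric.ball (0:ℂ) R ×ˢ (univ : Set V)) :
    HasSum (fun m => (a m p.2 : ℂ) * p.1^m) (PS a p) := by
  obtain ⟨hc, C, hC, hb⟩ := h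
  exact (Summable.of_norm_bounded (ps_sum (K := C) hs.le hR.le hsR)
    (fun m => PS.term_bound hb m hp)).hasSum

/-- derivative of a term -/
def tD (a : ℕ → V → ℝ) (m : ℕ) (p : ℂ × V) : ℂ × V →L[ℝ] ℂ :=
  ((a m p.2 : ℂ) * (m * p.1^(m-1))) • lz +
      ((fderiv ℝ (a m) p.2 (1,0) : ℂ) * p.1^m) • l1 + ((fderiv ℝ (a m) p.2 (0,1) : ℂ) * p.1^m) • l2

lemma PS.term_deriv {a : ℕ → V → ℝ} (m : ℕ) (hd : Differentiable ℝ (a m)) (q : ℂ × V) :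
    HasFDerivAt (fun p : ℂ × V => (a m p.2 : ℂ) * p.1^m) (tD a m q) q := by
  have ha : HasFDerivAt (fun q : ℂ × V => (a m q.2 : ℂ))
      (Complex.ofRealCLM.comp ((fderiv ℝ (a m) q.2).comp (ContinuousLinearMap.snd ℝ ℂ V))) q :=
    Complex.ofRealCLM.hasFDerivAt.comp q (((hd q.2).hasFDerivAt).comp q hasFDerivAt_snd)
  have hzz : HasFDerivAt (fun q : ℂ × V => q.1^m) (((m:ℂ) * q.1^(m-1)) • lz) q := by
    have h3 := (hasDerivAt_pow m q.1).hasFDerivAt.restrictScalars ℝ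
    have := h3.comp q (hasFDerivAt_fst (𝕜 := ℝ) (p := q))
    refine HasFDerivAt.congr_fderiv this ?_
    ext v <;> simp [lz, mul_comm]
  have h5 := ha.mul hzz
  refine HasFDerivAt.congr_fderiv h5 ?_
  unfold tD
  rw [LF_eq (fderiv ℝ (a m) q.2)]
  refine ContinuousLinearMap.ext fun v => ?_
  simp [lz, l1, l2, LF_apply]
  ring

lemma PS.term_dbound {a : ℕ → V → ℝ} {s R C C1 C2 : ℝ} (hR : 0 < R) (hC : 0 ≤ C) (hs : 0 < s)
    (hb : ∀ m v, |a m v| ≤ C * s^m) (hb1 : ∀ m v, |fderiv ℝ (a m) v (1,0)| ≤ C1 * s^m)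
    (hb2 : ∀ m v, |fderiv ℝ (a m) v (0,1)| ≤ C2 * s^m) (m : ℕ) {q : ℂ × V}
    (hq : q ∈ Metric.ball (0:ℂ) R ×ˢ (univ : Set V)) :
    ‖tD a m q‖ ≤ (C/R) * (m^1 * (s*R)^m) * ‖lz‖ + C1 * (s*R)^m * ‖l1‖ + C2 * (s*R)^m * ‖l2‖ := by
  have hq' : ‖q.1‖ ≤ R := (mem_ball_zero_iff.1 hq.1).le
  refine (norm_add_le _ _).trans (add_le_add ((norm_add_le _ _).trans (add_le_add ?_ ?_)) ?_)
  · rw [norm_smul]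
    refine mul_le_mul_of_nonneg_right ?_ (norm_nonneg _)
    rw [norm_mul, norm_mul, norm_pow, Complex.norm_real, Real.norm_eq_abs, Complex.norm_natCast]
    have e1 : (m:ℝ) * ‖q.1‖^(m-1) ≤ m * R^(m-1) :=
      mul_le_mul_of_nonneg_left (pow_le_pow_left₀ (norm_nonneg _) hq' _) (by positivity)
    have e2 : (m:ℝ) * R^(m-1) = m * R^m / R := by
      cases m with
      | zero => simp
      | succ k => simp; field_simp; ring
    calc |a m q.2| * (m * ‖q.1‖^(m-1)) ≤ (C * s^m) * (m * R^(m-1)) :=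
          mul_le_mul (hb m q.2) e1 (by positivity) (by positivity)
      _ = _ := by rw [e2, mul_pow]; field_simp
  · rw [norm_smul]
    exact mul_le_mul_of_nonneg_right (PS.term_bound hb1 m hq) (norm_nonneg _)
  · rw [norm_smul]
    exact mul_le_mul_of_nonneg_right (PS.term_bound hb2 m hq) (norm_nonneg _)

lemma PS.tD_sum {a : ℕ → V → ℝ} {s R : ℝ} (h : WB (fun m _ => s^m) 1 a) (hs : 0 < s) (hR : 0 < R)
    (hsR : s * R < 1) {p : ℂ × V} (hp : p ∈ Metric.ball (0:ℂ) R ×ˢ (univ : Set V)) :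
    (∑' m, tD a m p) = PS (PV.dz a) p • lz + PS (fun m v => fderiv ℝ (a m) v (1,0)) p • l1 +
      PS (fun m v => fderiv ℝ (a m) v (0,1)) p • l2 := by
  obtain ⟨hd, h1, h2⟩ := h.derivs
  have h0 := h.zero
  obtain ⟨t, hst, htR⟩ : ∃ t, s < t ∧ t * R < 1 := by
    have : s < 1 / R := by rwa [lt_div_iff₀ hR]
    obtain ⟨t, h1, h2⟩ := exists_between this
    exact ⟨t, h1, (lt_div_iff₀ hR).1 h2⟩
  have hz := PS.hasSum (h.dz hs hst).zero (hs.trans hst) hR htR hp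
  have s1 := PS.hasSum h1.zero hs hR hsR hp
  have s2 := PS.hasSum h2.zero hs hR hsR hp
  have hz' : HasSum (fun m : ℕ => (a m p.2 : ℂ) * (m * p.1^(m-1))) (PS (PV.dz a) p) := by
    rw [← hasSum_nat_add_iff' 1]
    simp only [Finset.range_one, Finset.sum_singleton, Nat.cast_zero, zero_mul, mul_zero, sub_zero]
    have e : (fun m : ℕ => (PV.dz a m p.2 : ℂ) * p.1^m) =
        fun m : ℕ => (a (m+1) p.2 : ℂ) * (((m+1:ℕ):ℂ) * p.1^(m+1-1)) := by
      funext m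
      simp only [PV.dz]
      rw [Nat.add_sub_cancel]
      push_cast
      ring
    rw [← e]; exact hz
  have e := ((hz'.smul_const lz).add (s1.smul_const l1)).add (s2.smul_const l2)
  exact e.tsum_eq

lemma PS.hasFDerivAt {a : ℕ → V → ℝ} {s R : ℝ} (h : WB (fun m _ => s^m) 1 a) (hs : 0 < s) (hR : 0 < R)
    (hsR : s * R < 1) {p : ℂ × V} (hp : p ∈ Metric.ball (0:ℂ) R ×ˢ (univ : Set V)) :
    HasFDerivAt (PS a) (PS (PV.dz a) p • lz + PS (fun m v => fderiv ℝ (a m) v (1,0)) p • l1 +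
      PS (fun m v => fderiv ℝ (a m) v (0,1)) p • l2) p := by
  refine HasFDerivAt.congr_fderiv ?_ (PS.tD_sum h hs hR hsR hp)
  obtain ⟨hd, h1, h2⟩ := h.derivs
  have h0 := h.zero
  have s0 := PS.hasSum h0 hs hR hsR hp
  obtain ⟨_, C, hC, hb⟩ := h0
  obtain ⟨_, C1, hC1, hb1⟩ := h1.zero
  obtain ⟨_, C2, hC2, hb2⟩ := h2.zero
  have hsR0 : 0 ≤ s * R := by positivity
  have hu : Summable (fun m : ℕ => (C/R) * ((m:ℝ)^1 * (s*R)^m) * ‖lz‖ + C1 * (s*R)^m * ‖l1‖ +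
      C2 * (s*R)^m * ‖l2‖) := by
    refine ((Summable.mul_right _ (Summable.mul_left _ ?_)).add ((ps_sum hs.le hR.le hsR).mul_right _)).add
      ((ps_sum hs.le hR.le hsR).mul_right _)
    exact summable_pow_mul_geometric_of_norm_lt_one 1 (by rwa [Real.norm_of_nonneg hsR0])
  have key := hasFDerivAt_tsum_of_isPreconnected (𝕜 := ℝ) (x₀ := p) (x := p)
    (s := Metric.ball (0:ℂ) R ×ˢ (univ : Set V))
    (f := fun (m : ℕ) (p : ℂ × V) => (a m p.2 : ℂ) * p.1^m)
    (f' := tD a) hu (Metric.isOpen_ball.prod isOpen_univ)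
    ((convex_ball (0:ℂ) R).isPreconnected.prod isPreconnected_univ)
    (fun m q _ => PS.term_deriv m (hd m) q)
    (fun m q hq => PS.term_dbound hR hC hs hb hb1 hb2 m hq) hp s0.summable hp
  exact key

lemma PS.contDiffOn {n : ℕ} {a : ℕ → V → ℝ} {s R : ℝ} (h : WB (fun m _ => s^m) n a) (hs : 0 < s)
    (hR : 0 < R) (hsR : s * R < 1) :
    ContDiffOn ℝ n (PS a) (Metric.ball (0:ℂ) R ×ˢ (univ : Set V)) := by
  induction n generalizing a s with
  | zero =>
    obtain ⟨hc, C, hC, hb⟩ := h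
    refine contDiffOn_zero.2 (continuousOn_tsum (fun m => ?_) (ps_sum (K := C) hs.le hR.le hsR)
      (fun m p hp => PS.term_bound hb m hp))
    have := hc m
    fun_prop
  | succ n ih =>
    obtain ⟨hd, h1, h2⟩ := h.derivs
    obtain ⟨t, hst, htR⟩ : ∃ t, s < t ∧ t * R < 1 := by
      have : s < 1 / R := by rwa [lt_div_iff₀ hR]
      obtain ⟨t, h1, h2⟩ := exists_between this
      exact ⟨t, h1, (lt_div_iff₀ hR).1 h2⟩
    have ho : IsOpen (Metric.ball (0:ℂ) R ×ˢ (univ : Set V)) := Metric.isOpen_ball.prod isOpen_univ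
    push_cast
    refine (contDiffOn_succ_iff_hasFDerivWithinAt_of_uniqueDiffOn ho.uniqueDiffOn).2
      ⟨by simp, _, ?_, fun p hp => (PS.hasFDerivAt (h.le (by omega)) hs hR hsR hp).hasFDerivWithinAt⟩
    have hl : ∀ (l : ℂ × V →L[ℝ] ℂ) {F : ℂ × V → ℂ} {S : Set (ℂ × V)}, ContDiffOn ℝ n F S →
        ContDiffOn ℝ n (fun p => F p • l) S := fun l F S hF =>
      ((ContinuousLinearMap.lsmul ℝ ℂ).flip l).contDiff.comp_contDiffOn hF
    refine ((hl _ ?_).add (hl _ ?_)).add (hl _ ?_)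
    · exact ih (h.pred.dz hs hst) (hs.trans hst) htR
    · exact ih h1 hs hsR
    · exact ih h2 hs hsR

end PV


namespace PV

/-- spectral data of the coefficients for one map and all small `u` -/
structure SD (T g : ℝ → ℝ) (η C θ M D : ℝ) : Prop where
  fin : ∀ n : ℕ, n ≠ 0 → (periodicPtsIn T n).Finite
  lam : ∀ u, |u| ≤ η → ∃ lam, 0 < lam ∧ (∀ n : ℕ, n ≠ 0 → |cR T g u n - lam ^ n| ≤ C * θ ^ n) ∧
    lam ≤ Real.exp (|u| * M) ∧ Real.exp (-(|u| * M)) ≤ lam ∧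
    ∀ n : ℕ, ∫ (x : ℝ) in 0..1, Real.exp (-u * birkhoff T g n x) ≤ D * lam ^ n

lemma poly_geom (N : ℕ) {s t : ℝ} (hs : 0 < s) (hst : s < t) :
    ∃ K, 0 ≤ K ∧ ∀ m : ℕ, ((m:ℝ)+1)^N * s^(m+1) ≤ K * t^m := by
  have ht : 0 < t := hs.trans hst
  have h0 : Tendsto (fun m : ℕ => (m:ℝ)^N * (s/t)^m) atTop (𝓝 0) := by
    exact tendsto_pow_const_mul_const_pow_of_lt_one N (div_nonneg hs.le ht.le) ((div_lt_one ht).2 hst)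
  obtain ⟨K, hK⟩ := h0.bddAbove_range
  have hK' : ∀ m : ℕ, (m:ℝ)^N * (s/t)^m ≤ K := fun m => hK ⟨m, rfl⟩
  have hK0 : 0 ≤ K := le_trans (by positivity) (hK' 1)
  refine ⟨K * t, by positivity, fun m => ?_⟩
  have := hK' (m+1)
  rw [div_pow, ← mul_div_assoc, div_le_iff₀ (by positivity)] at this
  push_cast at this
  calc _ ≤ K * t^(m+1) := this
    _ = _ := by ring

/-- remainders -/
lemma e_bound {C θ s : ℝ} (hC : 0 ≤ C) (hθ : 0 < θ) (hs : θ < s) :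
    ∃ K, 0 ≤ K ∧ ∀ r : ℕ → ℝ, (∀ k, |r k| ≤ C * θ^(k+1)) → ∀ m, |dc r m| ≤ K * s^m := by
  obtain ⟨K, hK, h⟩ := rec_growth (C := C * θ) (K0 := 1) (R := 0) (by positivity) hθ.le hs zero_le_one le_rfl
  refine ⟨K, hK, fun r hr => h r (dc r) (fun _ => 0) (fun k => (hr k).trans (le_of_eq (by ring)))
    (by simp [dc_zero]) (by simp) (by simpa using dc_succ r)⟩

theorem GF.core {n : ℕ} {F : ℝ → ℝ → ℝ} {g : ℝ → ℝ} {d : ℤ} {κ : ℝ} (G : GF (n+1) F g d κ) :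
    ∃ η t R C θ M D C' ρ : ℝ, 0 < η ∧ 0 < t ∧ 1 < R ∧ t * R < 1 ∧ 0 < C ∧ 0 < θ ∧ θ < 1 ∧ 0 ≤ M ∧
      0 ≤ C' ∧ 0 < ρ ∧
      (∀ x, |g x| ≤ M) ∧
      (∀ σ, SD (F σ) g η C θ M D) ∧
      (∀ σ u, |u| ≤ η → ∀ k : ℕ, |cR (F σ) g u (k+1)| ≤ C' * ρ^k) ∧
      WB (fun m _ => t^m) n
        (fun m v => dc (fun k => cR (F v.2) g (η * Real.sin v.1) (k+1)) m) := by
  obtain ⟨B, hB, hlog⟩ := G.logLip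
  obtain ⟨M, hM, hgM, hgL⟩ := G.gBound
  obtain ⟨η0, C, θ, a, hη0, hη1, hC, hθ, hθ1, H⟩ := asymp κ B M G.hκ hB hM
  obtain ⟨s, hs, hs1⟩ := exists_between hθ1
  have hs0 : 0 < s := hθ.trans hs
  obtain ⟨ρ0, t, hρ0, ht0, ht1, HL⟩ := WB.landau n s hs0 hs1
  obtain ⟨ρ1, hρ1, hρ10⟩ := exists_between hρ0
  obtain ⟨ρ2, hρ2, hρ21⟩ := exists_between hρ1
  have hρ2p : 0 < ρ2 := by linarith
  have hlogρ : 0 < Real.log ρ2 := Real.log_pos hρ2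
  obtain ⟨R, hR, hR'⟩ := exists_between ((one_lt_div ht0).2 ht1)
  have hRt : t * R < 1 := by rw [lt_div_iff₀ ht0] at hR'; linarith
  set η := min η0 (Real.log ρ2 / (M+1)) with hη
  have hηp : 0 < η := lt_min hη0 (by positivity)
  have hηM : ∀ u, |u| ≤ η → Real.exp (|u| * M) ≤ ρ2 := by
    intro u hu
    rw [← Real.le_log_iff_exp_le hρ2p]
    have h1 : |u| ≤ Real.log ρ2 / (M+1) := hu.trans (min_le_right _ _)
    rw [le_div_iff₀ (by positivity)] at h1
    nlinarith [abs_nonneg u]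
  have HS : ∀ σ, SD (F σ) g η C θ M (Real.exp a) := by
    intro σ
    refine ⟨(H (F σ) g d 0 (G.em σ) (hlog σ) G.gper hgM hgL (by simpa using hη0.le)).1, fun u hu => ?_⟩
    obtain ⟨_, lam, h1, h2, h3, h4, h5⟩ :=
      H (F σ) g d u (G.em σ) (hlog σ) G.gper hgM hgL (hu.trans (min_le_left _ _))
    exact ⟨lam, h1, h2, h3, h4, fun n => (h5 n).2⟩
  have hcb : ∀ σ u, |u| ≤ η → ∀ k : ℕ, |cR (F σ) g u (k+1)| ≤ (1 + C) * ρ2^(k+1) := by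
    intro σ u hu k
    obtain ⟨lam, h1, h2, h3, h4, h5⟩ := (HS σ).lam u hu
    have e1 := h2 (k+1) (by omega)
    have e2 : lam^(k+1) ≤ ρ2^(k+1) := pow_le_pow_left₀ h1.le (h3.trans (hηM u hu)) _
    have e3 : θ^(k+1) ≤ ρ2^(k+1) := pow_le_pow_left₀ hθ.le (by linarith) _
    have e4 : |cR (F σ) g u (k+1)| ≤ |lam^(k+1)| + |cR (F σ) g u (k+1) - lam^(k+1)| := by
      have := abs_add_le (lam^(k+1)) (cR (F σ) g u (k+1) - lam^(k+1))
      simpa using this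
    rw [abs_of_pos (by positivity : 0 < lam^(k+1))] at e4
    nlinarith
  have hsin : ∀ x, |η * Real.sin x| ≤ η := by
    intro x
    rw [abs_mul, abs_of_pos hηp]
    have := Real.abs_sin_le_one x
    nlinarith
  refine ⟨η, t, R, C, θ, M, Real.exp a, (1+C)*ρ2, ρ2, hηp, ht0, hR, hRt, hC, hθ, hθ1, hM, by positivity, hρ2p,
    hgM, HS, ?_, ?_⟩
  · intro σ u hu k
    exact (hcb σ u hu k).trans (le_of_eq (by ring))
  refine HL _ ?_ ?_
  · have hc := G.coeff η
    obtain ⟨K, hK, hKb⟩ := poly_geom (n+1) hρ2p hρ21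
    have hc' := hc.mono (w' := fun k _ => ρ1^k) (K := (1+C)*K) (fun k v => by
      have h1 := hcb v.2 _ (hsin v.1) k
      have h2 := (le_abs_self _).trans h1
      calc ((k:ℝ)+1)^(n+1) * cR (F v.2) g (η * Real.sin v.1) (k+1)
          ≤ ((k:ℝ)+1)^(n+1) * ((1+C) * ρ2^(k+1)) := by gcongr
        _ = (1+C) * (((k:ℝ)+1)^(n+1) * ρ2^(k+1)) := by ring
        _ ≤ (1+C) * (K * ρ1^k) := mul_le_mul_of_nonneg_left (hKb k) (by linarith)
        _ = _ := by ring) (by positivity)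
    refine WB.recur (r := fun _ _ => 0) (by linarith) hρ10 hc' ?_ ?_ ?_
    · refine (WB.const (fun _ => 0)).mono (K := 1) (fun m v => ?_) zero_le_one
      simp only [abs_zero, one_mul]
      have : 0 < ρ0 := by linarith
      positivity
    · have := (WB.const (ι := Unit) (n := n+1) (fun _ => 1))
      refine (this.congrw (fun i v => by simp)).congr (fun i v => ?_)
      rw [dc_zero]
    · intro m v
      rw [add_zero]
      exact dc_succ _ m
  · obtain ⟨K, hK, hKb⟩ := e_bound hC.le hθ hs
    refine ⟨fun m => ?_, K + ρ2 * (K / s), by positivity, fun m v => ?_⟩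
    · refine (rec_contDiff (n := ((n+1:ℕ):WithTop ℕ∞)) (r := fun _ _ => 0)
        (c := fun k v => cR (F v.2) g (η * Real.sin v.1) (k+1))
        (b := fun m v => dc (fun k => cR (F v.2) g (η * Real.sin v.1) (k+1)) m)
        (fun k => (G.coeff η).contDiff k)
        (fun _ => contDiff_const) ?_ ?_ m).continuous
      · simp only [dc_zero]; exact contDiff_const
      · intro m v
        rw [add_zero]
        exact dc_succ _ m
    · obtain ⟨lam, h1, h2, h3, h4, h5⟩ := (HS v.2).lam _ (hsin v.1)
      have hl := h3.trans (hηM _ (hsin v.1))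
      set r : ℕ → ℝ := fun k => cR (F v.2) g (η * Real.sin v.1) (k+1) - lam^(k+1) with hr
      have e1 : (fun k => cR (F v.2) g (η * Real.sin v.1) (k+1)) = fun k => r k + lam^(k+1) := by
        funext k; simp [hr]
      show |dc (fun k => cR (F v.2) g (η * Real.sin v.1) (k+1)) m| ≤ _
      rw [e1, dc_split]
      have hb := hKb r (fun k => h2 (k+1) (by omega))
      have e2 : |shf (dc r) m| ≤ K / s * s^m := by
        cases m with
        | zero => simp only [shf, abs_zero]; positivity
        | succ m =>
          simp only [shf]
          exact (hb m).trans (le_of_eq (by field_simp; ring))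
      have e3 := abs_sub (dc r m) (lam * shf (dc r) m)
      rw [abs_mul, abs_of_pos h1] at e3
      have e4 : lam * |shf (dc r) m| ≤ ρ2 * (K / s * s^m) :=
        mul_le_mul hl e2 (abs_nonneg _) hρ2p.le
      have e5 := hb m
      show _ ≤ (K + ρ2 * (K / s)) * s^m
      linarith

end PV


namespace PV

/-- the determinant -/
def dd (T g : ℝ → ℝ) (u : ℝ) (z : ℂ) : ℂ := ∑' m, (dc (fun k => cR T g u (k+1)) m : ℂ) * z^m

lemma cR_cont {T g : ℝ → ℝ} {n : ℕ} (h : (periodicPtsIn T n).Finite) : Continuous fun u => cR T g u n := by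
  have : (fun u => cR T g u n) = fun u => ∑ x ∈ h.toFinset,
      Real.exp (-u * birkhoff T g n x) / |deriv T^[n] x - 1| := by
    funext u
    exact finsum_mem_eq_finite_toFinset_sum _ h
  rw [this]
  fun_prop

lemma pv_eq {T g : ℝ → ℝ} {n : ℕ} (h : (periodicPtsIn T n).Finite) (u : ℝ) :
    pvCoeff T g u n = ((n:ℂ))⁻¹ * (cR T g u n : ℂ) := by
  unfold pvCoeff cR
  rw [finsum_mem_eq_finite_toFinset_sum _ h, finsum_mem_eq_finite_toFinset_sum _ h, Complex.ofReal_sum]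

/-- the exponential formula near zero -/
lemma dd_exp {T g : ℝ → ℝ} {u C' ρ : ℝ} (hfin : ∀ n : ℕ, n ≠ 0 → (periodicPtsIn T n).Finite)
    (hC' : 0 ≤ C') (hρ : 0 < ρ) (hc : ∀ k : ℕ, |cR T g u (k+1)| ≤ C' * ρ^k) :
    ∃ r : ℝ, 0 < r ∧ ∀ z : ℂ, ‖z‖ < r →
      dd T g u z = Complex.exp (-∑' n : ℕ, pvCoeff T g u n * z ^ n) := by
  refine ⟨1 / (2 * ρ), by positivity, fun z hz => ?_⟩
  have hr : ρ * (1 / (2*ρ)) < 1 := by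
    have : ρ * (1 / (2*ρ)) = 1/2 := by field_simp
    rw [this]; norm_num
  unfold dd
  rw [dc_exp hC' hρ.le hc (by positivity) hr hz]
  congr 2
  have hterm : ∀ k : ℕ, (cR T g u (k+1) : ℂ) / ((k:ℂ)+1) * z^(k+1) = pvCoeff T g u (k+1) * z^(k+1) := by
    intro k
    rw [pv_eq (hfin (k+1) (by omega))]
    push_cast
    rw [div_eq_inv_mul]
  simp only [hterm]
  have h0 : pvCoeff T g u 0 * z^0 = 0 := by simp [pvCoeff]
  have hsum : Summable fun k : ℕ => pvCoeff T g u (k+1) * z^(k+1) := by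
    have hb : z ∈ Metric.ball (0:ℂ) (1/(2*ρ)) := mem_ball_zero_iff.2 hz
    refine Summable.of_norm_bounded ((ps_sum (K := C') hρ.le (by positivity) hr).mul_left ‖z‖) fun k => ?_
    rw [← hterm]
    have h1 := ps_bound (a := fun k => cR T g u (k+1)) hc k hb
    have h2 : ‖(cR T g u (k+1) : ℂ) / ((k:ℂ)+1) * z^(k+1)‖ ≤ ‖(cR T g u (k+1) : ℂ) * z^k‖ * ‖z‖ := by
      rw [pow_succ, ← mul_assoc, norm_mul, norm_mul, norm_mul, norm_div]
      have h3 : (1:ℝ) ≤ ‖(k:ℂ)+1‖ := by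
        have : ‖(k:ℂ)+1‖ = (k:ℝ)+1 := by
          rw [show (k:ℂ)+1 = ((k+1:ℕ):ℂ) by push_cast; rfl, Complex.norm_natCast]; push_cast; rfl
        rw [this]; linarith [(Nat.cast_nonneg k : (0:ℝ) ≤ k)]
      gcongr
      exact div_le_self (norm_nonneg _) h3
    refine h2.trans ?_
    rw [mul_comm]
    exact mul_le_mul_of_nonneg_left h1 (norm_nonneg _)
  have hs : Summable fun n : ℕ => pvCoeff T g u n * z^n := (summable_nat_add_iff 1).1 hsum
  rw [hs.tsum_eq_zero_add, h0, zero_add]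

/-- factorization of the determinant -/
lemma dd_factor {T g : ℝ → ℝ} {u lam C θ : ℝ} (hC : 0 ≤ C) (hθ : 0 < θ) (hθ1 : θ < 1)
    (h : ∀ n : ℕ, n ≠ 0 → |cR T g u n - lam ^ n| ≤ C * θ ^ n) :
    ∃ R > 1, ∃ e : ℂ → ℂ, DifferentiableOn ℂ e (Metric.ball 0 R) ∧
      (∀ z ∈ Metric.ball (0:ℂ) R, dd T g u z = (1 - lam * z) * e z) ∧
      e 1 = Complex.exp (-∑' k : ℕ, ((cR T g u (k+1) - lam^(k+1) : ℝ) : ℂ) / ((k:ℂ)+1)) := by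
  obtain ⟨s, hs, hs1⟩ := exists_between hθ1
  have hs0 : 0 < s := hθ.trans hs
  obtain ⟨R, hR, hR'⟩ := exists_between ((one_lt_div hs0).2 hs1)
  have hRs : s * R < 1 := by rw [lt_div_iff₀ hs0] at hR'; linarith
  obtain ⟨K, hK, hKb⟩ := e_bound hC hθ hs
  set r : ℕ → ℝ := fun k => cR T g u (k+1) - lam^(k+1) with hr
  have hrb : ∀ k, |r k| ≤ C * θ^(k+1) := fun k => h (k+1) (by omega)
  have hb := hKb r hrb
  have hR0 : 0 ≤ R := by linarith
  refine ⟨R, hR, fun z => ∑' m, (dc r m : ℂ) * z^m, ps_diff hb hs0.le hR0 hRs, ?_, ?_⟩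
  · intro z hz
    have e1 : (fun k => cR T g u (k+1)) = fun k => r k + lam^(k+1) := by
      funext k; simp [hr]
    have hsm : Summable fun m => (dc r m : ℂ) * z^m :=
      Summable.of_norm_bounded (ps_sum (K := K) hs0.le hR0 hRs) fun m => ps_bound hb m hz
    have hsh : HasSum (fun m => (shf (dc r) m : ℂ) * z^m) (z * ∑' m, (dc r m : ℂ) * z^m) := by
      rw [← hasSum_nat_add_iff' 1]
      simp only [Finset.range_one, Finset.sum_singleton, shf, Complex.ofReal_zero, zero_mul, sub_zero]
      have := hsm.hasSum.mul_left z
      refine this.congr_fun ?_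
      intro m
      ring
    have h2 := hsm.hasSum.sub (hsh.mul_left (lam:ℂ))
    unfold dd
    rw [e1]
    have h3 : (fun m => (dc (fun k => r k + lam^(k+1)) m : ℂ) * z^m) =
        fun m => (dc r m : ℂ) * z^m - lam * ((shf (dc r) m : ℂ) * z^m) := by
      funext m
      rw [dc_split]; push_cast; ring
    rw [h3, h2.tsum_eq]
    ring
  · obtain ⟨r', h1, h2⟩ := exists_between ((one_lt_div hθ).2 hθ1)
    have h3 : θ * r' < 1 := by rw [lt_div_iff₀ hθ] at h2; linarith
    have := dc_exp (c := r) (C := C * θ) (ρ := θ) (r := r') (by positivity) hθ.le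
      (fun k => (hrb k).trans (le_of_eq (by ring))) (by linarith) h3 (z := 1) (by simpa using h1)
    simp only [one_pow, mul_one] at this ⊢
    exact this

lemma deriv_mul_zero {f h : ℝ → ℂ} {L : ℂ} (hf : HasDerivAt f L 0) (h0 : f 0 = 0)
    (hh : ContinuousAt h 0) : HasDerivAt (fun u => f u * h u) (L * h 0) 0 := by
  rw [hasDerivAt_iff_tendsto_slope] at hf ⊢
  have h1 : Tendsto h (𝓝[≠] 0) (𝓝 (h 0)) := hh.tendsto.mono_left nhdsWithin_le_nhds
  refine (hf.mul h1).congr fun u => ?_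
  simp only [slope, vsub_eq_sub, h0, zero_mul, sub_zero, smul_mul_assoc]

theorem one_map {T g : ℝ → ℝ} {d : ℤ} {κ η C θ M D : ℝ} (E : EM T d κ) (hg : Continuous g)
    (hgp : ∀ x, g (x+1) = g x) (hgM : ∀ x, |g x| ≤ M) (S : SD T g η C θ M D) (hη : 0 < η) (hC : 0 ≤ C)
    (hθ : 0 < θ) (hθ1 : θ < 1)
    (μ : Measure 𝕊) [IsProbabilityMeasure μ] (hμ : Measure.map (circleMapC T) μ = μ) (hac : μ ≪ volume)
    {L : ℂ} (hL : HasDerivAt (fun u : ℝ => dd T g u 1) L 0) :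
    ∃ e0 : ℂ, e0 ≠ 0 ∧ HasDerivAt (fun z : ℂ => dd T g 0 z) (-e0) 1 ∧
      ((∫ y, circleFun g y ∂μ : ℝ) : ℂ) = L / e0 := by
  choose! lam hl0 hl1 hl2 hl3 hl4 using S.lam
  have hη0 : |(0:ℝ)| ≤ η := by simpa using hη.le
  have lam0 : lam 0 = 1 := by
    have h1 := hl2 0 hη0
    have h2 := hl3 0 hη0
    simp at h1 h2
    linarith
  set q : ℝ → ℂ := fun u => Complex.exp (-∑' k : ℕ, ((cR T g u (k+1) - (lam u)^(k+1) : ℝ) : ℂ) / ((k:ℂ)+1)) with hq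
  have near : ∀ᶠ u in 𝓝 (0:ℝ), |u| ≤ η := by
    have : Tendsto (fun u : ℝ => |u|) (𝓝 0) (𝓝 |0|) := continuous_abs.continuousAt
    rw [abs_zero] at this
    filter_upwards [this.eventually (gt_mem_nhds hη)] with u hu using hu.le
  have hd1 : ∀ u, |u| ≤ η → dd T g u 1 = (1 - lam u) * q u := by
    intro u hu
    obtain ⟨R, hR, e, he, h1, h2⟩ := dd_factor hC hθ hθ1 (hl1 u hu)
    rw [h1 1 (by simpa using hR), h2, mul_one]
  have lamc : Tendsto lam (𝓝 0) (𝓝 1) := by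
    have t1 : Tendsto (fun u : ℝ => Real.exp (|u| * M)) (𝓝 0) (𝓝 1) := by
      have : Continuous fun u : ℝ => Real.exp (|u| * M) := by fun_prop
      simpa using this.tendsto 0
    have t2 : Tendsto (fun u : ℝ => Real.exp (-(|u| * M))) (𝓝 0) (𝓝 1) := by
      have : Continuous fun u : ℝ => Real.exp (-(|u| * M)) := by fun_prop
      simpa using this.tendsto 0
    exact tendsto_of_tendsto_of_tendsto_of_le_of_le' t2 t1
      (near.mono fun u hu => hl3 u hu) (near.mono fun u hu => hl2 u hu)
  have qc : ContinuousAt q 0 := by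
    refine Complex.continuous_exp.continuousAt.comp (ContinuousAt.neg ?_)
    refine tendsto_tsum_of_dominated_convergence (bound := fun k : ℕ => C * θ * θ^k)
      ((summable_geometric_of_lt_one hθ.le hθ1).mul_left _) (fun k => ?_) ?_
    · refine Tendsto.div_const ?_ _
      refine (Complex.continuous_ofReal.tendsto _).comp ?_
      refine Tendsto.sub ((cR_cont (S.fin (k+1) (by omega))).tendsto 0) ?_
      rw [lam0]
      exact lamc.pow _
    · filter_upwards [near] with u hu k
      rw [norm_div, Complex.norm_real, Real.norm_eq_abs]
      have h3 : (1:ℝ) ≤ ‖(k:ℂ)+1‖ := by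
        have : ‖(k:ℂ)+1‖ = (k:ℝ)+1 := by
          rw [show (k:ℂ)+1 = ((k+1:ℕ):ℂ) by push_cast; rfl, Complex.norm_natCast]; push_cast; rfl
        rw [this]; linarith [(Nat.cast_nonneg k : (0:ℝ) ≤ k)]
      refine (div_le_self (abs_nonneg _) h3).trans ((hl1 u hu (k+1) (by omega)).trans (le_of_eq (by ring)))
  have q0 : ∀ u, q u ≠ 0 := fun u => Complex.exp_ne_zero _
  refine ⟨q 0, q0 0, ?_, ?_⟩
  · obtain ⟨R, hR, e, he, h1, h2⟩ := dd_factor hC hθ hθ1 (hl1 0 hη0)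
    have h1b : (1:ℂ) ∈ Metric.ball (0:ℂ) R := by simpa using hR
    have hnb := Metric.isOpen_ball.mem_nhds h1b
    have hed := (he.differentiableAt hnb).hasDerivAt
    have h3 : HasDerivAt (fun z : ℂ => (1 - z) * e z) ((-1) * e 1 + (1 - 1) * deriv e 1) 1 :=
      ((hasDerivAt_id (1:ℂ)).const_sub 1).mul hed
    have h4 : (-1) * e 1 + (1 - 1) * deriv e 1 = - q 0 := by rw [h2]; simp [hq]
    rw [h4] at h3
    refine h3.congr_of_eventuallyEq ?_
    filter_upwards [hnb] with z hz
    rw [h1 z hz, lam0]; simp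
  · have hd0 : dd T g 0 1 = 0 := by rw [hd1 0 hη0, lam0]; simp
    have h1 := deriv_mul_zero hL hd0 (qc.inv₀ (q0 0))
    have h2 : HasDerivAt (fun u : ℝ => ((lam u : ℝ) : ℂ)) (-(L * (q 0)⁻¹)) 0 := by
      refine (h1.const_sub 1).congr_of_eventuallyEq ?_
      filter_upwards [near] with u hu
      simp only [Pi.inv_apply]
      rw [hd1 u hu, mul_assoc, mul_inv_cancel₀ (q0 u)]
      ring
    have h3 : HasDerivAt (fun u : ℝ => lam u) (-(L * (q 0)⁻¹)).re 0 := by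
      have := Complex.reCLM.hasFDerivAt.comp_hasDerivAt (0:ℝ) h2
      simpa [Function.comp_def] using this
    have h4 : HasDerivAt (fun u : ℝ => (0:ℝ)) (-(L * (q 0)⁻¹)).im 0 := by
      have := Complex.imCLM.hasFDerivAt.comp_hasDerivAt (0:ℝ) h2
      simpa [Function.comp_def] using this
    have him : (-(L * (q 0)⁻¹)).im = 0 := h4.unique (hasDerivAt_const _ _)
    set G := ∫ y, circleFun g y ∂μ with hG
    have h5 : HasDerivAt (fun u : ℝ => Real.exp (-u * G)) (-G) 0 := by
      have := (((hasDerivAt_id (0:ℝ)).neg).mul_const G).exp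
      simpa using this
    have h6 := h3.sub h5
    have h7 : IsLocalMin (fun u => lam u - Real.exp (-u * G)) 0 := by
      filter_upwards [near] with u hu
      have := lam_lower E hg hgp hgM μ hμ hac (hl0 u hu) (hl4 u hu)
      rw [lam0]
      simp
      simpa using this
    have h8 := h7.hasDerivAt_eq_zero h6
    have h9 : G = -(-(L * (q 0)⁻¹)).re := by linarith
    have h10 : L / q 0 = (G : ℂ) := by
      rw [div_eq_mul_inv]
      apply Complex.ext
      · rw [h9]; simp
      · simp only [Complex.neg_im, neg_eq_zero] at him
        rw [him]; simp
    exact h10.symm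

end PV


namespace PV

/-- the family version of the determinant statement -/
theorem family {ε : ℝ} (hε : 0 < ε) {T : ℝ → ℝ → ℝ} {g : ℝ → ℝ} {n r : ℕ} (hr : n + 3 ≤ r)
    (hn : 1 ≤ n)
    (hT : CNFamilyU (n+1) r (Ioo (-ε) ε) T)
    (hTexp : ∀ τ ∈ Ioo (-ε) ε, (∃ d : ℤ, IsCircleLift (T τ) d) ∧ ∀ x, 1 < |deriv (T τ) x|)
    (hg : ContDiff ℝ (n+1 : ℕ) g) (hgper : ∀ x, g (x + 1) = g x)
    (μ : ℝ → Measure 𝕊)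
    (hμ : ∀ τ ∈ Ioo (-ε) ε, IsProbabilityMeasure (μ τ) ∧
      Measure.map (circleMapC (T τ)) (μ τ) = μ τ ∧ μ τ ≪ (volume : Measure 𝕊)) :
    ∃ R : ℝ, 1 < R ∧ ∃ ε' : ℝ, 0 < ε' ∧ ε' ≤ ε ∧
      (∀ u τ : ℝ, |u| < ε' → |τ| < ε' →
        DifferentiableOn ℂ (fun z => dd (T τ) g u z) (Metric.ball 0 R) ∧
        ∃ ρ : ℝ, 0 < ρ ∧ ∀ z : ℂ, ‖z‖ < ρ →
          dd (T τ) g u z = Complex.exp (-∑' n : ℕ, pvCoeff (T τ) g u n * z ^ n)) ∧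
      ContDiffOn ℝ n (fun p : ℂ × ℝ × ℝ => dd (T p.2.2) g p.2.1 p.1)
        (Metric.ball 0 R ×ˢ Ioo (-ε') ε' ×ˢ Ioo (-ε') ε') ∧
      (∀ τ : ℝ, |τ| < ε' → deriv (fun z : ℂ => dd (T τ) g 0 z) 1 ≠ 0 ∧
        ((∫ y, circleFun g y ∂(μ τ) : ℝ) : ℂ) =
          -(deriv (fun u : ℝ => dd (T τ) g u 1) 0) / deriv (fun z : ℂ => dd (T τ) g 0 z) 1) := by
  obtain ⟨d, κ, G⟩ := exists_GF hε (N := n+1) (by omega) (by omega) hT hTexp hg hgper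
  obtain ⟨η, t, R, C, θ, M, D, C', ρ, hη, ht, hR, htR, hC, hθ, hθ1, hM, hC', hρ, hgM, hSD, hcR, hWB⟩ := G.core
  set δ : ℝ := ε/2 with hδ
  have hδ0 : 0 < δ := by positivity
  have hR0 : 0 < R := by linarith
  set ε' := min η δ with hε'
  have hε'0 : 0 < ε' := lt_min hη hδ0
  have hsub : ∀ {s c : ℝ}, 0 < c → |s| < c → -1 < s / c ∧ s / c < 1 := by
    intro s c hc hs
    rw [abs_lt] at hs
    constructor
    · rw [lt_div_iff₀ hc]; linarith
    · rw [div_lt_one hc]; exact hs.2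
  have hasin : ∀ {s c : ℝ}, 0 < c → |s| < c → c * Real.sin (Real.arcsin (s / c)) = s := by
    intro s c hc hs
    obtain ⟨h1, h2⟩ := hsub hc hs
    rw [Real.sin_arcsin h1.le h2.le]
    field_simp
  set a : ℕ → V → ℝ := fun m v => dc (fun k => cR (T (δ * Real.sin v.2)) g (η * Real.sin v.1) (k+1)) m with ha
  have hPS : ∀ (z : ℂ) (u τ : ℝ), |u| < η → |τ| < δ →
      dd (T τ) g u z = PS a (z, (Real.arcsin (u/η), Real.arcsin (τ/δ))) := by
    intro z u τ hu hτ
    simp only [dd, PS, ha, hasin hη hu, hasin hδ0 hτ]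
  have hFT : ∀ τ : ℝ, |τ| < δ → T (δ * Real.sin (Real.arcsin (τ/δ))) = T τ := by
    intro τ hτ
    rw [hasin hδ0 hτ]
  have hlt1 : ∀ {s}, |s| < ε' → |s| < η := fun h => h.trans_le (min_le_left _ _)
  have hlt2 : ∀ {s}, |s| < ε' → |s| < δ := fun h => h.trans_le (min_le_right _ _)
  have hCD : ContDiffOn ℝ n (fun p : ℂ × ℝ × ℝ => dd (T p.2.2) g p.2.1 p.1)
        (Metric.ball 0 R ×ˢ Ioo (-ε') ε' ×ˢ Ioo (-ε') ε') := by
    have h1 := PS.contDiffOn (a := a) hWB ht hR0 htR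
    have h2 : ContDiffOn ℝ n (fun p : ℂ × ℝ × ℝ => ((p.1, (Real.arcsin (p.2.1/η), Real.arcsin (p.2.2/δ))) : ℂ × V))
        (Metric.ball 0 R ×ˢ Ioo (-ε') ε' ×ˢ Ioo (-ε') ε') := by
      rintro ⟨z, u, τ⟩ ⟨hz, hu, hτ⟩
      have hu' := hsub hη (hlt1 (abs_lt.2 hu))
      have hτ' := hsub hδ0 (hlt2 (abs_lt.2 hτ))
      apply ContDiffAt.contDiffWithinAt
      refine contDiffAt_fst.prodMk (ContDiffAt.prodMk ?_ ?_)
      · exact ContDiffAt.comp (g := Real.arcsin) (f := fun p : ℂ × ℝ × ℝ => p.2.1/η) (z, u, τ)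
          (Real.contDiffAt_arcsin (x := u/η) hu'.1.ne' hu'.2.ne)
          (contDiff_snd.fst.div_const η).contDiffAt
      · exact ContDiffAt.comp (g := Real.arcsin) (f := fun p : ℂ × ℝ × ℝ => p.2.2/δ) (z, u, τ)
          (Real.contDiffAt_arcsin (x := τ/δ) hτ'.1.ne' hτ'.2.ne)
          (contDiff_snd.snd.div_const δ).contDiffAt
    refine (h1.comp h2 ?_).congr ?_
    · rintro ⟨z, u, τ⟩ ⟨hz, hu, hτ⟩
      exact ⟨hz, mem_univ _⟩
    · rintro ⟨z, u, τ⟩ ⟨hz, hu, hτ⟩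
      exact hPS z u τ (hlt1 (abs_lt.2 hu)) (hlt2 (abs_lt.2 hτ))
  refine ⟨R, hR, ε', hε'0, (min_le_right _ _).trans (by rw [hδ]; linarith), ?_, hCD, ?_⟩
  · intro u τ hu hτ
    have hu1 := hlt1 hu
    have hτ1 := hlt2 hτ
    constructor
    · obtain ⟨_, K, hK, hb⟩ := hWB.zero
      have := ps_diff (a := fun m => a m (Real.arcsin (u/η), Real.arcsin (τ/δ))) (K := K) (s := t)
        (fun m => hb m (Real.arcsin (u/η), Real.arcsin (τ/δ))) ht.le hR0.le htR
      exact this.congr fun z _ => hPS z u τ hu1 hτ1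
    · have hf := (hSD (Real.arcsin (τ/δ))).fin
      have hc := hcR (Real.arcsin (τ/δ)) u hu1.le
      simp only [hFT τ hτ1] at hf hc
      exact dd_exp hf hC' hρ hc
  · intro τ hτ
    have hτ1 := hlt2 hτ
    have hτε : τ ∈ Ioo (-ε) ε := abs_lt.1 (hτ1.trans (by rw [hδ]; linarith))
    obtain ⟨hp, hinv, hac⟩ := hμ τ hτε
    have hE := G.em (Real.arcsin (τ/δ))
    have hS := hSD (Real.arcsin (τ/δ))
    simp only [hFT τ hτ1] at hE hS
    have hopen : IsOpen (Metric.ball (0:ℂ) R ×ˢ Ioo (-ε') ε' ×ˢ Ioo (-ε') ε') :=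
      Metric.isOpen_ball.prod (isOpen_Ioo.prod isOpen_Ioo)
    have hmem : ((1:ℂ), (0:ℝ), τ) ∈ Metric.ball (0:ℂ) R ×ˢ Ioo (-ε') ε' ×ˢ Ioo (-ε') ε' := by
      refine ⟨by simpa using hR, ⟨by simpa using hε'0, hε'0⟩, abs_lt.1 hτ⟩
    have hd : DifferentiableAt ℝ (fun p : ℂ × ℝ × ℝ => dd (T p.2.2) g p.2.1 p.1) ((1:ℂ), (0:ℝ), τ) :=
      (hCD.contDiffAt (hopen.mem_nhds hmem)).differentiableAt (by exact_mod_cast (by omega : n ≠ 0))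
    have hL : DifferentiableAt ℝ (fun u : ℝ => dd (T τ) g u 1) 0 :=
      DifferentiableAt.comp (f := fun u : ℝ => ((1:ℂ), u, τ)) (0:ℝ) hd (by fun_prop)
    obtain ⟨e0, he0, h1, h2⟩ := one_map hE hg.continuous hgper hgM hS hη hC.le hθ hθ1 (μ τ) hinv hac hL.hasDerivAt
    rw [h1.deriv, h2]
    exact ⟨neg_ne_zero.2 he0, by rw [neg_div_neg_eq]⟩

/-- the derivative computation -/
lemma quot_deriv {d : ℂ → ℝ → ℝ → ℂ} {R ε' : ℝ} (hR : 1 < R) (hε' : 0 < ε')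
    (hol : ∀ τ : ℝ, |τ| < ε' → DifferentiableOn ℂ (fun z => d z 0 τ) (Metric.ball 0 R))
    (hCD : ContDiffOn ℝ 2 (fun p : ℂ × ℝ × ℝ => d p.1 p.2.1 p.2.2)
        (Metric.ball 0 R ×ˢ Ioo (-ε') ε' ×ˢ Ioo (-ε') ε'))
    {I : ℝ → ℂ}
    (hI : ∀ τ : ℝ, |τ| < ε' → deriv (fun z : ℂ => d z 0 τ) 1 ≠ 0 ∧
      I τ = -(deriv (fun u : ℝ => d 1 u τ) 0) / deriv (fun z : ℂ => d z 0 τ) 1) :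
    deriv I 0 = -(deriv (fun τ : ℝ => deriv (fun u : ℝ => d 1 u τ) 0) 0) /
              deriv (fun z : ℂ => d z 0 0) 1 +
            deriv (fun τ : ℝ => deriv (fun z : ℂ => d z 0 τ) 1) 0 *
              deriv (fun u : ℝ => d 1 u 0) 0 /
              (deriv (fun z : ℂ => d z 0 0) 1) ^ 2 := by
  set Φ : ℂ × ℝ × ℝ → ℂ := fun p => d p.1 p.2.1 p.2.2 with hΦ
  have hopen : IsOpen (Metric.ball (0:ℂ) R ×ˢ Ioo (-ε') ε' ×ˢ Ioo (-ε') ε') :=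
    Metric.isOpen_ball.prod (isOpen_Ioo.prod isOpen_Ioo)
  have hmem : ∀ τ : ℝ, |τ| < ε' → ((1:ℂ), (0:ℝ), τ) ∈ Metric.ball (0:ℂ) R ×ˢ Ioo (-ε') ε' ×ˢ Ioo (-ε') ε' :=
    fun τ hτ => ⟨by simpa using hR, ⟨by simpa using hε', hε'⟩, abs_lt.1 hτ⟩
  have hC : ∀ τ : ℝ, |τ| < ε' → ContDiffAt ℝ 2 Φ ((1:ℂ), (0:ℝ), τ) := fun τ hτ =>
    hCD.contDiffAt (hopen.mem_nhds (hmem τ hτ))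
  have hD : ∀ τ : ℝ, |τ| < ε' → HasFDerivAt Φ (fderiv ℝ Φ ((1:ℂ), (0:ℝ), τ)) ((1:ℂ), (0:ℝ), τ) := fun τ hτ =>
    ((hC τ hτ).differentiableAt (by norm_num)).hasFDerivAt
  have h00 : |(0:ℝ)| < ε' := by simpa using hε'
  have near : ∀ᶠ τ in 𝓝 (0:ℝ), |τ| < ε' := by
    have : Tendsto (fun u : ℝ => |u|) (𝓝 0) (𝓝 |0|) := continuous_abs.continuousAt
    rw [abs_zero] at this
    exact this.eventually (gt_mem_nhds hε')
  have hA : ∀ τ : ℝ, |τ| < ε' → deriv (fun u : ℝ => d 1 u τ) 0 =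
      fderiv ℝ Φ ((1:ℂ), (0:ℝ), τ) ((0:ℂ), (1:ℝ), (0:ℝ)) := by
    intro τ hτ
    have hc : HasDerivAt (fun u : ℝ => (((1:ℂ), u, τ) : ℂ × ℝ × ℝ)) ((0:ℂ), (1:ℝ), (0:ℝ)) 0 :=
      (hasDerivAt_const (0:ℝ) (1:ℂ)).prodMk ((hasDerivAt_id (0:ℝ)).prodMk (hasDerivAt_const (0:ℝ) τ))
    exact ((hD τ hτ).comp_hasDerivAt (0:ℝ) hc).deriv
  have hB : ∀ τ : ℝ, |τ| < ε' → deriv (fun z : ℂ => d z 0 τ) 1 =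
      fderiv ℝ Φ ((1:ℂ), (0:ℝ), τ) ((1:ℂ), (0:ℝ), (0:ℝ)) := by
    intro τ hτ
    have hc : HasDerivAt (fun s : ℝ => (((s:ℂ), (0:ℝ), τ) : ℂ × ℝ × ℝ)) ((1:ℂ), (0:ℝ), (0:ℝ)) 1 :=
      (Complex.ofRealCLM.hasDerivAt (x := (1:ℝ))).prodMk ((hasDerivAt_const (1:ℝ) (0:ℝ)).prodMk (hasDerivAt_const (1:ℝ) τ))
    have h1 : HasFDerivAt Φ (fderiv ℝ Φ ((1:ℂ), (0:ℝ), τ)) (((1:ℝ):ℂ), (0:ℝ), τ) := by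
      rw [Complex.ofReal_one]; exact hD τ hτ
    have h2 : HasDerivAt (fun s : ℝ => d (s:ℂ) 0 τ) (fderiv ℝ Φ ((1:ℂ), (0:ℝ), τ) ((1:ℂ), (0:ℝ), (0:ℝ))) 1 :=
      HasFDerivAt.comp_hasDerivAt (l := Φ) (f := fun s : ℝ => (((s:ℂ), (0:ℝ), τ) : ℂ × ℝ × ℝ)) (1:ℝ) h1 hc
    have h3 : HasDerivAt (fun z : ℂ => d z 0 τ) (deriv (fun z : ℂ => d z 0 τ) 1) ((1:ℝ):ℂ) := by
      rw [Complex.ofReal_one]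
      exact ((hol τ hτ).differentiableAt (Metric.isOpen_ball.mem_nhds (by simpa using hR))).hasDerivAt
    exact h3.comp_ofReal.unique h2
  have hfd : DifferentiableAt ℝ (fun τ : ℝ => fderiv ℝ Φ ((1:ℂ), (0:ℝ), τ)) 0 := by
    have h1 : ContDiffAt ℝ 1 (fderiv ℝ Φ) ((1:ℂ), (0:ℝ), (0:ℝ)) :=
      (hC 0 h00).fderiv_right (by norm_num)
    exact DifferentiableAt.comp (f := fun τ : ℝ => ((1:ℂ), (0:ℝ), τ)) (0:ℝ)
      (h1.differentiableAt (by norm_num)) (by fun_prop)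
  have hAe : (fun τ : ℝ => deriv (fun u : ℝ => d 1 u τ) 0) =ᶠ[𝓝 0]
      fun τ => fderiv ℝ Φ ((1:ℂ), (0:ℝ), τ) ((0:ℂ), (1:ℝ), (0:ℝ)) := near.mono hA
  have hBe : (fun τ : ℝ => deriv (fun z : ℂ => d z 0 τ) 1) =ᶠ[𝓝 0]
      fun τ => fderiv ℝ Φ ((1:ℂ), (0:ℝ), τ) ((1:ℂ), (0:ℝ), (0:ℝ)) := near.mono hB
  have hAd : DifferentiableAt ℝ (fun τ : ℝ => deriv (fun u : ℝ => d 1 u τ) 0) 0 :=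
    (hfd.clm_apply (differentiableAt_const _)).congr_of_eventuallyEq hAe
  have hBd : DifferentiableAt ℝ (fun τ : ℝ => deriv (fun z : ℂ => d z 0 τ) 1) 0 :=
    (hfd.clm_apply (differentiableAt_const _)).congr_of_eventuallyEq hBe
  have hIe : I =ᶠ[𝓝 0] fun τ => -(deriv (fun u : ℝ => d 1 u τ) 0) / deriv (fun z : ℂ => d z 0 τ) 1 :=
    near.mono fun τ hτ => (hI τ hτ).2
  have hne := (hI 0 h00).1
  have hq := (hAd.hasDerivAt.neg.div hBd.hasDerivAt hne)
  rw [(hq.congr_of_eventuallyEq hIe).deriv]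
  simp only [Pi.neg_apply]
  field_simp
  ring

lemma deriv_ofReal_aux (f : ℝ → ℝ) (x : ℝ) : ((deriv f x : ℝ) : ℂ) = deriv (fun t => (f t : ℂ)) x := by
  by_cases h : DifferentiableAt ℝ f x
  · exact h.hasDerivAt.ofReal_comp.deriv.symm
  · rw [deriv_zero_of_not_differentiableAt h, deriv_zero_of_not_differentiableAt]
    · simp
    · intro h'
      exact h (Complex.reCLM.differentiableAt.comp x h')

end PV

/-- Corollary `adaptation`, linear response.  Let `τ ↦ T_τ` be a
`C²` curve on `(−ε,ε)` of `C⁷` expanding maps of the circle and `g` a `C⁶` function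
on the circle; for each `τ` let `μ_τ` be the unique `T_τ`-invariant probability
measure absolutely continuous with respect to Lebesgue.  Then there is `R > 1` such
that for all `u, τ` close to `0` the dynamical determinant extends holomorphically to
`d(·,u,τ)` on `D(0,R)`; `d` is `C¹` and `∫ g dμ_τ = −∂_u d(1,0,τ)/∂_z d(1,0,τ)`.
If moreover `τ ↦ T_τ` is a `C³` curve of `C⁸` expanding maps and `g` is `C⁷`, then
`d` is `C²` and the linear response formula holds:
`(d/dτ) ∫ g dμ_τ |_{τ=0} = −∂²_{uτ} d(1,0,0)/∂_z d(1,0,0)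
  + ∂²_{τz} d(1,0,0) ∂_u d(1,0,0)/(∂_z d(1,0,0))²`. -/
theorem statement1
    (ε : ℝ) (hε : 0 < ε)
    (T : ℝ → ℝ → ℝ) (g : ℝ → ℝ)
    (hT : CNFamilyU 2 7 (Ioo (-ε) ε) T)
    (hTexp : ∀ τ ∈ Ioo (-ε) ε, ContDiff ℝ 7 (T τ) ∧ (∃ d : ℤ, IsCircleLift (T τ) d) ∧
      ∀ x, 1 < |deriv (T τ) x|)
    (hg : ContDiff ℝ 6 g) (hgper : ∀ x, g (x + 1) = g x)
    (μ : ℝ → Measure 𝕊)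
    (hμ : ∀ τ ∈ Ioo (-ε) ε, IsProbabilityMeasure (μ τ) ∧
      Measure.map (circleMapC (T τ)) (μ τ) = μ τ ∧ μ τ ≪ (volume : Measure 𝕊) ∧
      ∀ ν : Measure 𝕊, IsProbabilityMeasure ν →
        Measure.map (circleMapC (T τ)) ν = ν → ν ≪ (volume : Measure 𝕊) → ν = μ τ) :
    ∃ R : ℝ, 1 < R ∧ ∃ ε' : ℝ, 0 < ε' ∧ ε' ≤ ε ∧
    ∃ d : ℂ → ℝ → ℝ → ℂ,
      -- holomorphic extension of the dynamical determinant on `D(0,R)`,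
      -- for `u, τ` close to `0`
      (∀ u τ : ℝ, |u| < ε' → |τ| < ε' →
        DifferentiableOn ℂ (fun z => d z u τ) (Metric.ball 0 R) ∧
        ∃ ρ : ℝ, 0 < ρ ∧ ∀ z : ℂ, ‖z‖ < ρ →
          d z u τ = Complex.exp (-∑' n : ℕ, pvCoeff (T τ) g u n * z ^ n)) ∧
      -- `d` is `C¹`
      ContDiffOn ℝ 1 (fun p : ℂ × ℝ × ℝ => d p.1 p.2.1 p.2.2)
        (Metric.ball 0 R ×ˢ Ioo (-ε') ε' ×ˢ Ioo (-ε') ε') ∧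
      -- the formula for `∫ g dμ_τ`
      (∀ τ : ℝ, |τ| < ε' →
        ∫ y, circleFun g y ∂(μ τ) =
          -(deriv (fun u : ℝ => d 1 u τ) 0) / deriv (fun z : ℂ => d z 0 τ) 1) ∧
      -- the `C³`/`C⁸`/`C⁷` case: `d` is `C²` and linear response holds
      ((CNFamilyU 3 8 (Ioo (-ε) ε) T ∧ (∀ τ ∈ Ioo (-ε) ε, ContDiff ℝ 8 (T τ)) ∧
          ContDiff ℝ 7 g) →
        ContDiffOn ℝ 2 (fun p : ℂ × ℝ × ℝ => d p.1 p.2.1 p.2.2)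
          (Metric.ball 0 R ×ˢ Ioo (-ε') ε' ×ˢ Ioo (-ε') ε') ∧
        (deriv (fun τ : ℝ => ∫ y, circleFun g y ∂(μ τ)) 0 : ℂ) =
          -(deriv (fun τ : ℝ => deriv (fun u : ℝ => d 1 u τ) 0) 0) /
              deriv (fun z : ℂ => d z 0 0) 1 +
            deriv (fun τ : ℝ => deriv (fun z : ℂ => d z 0 τ) 1) 0 *
              deriv (fun u : ℝ => d 1 u 0) 0 /
              (deriv (fun z : ℂ => d z 0 0) 1) ^ 2) := by
  have hE : ∀ τ ∈ Ioo (-ε) ε, (∃ d : ℤ, IsCircleLift (T τ) d) ∧ ∀ x, 1 < |deriv (T τ) x| :=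
    fun τ hτ => (hTexp τ hτ).2
  have hM : ∀ τ ∈ Ioo (-ε) ε, IsProbabilityMeasure (μ τ) ∧
      Measure.map (circleMapC (T τ)) (μ τ) = μ τ ∧ μ τ ≪ (volume : Measure 𝕊) :=
    fun τ hτ => ⟨(hμ τ hτ).1, (hμ τ hτ).2.1, (hμ τ hτ).2.2.1⟩
  by_cases hcase : CNFamilyU 3 8 (Ioo (-ε) ε) T ∧ (∀ τ ∈ Ioo (-ε) ε, ContDiff ℝ 8 (T τ)) ∧
          ContDiff ℝ 7 g
  · obtain ⟨R, hR, ε', hε', hle, h1, h2, h3⟩ := PV.family hε (n := 2) (r := 8) (by norm_num) (by norm_num)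
      hcase.1 hE (hg.of_le (by norm_num)) hgper μ hM
    refine ⟨R, hR, ε', hε', hle, fun z u τ => PV.dd (T τ) g u z, h1, h2.of_le (by norm_num),
      fun τ hτ => (h3 τ hτ).2, fun _ => ⟨h2, ?_⟩⟩
    have h0 : |(0:ℝ)| < ε' := by simpa using hε'
    have key := PV.quot_deriv (d := fun z u τ => PV.dd (T τ) g u z) hR hε'
      (fun τ hτ => (h1 0 τ h0 hτ).1) h2 (I := fun τ => ((∫ y, circleFun g y ∂(μ τ) : ℝ) : ℂ)) h3
    simp only [integral_complex_ofReal]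
    exact key
  · obtain ⟨R, hR, ε', hε', hle, h1, h2, h3⟩ := PV.family hε (n := 1) (r := 7) (by norm_num) (by norm_num)
      hT hE (hg.of_le (by norm_num)) hgper μ hM
    exact ⟨R, hR, ε', hε', hle, fun z u τ => PV.dd (T τ) g u z, h1, h2,
      fun τ hτ => (h3 τ hτ).2, fun h => absurd h hcase⟩
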